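/- arXiv:0809.2511 — 5 statements merged into one kernel-verified Lean document; each statement's English description precedes it below -/
import Mathlib

section
/- (One-dimensional criterion, case p = 1.) Let Ω = (α,β) with −∞ ≤ α < β ≤ ∞, let q ≥ 1, let C ≥ 0, and let μ be a nonnegative measure on Ω×Ω which is locally finite outside the diagonal. Then the inequality ( ∫_Ω ∫_Ω |u(x) − u(y)|^q μ(dx,dy) )^{1/q} ≤ C · ∫_Ω |u′(x)| dx holds for every u ∈ C^∞(Ω) if and only if: (a) ( μ(I × (Ω∖Ī)) + μ((Ω∖Ī) × I) )^{1/q} ≤ 2C for every open interval I whose closure Ī is contained in Ω, and (b) ( μ(I × (Ω∖Ī)) + μ((Ω∖Ī) × I) )^{1/q} ≤ C for every interval I ⊆ Ω of the form (α,x] or [x,β) whose closure contains one of the endpoints of Ω. -/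
open MeasureTheory Metric Set Filter
open scoped ENNReal Topology MeasureTheory

noncomputable section

/-- The pairs of real numbers separated by the threshold `t`. -/
def cutPairs (t : ℝ) : Set (ℝ × ℝ) := Iic t ×ˢ Ioi t ∪ Ioi t ×ˢ Iic t

theorem mem_cutPairs {t : ℝ} {z : ℝ × ℝ} :
    z ∈ cutPairs t ↔ min z.1 z.2 ≤ t ∧ t < max z.1 z.2 := by
  simp only [cutPairs, mem_union, mem_prod, mem_Iic, mem_Ioi, inf_le_iff, lt_sup_iff]
  grind

theorem measurableSet_cutPairs (t : ℝ) : MeasurableSet (cutPairs t) :=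
  (measurableSet_Iic.prod measurableSet_Ioi).union (measurableSet_Ioi.prod measurableSet_Iic)

theorem measurableSet_cutPairs_uncurry :
    MeasurableSet {p : (ℝ × ℝ) × ℝ | p.1 ∈ cutPairs p.2} := by
  simp only [mem_cutPairs]
  have hmin : Measurable fun p : (ℝ × ℝ) × ℝ => min p.1.1 p.1.2 := by fun_prop
  have hmax : Measurable fun p : (ℝ × ℝ) × ℝ => max p.1.1 p.1.2 := by fun_prop
  exact (measurableSet_le hmin measurable_snd).inter (measurableSet_lt measurable_snd hmax)

theorem restrict_prod_self_apply_symm {Ω s t : Set ℝ} (μ : Measure (ℝ × ℝ))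
    (hs : MeasurableSet s) (ht : MeasurableSet t) (hst : Disjoint s t) :
    μ.restrict (Ω ×ˢ Ω) (s ×ˢ t ∪ t ×ˢ s) =
      μ ((Ω ∩ s) ×ˢ (Ω ∩ t)) + μ ((Ω ∩ t) ×ˢ (Ω ∩ s)) := by
  rw [measure_union (Set.disjoint_prod.2 (.inl hst)) (ht.prod hs),
    Measure.restrict_apply (hs.prod ht), Measure.restrict_apply (ht.prod hs), prod_inter_prod,
    prod_inter_prod, inter_comm s, inter_comm t]

theorem lintegral_deriv_smoothTransition_affine_le (a b : ℝ) (ha : 0 ≤ a) (Ω : Set ℝ) :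
    ∫⁻ x in Ω, ‖deriv (fun y => Real.smoothTransition (a * y + b)) x‖ₑ ≤ 1 := by
  set u : ℝ → ℝ := fun y => Real.smoothTransition (a * y + b)
  have hmono : Monotone u := fun x y hxy => Real.smoothTransition.monotone (by gcongr)
  have hdiff : Differentiable ℝ u := by
    refine ContDiff.differentiable (n := ((1 : ℕ∞) : WithTop ℕ∞)) ?_ (by simp)
    exact Real.smoothTransition.contDiff.comp (by fun_prop)
  calc ∫⁻ x in Ω, ‖deriv u x‖ₑ ≤ ∫⁻ x in univ, ‖deriv u x‖ₑ := lintegral_mono_set (subset_univ _)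
    _ = ∫⁻ x in univ, ENNReal.ofReal (deriv u x) :=
        lintegral_congr fun x => Real.enorm_of_nonneg hmono.deriv_nonneg
    _ = volume (u '' univ) := lintegral_deriv_eq_volume_image_of_monotoneOn .univ
        (fun x _ => (hdiff x).hasDerivAt.hasDerivWithinAt) (hmono.monotoneOn _)
    _ ≤ volume (Icc (0 : ℝ) 1) := measure_mono <| image_subset_iff.2 fun x _ =>
        ⟨Real.smoothTransition.nonneg _, Real.smoothTransition.le_one _⟩
    _ = 1 := by simp

theorem measure_rpow_le_of_smooth_inequality {ν : Measure (ℝ × ℝ)} {Ω : Set ℝ} {q : ℝ}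
    (hq : 0 < q) {C : ℝ≥0∞}
    (h : ∀ u : ℝ → ℝ, ContDiff ℝ (⊤ : ℕ∞) u →
      (∫⁻ z, ‖u z.1 - u z.2‖ₑ ^ q ∂ν) ^ (1 / q) ≤ C * ∫⁻ x in Ω, ‖deriv u x‖ₑ)
    {S : Set (ℝ × ℝ)} (hSm : MeasurableSet S) (a b : ℕ → ℝ) (ha : ∀ n, 0 ≤ a n)
    (hS : ∀ z ∈ S, ∀ᶠ n in atTop, ‖Real.smoothTransition (a n * z.1 + b n) -
      Real.smoothTransition (a n * z.2 + b n)‖ₑ = 1) :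
    ν S ^ (1 / q) ≤ C := by
  set u : ℕ → ℝ → ℝ := fun n y => Real.smoothTransition (a n * y + b n)
  have hu : ∀ n, ContDiff ℝ (⊤ : ℕ∞) (u n) := fun n =>
    Real.smoothTransition.contDiff.comp (by fun_prop)
  have hbound : ∀ n, ∫⁻ z, ‖u n z.1 - u n z.2‖ₑ ^ q ∂ν ≤ C ^ q := fun n => by
    rw [← ENNReal.rpow_inv_le_iff hq, ← one_div]
    exact (h _ (hu n)).trans
      (mul_le_of_le_one_right' (lintegral_deriv_smoothTransition_affine_le _ _ (ha n) Ω))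
  rw [one_div, ENNReal.rpow_inv_le_iff hq]
  calc ν S = ∫⁻ z, S.indicator 1 z ∂ν := (lintegral_indicator_one hSm).symm
    _ ≤ ∫⁻ z, liminf (fun n => ‖u n z.1 - u n z.2‖ₑ ^ q) atTop ∂ν := by
        refine lintegral_mono fun z => ?_
        by_cases hz : z ∈ S
        swap
        · simp [hz]
        refine le_liminf_of_le (by isBoundedDefault) ?_
        filter_upwards [hS z hz] with n hn
        simp [u, hn, hz]
    _ ≤ liminf (fun n => ∫⁻ z, ‖u n z.1 - u n z.2‖ₑ ^ q ∂ν) atTop :=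
        lintegral_liminf_le fun n => by
          have := (hu n).continuous
          fun_prop
    _ ≤ C ^ q := liminf_le_of_frequently_le' (Eventually.of_forall hbound).frequently

theorem sFinite_restrict_of_isCompact_lt_top {X : Type*} [TopologicalSpace X]
    [SecondCountableTopology X] [LocallyCompactSpace X] [T2Space X] [MeasurableSpace X]
    [OpensMeasurableSpace X] {μ : Measure X} {D : Set X} (hD : IsOpen D)
    (h : ∀ K, IsCompact K → K ⊆ D → μ K < ⊤) : SFinite (μ.restrict D) := by
  have : LocallyCompactSpace D := hD.locallyCompactSpace
  obtain ⟨K, hK, rfl⟩ : IsSigmaCompact D := isSigmaCompact_iff_sigmaCompactSpace.2 inferInstance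
  rw [← iUnion_disjointed, Measure.restrict_iUnion (disjoint_disjointed K)
    (MeasurableSet.disjointed fun n => (hK n).measurableSet)]
  have (n : ℕ) : IsFiniteMeasure (μ.restrict (disjointed K n)) := isFiniteMeasure_restrict.2
    ((measure_mono (disjointed_subset K n)).trans_lt (h _ (hK n) (subset_iUnion K n))).ne
  infer_instance

theorem enorm_sub_le_lintegral_deriv_cutPairs {Ω : Set ℝ} [OrdConnected Ω] {u : ℝ → ℝ}
    (hu : ContDiffOn ℝ 1 u Ω) {z : ℝ × ℝ} (hz : z ∈ Ω ×ˢ Ω) :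
    ‖u z.1 - u z.2‖ₑ ≤
      ∫⁻ t in Ω, {p : (ℝ × ℝ) × ℝ | p.1 ∈ cutPairs p.2}.indicator
        (fun p => ‖deriv u p.2‖ₑ) (z, t) := by
  obtain ⟨x, y⟩ := z
  obtain ⟨hx, hy⟩ := hz
  dsimp only at hx hy ⊢
  have hsub : Icc (min x y) (max x y) ⊆ Ω := OrdConnected.uIcc_subset ‹_› hx hy
  calc ‖u x - u y‖ₑ = ‖u (max x y) - u (min x y)‖ₑ := by
        rcases le_total x y with h | h <;> simp [h, enorm_sub_rev]
    _ ≤ ∫⁻ t in Icc (min x y) (max x y), ‖deriv u t‖ₑ :=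
        enorm_sub_le_lintegral_deriv_of_contDiffOn_Icc (hu.mono hsub) min_le_max
    _ = ∫⁻ t in Ico (min x y) (max x y), ‖deriv u t‖ₑ := by rw [restrict_Ico_eq_restrict_Icc]
    _ = ∫⁻ t in Ω, (Ico (min x y) (max x y)).indicator (fun t => ‖deriv u t‖ₑ) t := by
        rw [lintegral_indicator measurableSet_Ico, Measure.restrict_restrict measurableSet_Ico,
          inter_eq_left.2 (Ico_subset_Icc_self.trans hsub)]
    _ = _ := lintegral_congr fun t => by
        simp only [indicator, mem_ofPred_eq, mem_cutPairs, mem_Ico]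

theorem lintegral_rpow_enorm_sub_le {Ω : Set ℝ} [OrdConnected Ω] {q : ℝ} (hq : 1 ≤ q)
    {M : ℝ≥0∞} {ρ : Measure (ℝ × ℝ)} [SFinite ρ] (hΩ : MeasurableSet Ω)
    (hρ : ∀ᵐ z ∂ρ, z ∈ Ω ×ˢ Ω) (hM : ∀ t ∈ Ω, ρ (cutPairs t) ≤ M ^ q) {u : ℝ → ℝ}
    (hu : ContDiffOn ℝ 1 u Ω) :
    ∫⁻ z, ‖u z.1 - u z.2‖ₑ ^ q ∂ρ ≤ (M * ∫⁻ x in Ω, ‖deriv u x‖ₑ) ^ q := by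
  set W := ∫⁻ x in Ω, ‖deriv u x‖ₑ with hW
  let g : (ℝ × ℝ) × ℝ → ℝ≥0∞ :=
    {p : (ℝ × ℝ) × ℝ | p.1 ∈ cutPairs p.2}.indicator (fun p => ‖deriv u p.2‖ₑ)
  have hderiv : Measurable fun t => ‖deriv u t‖ₑ := (measurable_deriv u).enorm
  have hgm : Measurable g :=
    (hderiv.comp measurable_snd).indicator measurableSet_cutPairs_uncurry
  have hpow (x : ℝ≥0∞) : x ^ q = x ^ (q - 1) * x := by
    conv_lhs => rw [← sub_add_cancel q 1,
      ENNReal.rpow_add_of_nonneg _ _ (by linarith) zero_le_one, ENNReal.rpow_one]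
  have hgW (z : ℝ × ℝ) : ∫⁻ t in Ω, g (z, t) ≤ W :=
    lintegral_mono fun t => indicator_le_self _ _ (z, t)
  calc ∫⁻ z, ‖u z.1 - u z.2‖ₑ ^ q ∂ρ
      ≤ ∫⁻ z, (W ^ (q - 1) * ∫⁻ t in Ω, g (z, t)) ∂ρ := by
        refine lintegral_mono_ae ?_
        filter_upwards [hρ] with z hz
        have hle := enorm_sub_le_lintegral_deriv_cutPairs hu hz
        rw [hpow]
        exact mul_le_mul' (ENNReal.rpow_le_rpow (hle.trans (hgW z)) (by linarith)) hle
    _ = W ^ (q - 1) * ∫⁻ t in Ω, ∫⁻ z, g (z, t) ∂ρ := by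
        rw [lintegral_const_mul _ hgm.lintegral_prod_right', lintegral_lintegral_swap]
        exact hgm.aemeasurable
    _ = W ^ (q - 1) * ∫⁻ t in Ω, ‖deriv u t‖ₑ * ρ (cutPairs t) := by
        congr 1
        refine lintegral_congr fun t => ?_
        rw [← lintegral_indicator_const (measurableSet_cutPairs t)]
        rfl
    _ ≤ W ^ (q - 1) * ∫⁻ t in Ω, ‖deriv u t‖ₑ * M ^ q := by
        gcongr W ^ (q - 1) * ?_
        exact setLIntegral_mono' hΩ fun t ht => by gcongr; exact hM t ht
    _ = (M * W) ^ q := by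
        rw [lintegral_mul_const _ hderiv, ← hW, ← mul_assoc, ← hpow, mul_comm,
          ENNReal.mul_rpow_of_nonneg _ _ (by linarith)]

theorem setLIntegral_prod_self_eq_offDiag (μ : Measure (ℝ × ℝ)) (Ω : Set ℝ) {f : ℝ × ℝ → ℝ≥0∞}
    (hf : ∀ x, f (x, x) = 0) :
    ∫⁻ z in Ω ×ˢ Ω, f z ∂μ = ∫⁻ z in {z | z.1 ≠ z.2} ∩ Ω ×ˢ Ω, f z ∂μ := by
  have hm : MeasurableSet {z : ℝ × ℝ | z.1 ≠ z.2} :=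
    (isOpen_ne_fun continuous_fst continuous_snd).measurableSet
  rw [← Measure.restrict_restrict hm, ← lintegral_indicator hm]
  refine lintegral_congr fun z => ?_
  by_cases hz : z.1 = z.2
  · obtain ⟨x, y⟩ := z
    obtain rfl : x = y := hz
    simp [hf]
  · simp [hz]

theorem eventually_mul_add_nonpos {x c : ℝ} (hx : x < 0) :
    ∀ᶠ n : ℕ in atTop, n * x + c ≤ 0 :=
  ((tendsto_natCast_atTop_atTop (R := ℝ)).atTop_mul_const_of_neg hx
    |>.atBot_add (tendsto_const_nhds (x := c))).eventually_le_atBot 0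

theorem eventually_one_le_mul {x : ℝ} (hx : 0 < x) : ∀ᶠ n : ℕ in atTop, 1 ≤ n * x :=
  ((tendsto_natCast_atTop_atTop (R := ℝ)).atTop_mul_const hx).eventually_ge_atTop 1

theorem eventually_enorm_smoothTransition_sub_Iic {t : ℝ} {z : ℝ × ℝ} (hz : z ∈ cutPairs t) :
    ∀ᶠ n : ℕ in atTop, ‖Real.smoothTransition (n * z.1 + -(n * t)) -
      Real.smoothTransition (n * z.2 + -(n * t))‖ₑ = 1 := by
  have key : ∀ {x y : ℝ}, x ≤ t → t < y → ∀ᶠ n : ℕ in atTop,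
      Real.smoothTransition (n * x + -(n * t)) = 0 ∧
        Real.smoothTransition (n * y + -(n * t)) = 1 := fun {x y} hx hy => by
    filter_upwards [eventually_one_le_mul (sub_pos.2 hy)] with n hn
    refine ⟨Real.smoothTransition.zero_of_nonpos ?_, Real.smoothTransition.one_of_one_le ?_⟩
    · have : (n : ℝ) * x ≤ n * t := by gcongr
      linarith
    · linarith
  rcases hz with ⟨h1, h2⟩ | ⟨h1, h2⟩
  · filter_upwards [key h1 h2] with n hn
    simp [hn]
  · filter_upwards [key h2 h1] with n hn
    simp [hn]

theorem eventually_enorm_smoothTransition_sub_Ici {t : ℝ} {z : ℝ × ℝ}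
    (hz : z ∈ Ici t ×ˢ Iio t ∪ Iio t ×ˢ Ici t) :
    ∀ᶠ n : ℕ in atTop, ‖Real.smoothTransition (n * z.1 + (1 - n * t)) -
      Real.smoothTransition (n * z.2 + (1 - n * t))‖ₑ = 1 := by
  have key : ∀ {x y : ℝ}, x < t → t ≤ y → ∀ᶠ n : ℕ in atTop,
      Real.smoothTransition (n * x + (1 - n * t)) = 0 ∧
        Real.smoothTransition (n * y + (1 - n * t)) = 1 := fun {x y} hx hy => by
    filter_upwards [eventually_mul_add_nonpos (c := 1) (sub_neg.2 hx)] with n hn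
    refine ⟨Real.smoothTransition.zero_of_nonpos ?_, Real.smoothTransition.one_of_one_le ?_⟩
    · linarith
    · have : (n : ℝ) * t ≤ n * y := by gcongr
      linarith
  rcases hz with ⟨h1, h2⟩ | ⟨h1, h2⟩
  · filter_upwards [key h2 h1] with n hn
    simp [hn]
  · filter_upwards [key h1 h2] with n hn
    simp [hn]

theorem Ioo_prod_diff_subset_cutPairs (a b : ℝ) :
    Ioo a b ×ˢ (Icc a b)ᶜ ∪ (Icc a b)ᶜ ×ˢ Ioo a b ⊆ cutPairs a ∪ cutPairs b := by
  rintro ⟨x, y⟩ h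
  simp only [mem_union, mem_prod, mem_Ioo, mem_compl_iff, mem_Icc, mem_cutPairs, inf_le_iff,
    lt_sup_iff] at h ⊢
  grind

/-- one-dimensional criterion, `p = 1`: on `Ω = (α,β)` the inequality
`(∬_{Ω×Ω}|u(x)−u(y)|^q dμ)^{1/q} ≤ C ∫_Ω |u′|` holds for all `u ∈ C^∞(Ω)` iff the
measure of pairs separated by any subinterval is suitably bounded. -/
theorem stmt_8 (α β : EReal) (hαβ : α < β) (q : ℝ) (hq : 1 ≤ q) (C : ℝ) (hC : 0 ≤ C)
    (Ω : Set ℝ) (hΩdef : Ω = {x : ℝ | α < (x : EReal) ∧ (x : EReal) < β})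
    (μ : Measure (ℝ × ℝ))
    -- `μ` is locally finite outside the diagonal
    (hloc : ∀ K : Set (ℝ × ℝ), IsCompact K → K ⊆ Ω ×ˢ Ω → (∀ z ∈ K, z.1 ≠ z.2) →
      μ K < ⊤) :
    (∀ u : ℝ → ℝ, ContDiffOn ℝ (⊤ : ℕ∞) u Ω →
      (∫⁻ z in Ω ×ˢ Ω, ENNReal.ofReal (|u z.1 - u z.2| ^ q) ∂μ) ^ (1 / q) ≤
        ENNReal.ofReal C * ∫⁻ x in Ω, ENNReal.ofReal |deriv u x|) ↔
    ((∀ a b : ℝ, a < b → Icc a b ⊆ Ω →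
        (μ (Ioo a b ×ˢ (Ω \ Icc a b)) + μ ((Ω \ Icc a b) ×ˢ Ioo a b)) ^ (1 / q) ≤
          ENNReal.ofReal (2 * C)) ∧
      (∀ x : ℝ, x ∈ Ω →
        (μ ((Ω ∩ Iic x) ×ˢ (Ω \ Iic x)) + μ ((Ω \ Iic x) ×ˢ (Ω ∩ Iic x))) ^ (1 / q) ≤
          ENNReal.ofReal C) ∧
      (∀ x : ℝ, x ∈ Ω →
        (μ ((Ω ∩ Ici x) ×ˢ (Ω \ Ici x)) + μ ((Ω \ Ici x) ×ˢ (Ω ∩ Ici x))) ^ (1 / q) ≤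
          ENNReal.ofReal C)) := by
  have hΩo : IsOpen Ω := by
    rw [hΩdef]
    exact (isOpen_lt continuous_const continuous_coe_real_ereal).inter
      (isOpen_lt continuous_coe_real_ereal continuous_const)
  have hΩm := hΩo.measurableSet
  have hΩc : OrdConnected Ω := by
    rw [hΩdef]
    exact ⟨fun x hx y hy z hz => ⟨hx.1.trans_le (EReal.coe_le_coe_iff.2 hz.1),
      (EReal.coe_le_coe_iff.2 hz.2).trans_lt hy.2⟩⟩
  have hq0 : 0 < q := by linarith
  have hint (u : ℝ → ℝ) (z : ℝ × ℝ) :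
      ENNReal.ofReal (|u z.1 - u z.2| ^ q) = ‖u z.1 - u z.2‖ₑ ^ q := by
    rw [Real.enorm_eq_ofReal_abs, ENNReal.ofReal_rpow_of_nonneg (abs_nonneg _) hq0.le]
  have hIic (x : ℝ) : μ ((Ω ∩ Iic x) ×ˢ (Ω \ Iic x)) + μ ((Ω \ Iic x) ×ˢ (Ω ∩ Iic x)) =
      μ.restrict (Ω ×ˢ Ω) (cutPairs x) := by
    rw [cutPairs, restrict_prod_self_apply_symm μ measurableSet_Iic measurableSet_Ioi
      (Iic_disjoint_Ioi le_rfl), sdiff_eq, compl_Iic]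
  have hIci (x : ℝ) : μ ((Ω ∩ Ici x) ×ˢ (Ω \ Ici x)) + μ ((Ω \ Ici x) ×ˢ (Ω ∩ Ici x)) =
      μ.restrict (Ω ×ˢ Ω) (Ici x ×ˢ Iio x ∪ Iio x ×ˢ Ici x) := by
    rw [restrict_prod_self_apply_symm μ measurableSet_Ici measurableSet_Iio
      (Iio_disjoint_Ici le_rfl).symm, sdiff_eq, compl_Ici]
  simp only [hint, ← Real.enorm_eq_ofReal_abs, hIic, hIci]
  constructor
  · intro h
    have h' : ∀ u : ℝ → ℝ, ContDiff ℝ (⊤ : ℕ∞) u → _ := fun u hu => h u hu.contDiffOn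
    have hcut (x : ℝ) : μ.restrict (Ω ×ˢ Ω) (cutPairs x) ^ (1 / q) ≤ ENNReal.ofReal C :=
      measure_rpow_le_of_smooth_inequality hq0 h' (measurableSet_cutPairs x) (fun n => n) _
        (fun n => n.cast_nonneg) fun z hz => eventually_enorm_smoothTransition_sub_Iic hz
    refine ⟨fun a b hab hsub => ?_, fun x _ => hcut x, fun x _ => ?_⟩
    · have hsub' : Ioo a b = Ω ∩ Ioo a b :=
        (inter_eq_right.2 (Ioo_subset_Icc_self.trans hsub)).symm
      rw [hsub', sdiff_eq, ← restrict_prod_self_apply_symm μ measurableSet_Ioo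
        measurableSet_Icc.compl (disjoint_compl_right.mono_left Ioo_subset_Icc_self),
        ENNReal.ofReal_mul zero_le_two, ENNReal.ofReal_ofNat, two_mul]
      calc _ ≤ (μ.restrict (Ω ×ˢ Ω) (cutPairs a) + μ.restrict (Ω ×ˢ Ω) (cutPairs b)) ^ (1 / q) := by
            gcongr
            exact (measure_mono (Ioo_prod_diff_subset_cutPairs a b)).trans (measure_union_le _ _)
        _ ≤ _ := ENNReal.rpow_add_le_add_rpow _ _ (by positivity) (by rw [div_le_one hq0]; exact hq)
        _ ≤ _ := add_le_add (hcut a) (hcut b)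
    · exact measure_rpow_le_of_smooth_inequality hq0 h'
        ((measurableSet_Ici.prod measurableSet_Iio).union
          (measurableSet_Iio.prod measurableSet_Ici)) (fun n => n) _
        (fun n => n.cast_nonneg) fun z hz => eventually_enorm_smoothTransition_sub_Ici hz
  · rintro ⟨-, h, -⟩ u hu
    have hDo : IsOpen ({z : ℝ × ℝ | z.1 ≠ z.2} ∩ Ω ×ˢ Ω) :=
      (isOpen_ne_fun continuous_fst continuous_snd).inter (hΩo.prod hΩo)
    have := sFinite_restrict_of_isCompact_lt_top (μ := μ) hDo fun K hK hKD =>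
      hloc K hK (hKD.trans inter_subset_right) fun z hz => (hKD hz).1
    rw [one_div, ENNReal.rpow_inv_le_iff hq0,
      setLIntegral_prod_self_eq_offDiag μ Ω fun x => by simp [hq0]]
    refine lintegral_rpow_enorm_sub_le hq hΩm ?_ (fun t ht => ?_) (hu.of_le (by simp))
    · filter_upwards [ae_restrict_mem hDo.measurableSet] with z hz using hz.2
    · refine (Measure.restrict_mono inter_subset_right le_rfl _).trans ?_
      rw [← ENNReal.rpow_inv_le_iff hq0, ← one_div]
      exact h t ht
end
end

section
/- Let q ≥ 1, let C ≥ 0, and let μ be a nonnegative measure on ℝⁿ×ℝⁿ, locally finite outside the diagonal, such that for every u ∈ C^∞(ℝⁿ), ( ∫_{ℝⁿ} ∫_{ℝⁿ} |u(x) − u(y)|^q μ(dx,dy) )^{1/q} ≤ C · ∫_{ℝⁿ} |∇u| dx. Then for every x ∈ ℝⁿ and ρ > 0, μ(B(x,ρ) × (ℝⁿ∖B(x,ρ))) + μ((ℝⁿ∖B(x,ρ)) × B(x,ρ)) ≤ ( σ_{n−1} · C · ρ^{n−1} )^q, where σ_{n−1} is the (n−1)-dimensional Hausdorff measure of the unit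 sphere S^{n−1} ⊂ ℝⁿ. -/
open MeasureTheory Metric Set Filter
open scoped ENNReal Topology MeasureTheory

noncomputable section

open scoped Pointwise NNReal

lemma lintegral_Ioo_ofReal_pow (m : ℕ) :
    ∫⁻ t in Ioo (0 : ℝ) 1, ENNReal.ofReal (t ^ m) = ((m + 1 : ℕ) : ℝ≥0∞)⁻¹ := by
  rw [Measure.restrict_congr_set Ioo_ae_eq_Ioc, ← ofReal_integral_eq_lintegral_ofReal]
  · rw [← intervalIntegral.integral_of_le zero_le_one, integral_pow, ← ENNReal.ofReal_natCast,
      ← ENNReal.ofReal_inv_of_pos (by positivity)]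
    congr 1
    simp
  · exact (intervalIntegral.intervalIntegrable_pow m).1
  · filter_upwards [ae_restrict_mem measurableSet_Ioc] with t ht
    exact pow_nonneg ht.1.le _

/-- The gnomonic projection from the sphere to the hyperplane tangent at the first basis vector. -/
def gnomonic {m : ℕ} (a : EuclideanSpace ℝ (Fin (m + 1))) : Fin m → ℝ :=
  fun i => a i.succ / a 0

lemma volume_Ioo_smul_le {m : ℕ} {S : Set (EuclideanSpace ℝ (Fin (m + 1)))}
    (hS : S ⊆ sphere 0 1) (hpos : ∀ a ∈ S, 0 < a 0) {D : ℝ≥0∞}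
    (hD : ∀ a ∈ S, ∀ b ∈ S, edist (gnomonic a) (gnomonic b) ≤ D) :
    volume (Ioo (0 : ℝ) 1 • S) ≤ ((m + 1 : ℕ) : ℝ≥0∞)⁻¹ * D ^ m := by
  set G : Set (Fin m → ℝ) := closure (gnomonic '' S) with hG
  have hGvol : volume G ≤ D ^ m := by
    refine (Real.volume_pi_le_diam_pow G).trans ?_
    rw [Fintype.card_fin, hG, ediam_closure]
    gcongr
    refine ediam_le ?_
    rintro _ ⟨a, ha, rfl⟩ _ ⟨b, hb, rfl⟩
    exact hD a ha b hb
  set W : Set (ℝ × (Fin m → ℝ)) := {p | p.1 ∈ Ioo (0 : ℝ) 1 ∧ p.1⁻¹ • p.2 ∈ G} with hW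
  have hWm : MeasurableSet W := by
    refine (measurable_fst measurableSet_Ioo).inter ?_
    exact (measurable_fst.inv.smul measurable_snd) isClosed_closure.measurableSet
  have hΦ := (volume_preserving_piFinSuccAbove (fun _ : Fin (m + 1) => ℝ) 0).comp
    (PiLp.volume_preserving_ofLp (Fin (m + 1)))
  have hsub : Ioo (0 : ℝ) 1 • S ⊆
      ((MeasurableEquiv.piFinSuccAbove (fun _ : Fin (m + 1) => ℝ) 0) ∘ WithLp.ofLp) ⁻¹' W := by
    rintro _ ⟨r, hr, a, ha, rfl⟩
    have h0 := hpos a ha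
    have h1 : a 0 ≤ 1 := by
      have := PiLp.norm_apply_le a 0
      rw [mem_sphere_zero_iff_norm.1 (hS ha)] at this
      exact (le_abs_self _).trans this
    have key : gnomonic a ∈ G := subset_closure (mem_image_of_mem _ ha)
    refine ⟨⟨?_, ?_⟩, ?_⟩
    · exact mul_pos hr.1 h0
    · change r * a 0 < 1
      nlinarith [hr.1, hr.2]
    · convert key using 1
      ext i
      change (r * a 0)⁻¹ * (r * a i.succ) = a i.succ / a 0
      have := hr.1.ne'
      field_simp
  calc volume (Ioo (0 : ℝ) 1 • S)
      ≤ _ := measure_mono hsub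
    _ = (volume : Measure (ℝ × (Fin m → ℝ))) W := hΦ.measure_preimage hWm.nullMeasurableSet
    _ = ∫⁻ t, volume (Prod.mk t ⁻¹' W) := by
        rw [Measure.volume_eq_prod, Measure.prod_apply hWm]
    _ ≤ ∫⁻ t, (Ioo (0 : ℝ) 1).indicator (fun t => ENNReal.ofReal (t ^ m) * D ^ m) t := by
        refine lintegral_mono fun t => ?_
        by_cases ht : t ∈ Ioo (0 : ℝ) 1
        · rw [indicator_of_mem ht]
          have : Prod.mk t ⁻¹' W = (t⁻¹ • ·) ⁻¹' G := by
            ext w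
            simp [hW, ht.1, ht.2]
          rw [this, Measure.addHaar_preimage_smul _ (inv_ne_zero ht.1.ne')]
          simp only [Module.finrank_fin_fun, inv_pow, inv_inv, abs_of_pos (pow_pos ht.1 m)]
          gcongr
        · rw [indicator_of_notMem ht]
          have : Prod.mk t ⁻¹' W = ∅ := by
            ext w
            simp only [hW, mem_preimage, mem_ofPred_eq, mem_empty_iff_false, iff_false]
            exact fun h => ht h.1
          simp [this]
    _ = _ := by
        rw [lintegral_indicator measurableSet_Ioo, lintegral_mul_const _ (by fun_prop),
          lintegral_Ioo_ofReal_pow]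

lemma dist_gnomonic_le {m : ℕ} {a b : EuclideanSpace ℝ (Fin (m + 1))} {ε : ℝ}
    (hε : ε < 1) (ha : ‖a - EuclideanSpace.single 0 1‖ ≤ ε)
    (hb : ‖b - EuclideanSpace.single 0 1‖ ≤ ε) :
    dist (gnomonic a) (gnomonic b) ≤ (1 + 2 * ε) / (1 - ε) ^ 2 * dist a b := by
  have hε0 : 0 ≤ ε := (norm_nonneg _).trans ha
  have zero_coord : ∀ {c : EuclideanSpace ℝ (Fin (m + 1))},
      ‖c - EuclideanSpace.single 0 1‖ ≤ ε → |c 0 - 1| ≤ ε := by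
    intro c hc
    have := (PiLp.norm_apply_le (c - EuclideanSpace.single 0 1) 0).trans hc
    simpa using this
  have ha0 := abs_le.1 (zero_coord ha)
  have hb0 := abs_le.1 (zero_coord hb)
  have hpos : 0 < 1 - ε := by linarith
  rw [dist_pi_le_iff (by positivity)]
  intro i
  have hbi : |b i.succ| ≤ ε := by
    have := (PiLp.norm_apply_le (b - EuclideanSpace.single 0 1) i.succ).trans hb
    simpa using this
  have hab : ∀ j, |a j - b j| ≤ dist a b := fun j => by
    rw [dist_eq_norm]
    exact PiLp.norm_apply_le (a - b) j
  have hapos : 0 < a 0 := by linarith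
  have hbpos : 0 < b 0 := by linarith
  have hd : 0 ≤ dist a b := dist_nonneg
  rw [Real.dist_eq]
  have e : gnomonic a i - gnomonic b i =
      ((a i.succ - b i.succ) * b 0 + b i.succ * (b 0 - a 0)) / (a 0 * b 0) := by
    simp only [gnomonic]
    field_simp
    ring
  rw [e, abs_div, abs_of_pos (mul_pos hapos hbpos), div_mul_eq_mul_div]
  have hnum : |(a i.succ - b i.succ) * b 0 + b i.succ * (b 0 - a 0)| ≤
      (1 + 2 * ε) * dist a b := by
    calc _ ≤ |a i.succ - b i.succ| * |b 0| + |b i.succ| * |b 0 - a 0| := by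
          rw [← abs_mul, ← abs_mul]; exact abs_add_le _ _
      _ ≤ dist a b * (1 + ε) + ε * dist a b := by
          have h1 : |b 0| ≤ 1 + ε := by rw [abs_of_pos hbpos]; linarith
          have h2 : |b 0 - a 0| ≤ dist a b := by rw [abs_sub_comm]; exact hab 0
          gcongr
          exact hab _
      _ = _ := by ring
  have hden : (1 - ε) ^ 2 ≤ a 0 * b 0 := by
    rw [sq]
    exact mul_le_mul (by linarith) (by linarith) hpos.le hapos.le
  gcongr

lemma toSphere_le_of_ediam_le {m : ℕ} {ε : ℝ} (hε0 : 0 ≤ ε) (hε : ε < 1)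
    {s : Set (sphere (0 : EuclideanSpace ℝ (Fin (m + 1))) 1)}
    (hs : ediam s ≤ ENNReal.ofReal ε) :
    (volume : Measure (EuclideanSpace ℝ (Fin (m + 1)))).toSphere s ≤
      (ENNReal.ofReal ((1 + 2 * ε) / (1 - ε) ^ 2) * ediam s) ^ m := by
  rcases s.eq_empty_or_nonempty with rfl | ⟨a₀, ha₀⟩
  · simp
  set e : EuclideanSpace ℝ (Fin (m + 1)) := EuclideanSpace.single 0 1 with he
  have hnorm : ‖(a₀ : EuclideanSpace ℝ (Fin (m + 1)))‖ = ‖e‖ := by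
    simp [he]
  set T := (ℝ ∙ ((a₀ : EuclideanSpace ℝ (Fin (m + 1))) - e))ᗮ.reflection with hT
  have hTa : T a₀ = e := Submodule.reflection_sub hnorm
  rw [← ediam_closure] at hs ⊢
  set c := closure s with hc
  have ha₀c : a₀ ∈ c := subset_closure ha₀
  have hclose : ∀ a ∈ c, ‖T a - e‖ ≤ ε := by
    intro a ha
    have h := (edist_le_ediam_of_mem ha ha₀c).trans hs
    rw [edist_dist, ENNReal.ofReal_le_ofReal_iff hε0] at h
    rw [← hTa, ← map_sub, LinearIsometryEquiv.norm_map, ← dist_eq_norm]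
    exact h
  set S : Set (EuclideanSpace ℝ (Fin (m + 1))) := T '' (Subtype.val '' c) with hS
  have hbound : volume (Ioo (0 : ℝ) 1 • S) ≤ ((m + 1 : ℕ) : ℝ≥0∞)⁻¹ *
      (ENNReal.ofReal ((1 + 2 * ε) / (1 - ε) ^ 2) * ediam c) ^ m := by
    refine volume_Ioo_smul_le ?_ ?_ ?_
    · rintro _ ⟨_, ⟨a, -, rfl⟩, rfl⟩
      simp
    · rintro _ ⟨_, ⟨a, ha, rfl⟩, rfl⟩
      have := (PiLp.norm_apply_le (T a - e) 0).trans (hclose a ha)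
      have h2 : |T a 0 - 1| ≤ ε := by simpa [he] using this
      linarith [(abs_le.1 h2).1]
    · rintro _ ⟨_, ⟨a, ha, rfl⟩, rfl⟩ _ ⟨_, ⟨b, hb, rfl⟩, rfl⟩
      have h := dist_gnomonic_le hε (hclose a ha) (hclose b hb)
      rw [LinearIsometryEquiv.dist_map, ← Subtype.dist_eq] at h
      calc _ = ENNReal.ofReal _ := edist_dist _ _
        _ ≤ _ := ENNReal.ofReal_le_ofReal h
        _ = _ := ENNReal.ofReal_mul (by positivity)
        _ ≤ _ := by
          rw [← edist_dist]
          gcongr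
          exact edist_le_ediam_of_mem ha hb
  have hvol : volume (Ioo (0 : ℝ) 1 • (Subtype.val '' c)) ≤ volume (Ioo (0 : ℝ) 1 • S) := by
    rw [← T.measurePreserving.measure_preimage_emb T.toHomeomorph.measurableEmbedding
      (Ioo (0 : ℝ) 1 • S)]
    refine measure_mono ?_
    rintro _ ⟨r, hr, a, ha, rfl⟩
    exact ⟨r, hr, T a, mem_image_of_mem _ ha, by simp⟩
  calc _ ≤ (volume : Measure (EuclideanSpace ℝ (Fin (m + 1)))).toSphere c :=
        measure_mono subset_closure
    _ = ((m + 1 : ℕ) : ℝ≥0∞) * volume (Ioo (0 : ℝ) 1 • (Subtype.val '' c)) := by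
        rw [Measure.toSphere_apply' _ isClosed_closure.measurableSet, finrank_euclideanSpace_fin]
    _ ≤ ((m + 1 : ℕ) : ℝ≥0∞) * (((m + 1 : ℕ) : ℝ≥0∞)⁻¹ *
      (ENNReal.ofReal ((1 + 2 * ε) / (1 - ε) ^ 2) * ediam c) ^ m) := by
        gcongr
        exact hvol.trans hbound
    _ = _ := by
        rw [← mul_assoc, ENNReal.mul_inv_cancel (by simp) (by simp), one_mul]

lemma natCast_mul_volume_ball_le_hausdorffMeasure_sphere (m : ℕ) :
    ((m + 1 : ℕ) : ℝ≥0∞) * volume (ball (0 : EuclideanSpace ℝ (Fin (m + 1))) 1) ≤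
      μH[(m : ℝ)] (sphere (0 : EuclideanSpace ℝ (Fin (m + 1))) 1) := by
  set σ := (volume : Measure (EuclideanSpace ℝ (Fin (m + 1)))).toSphere with hσ
  set Λ : ℝ → ℝ≥0∞ := fun ε => ENNReal.ofReal ((1 + 2 * ε) / (1 - ε) ^ 2) ^ m with hΛ
  have hle : ∀ ε ∈ Ioo (0 : ℝ) 1, σ univ ≤ Λ ε *
      μH[(m : ℝ)] (sphere (0 : EuclideanSpace ℝ (Fin (m + 1))) 1) := by
    intro ε hε
    have hpos : 0 < (1 + 2 * ε) / (1 - ε) ^ 2 := by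
      have := hε.1
      have := hε.2
      have : 0 < 1 - ε := by linarith
      positivity
    have h0 : Λ ε ≠ 0 := pow_ne_zero _ (ENNReal.ofReal_pos.2 hpos).ne'
    have htop : Λ ε ≠ ⊤ := ENNReal.pow_ne_top ENNReal.ofReal_ne_top
    have h : (Λ ε)⁻¹ • σ ≤ μH[(m : ℝ)] := by
      refine Measure.le_hausdorffMeasure _ _ (ENNReal.ofReal ε) (ENNReal.ofReal_pos.2 hε.1) ?_
      intro s hs
      rw [Measure.smul_apply, smul_eq_mul, ENNReal.rpow_natCast]
      rw [ENNReal.inv_mul_le_iff h0 htop, hΛ, ← mul_pow]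
      exact toSphere_le_of_ediam_le hε.1.le hε.2 hs
    have h2 := h univ
    rw [Measure.smul_apply, smul_eq_mul, ENNReal.inv_mul_le_iff h0 htop] at h2
    have h3 := (isometry_subtype_coe (s := sphere (0 : EuclideanSpace ℝ (Fin (m + 1))) 1)
      ).hausdorffMeasure_image (Or.inl (Nat.cast_nonneg m)) univ
    rw [image_univ, Subtype.range_coe] at h3
    rwa [h3]
  have hlim : Tendsto (fun ε => Λ ε *
      μH[(m : ℝ)] (sphere (0 : EuclideanSpace ℝ (Fin (m + 1))) 1)) (𝓝[>] 0)
      (𝓝 (1 * μH[(m : ℝ)] (sphere (0 : EuclideanSpace ℝ (Fin (m + 1))) 1))) := by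
    refine ENNReal.Tendsto.mul_const ?_ (Or.inl one_ne_zero)
    have hc : Tendsto (fun ε : ℝ => (1 + 2 * ε) / (1 - ε) ^ 2) (𝓝[>] 0) (𝓝 1) := by
      have : ContinuousAt (fun ε : ℝ => (1 + 2 * ε) / (1 - ε) ^ 2) 0 := by
        refine ContinuousAt.div (by fun_prop) (by fun_prop) (by simp)
      have h := this.tendsto.mono_left (nhdsWithin_le_nhds (s := Ioi 0))
      simpa using h
    have h := ENNReal.Tendsto.pow (n := m) (ENNReal.tendsto_ofReal hc)
    simpa [hΛ] using h
  rw [one_mul] at hlim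
  have h := ge_of_tendsto hlim (by
    filter_upwards [Ioo_mem_nhdsGT (zero_lt_one' ℝ)] with ε hε using hle ε hε)
  rwa [hσ, Measure.toSphere_apply_univ, finrank_euclideanSpace_fin] at h

lemma dist_inv_norm_smul_le {E : Type*} [NormedAddCommGroup E] [NormedSpace ℝ E] {x y : E}
    (hx : 1 ≤ ‖x‖) (hy : 1 ≤ ‖y‖) : dist (‖x‖⁻¹ • x) (‖y‖⁻¹ • y) ≤ 2 * dist x y := by
  have hx0 : 0 < ‖x‖ := by linarith
  have hy0 : 0 < ‖y‖ := by linarith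
  have e : ‖x‖⁻¹ • x - ‖y‖⁻¹ • y = ‖x‖⁻¹ • (x - y) + (‖x‖⁻¹ - ‖y‖⁻¹) • y := by
    module
  have h1 : ‖(‖x‖⁻¹ - ‖y‖⁻¹) • y‖ = ‖x‖⁻¹ * |‖y‖ - ‖x‖| := by
    have : ‖x‖⁻¹ - ‖y‖⁻¹ = ‖x‖⁻¹ * (‖y‖ - ‖x‖) * ‖y‖⁻¹ := by field_simp
    rw [norm_smul, this, norm_mul, norm_mul, norm_inv, norm_inv, norm_norm, norm_norm,
      Real.norm_eq_abs, mul_assoc, inv_mul_cancel₀ hy0.ne', mul_one]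
  have h2 : ‖x‖⁻¹ ≤ 1 := inv_le_one_of_one_le₀ hx
  rw [dist_eq_norm, dist_eq_norm, e]
  calc _ ≤ _ := norm_add_le _ _
    _ = ‖x‖⁻¹ * ‖x - y‖ + ‖x‖⁻¹ * |‖y‖ - ‖x‖| := by
      rw [h1, norm_smul, norm_inv, norm_norm]
    _ ≤ 1 * ‖x - y‖ + 1 * ‖x - y‖ := by
      gcongr
      rw [norm_sub_rev]
      exact abs_norm_sub_norm_le y x
    _ = _ := by ring

/-- The radial projection to the sphere of the hyperplane where the `i`-th coordinate is `s`. -/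
def radialFace {m : ℕ} (i : Fin (m + 1)) (s : ℝ) (w : Fin m → ℝ) :
    EuclideanSpace ℝ (Fin (m + 1)) :=
  ‖WithLp.toLp 2 (i.insertNth (α := fun _ => ℝ) s w)‖⁻¹ •
    WithLp.toLp 2 (i.insertNth (α := fun _ => ℝ) s w)

lemma exists_lipschitzWith_radialFace {m : ℕ} (i : Fin (m + 1)) {s : ℝ} (hs : |s| = 1) :
    ∃ K, LipschitzWith K (radialFace i s) := by
  obtain ⟨L, hL⟩ : ∃ L, LipschitzWith L (WithLp.toLp 2 : (Fin (m + 1) → ℝ) → _) :=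
    ⟨_, PiLp.lipschitzWith_toLp 2 (fun _ : Fin (m + 1) => ℝ)⟩
  refine ⟨2 * L, LipschitzWith.of_dist_le_mul fun w w' => ?_⟩
  have hone : ∀ w : Fin m → ℝ,
      1 ≤ ‖WithLp.toLp 2 (i.insertNth (α := fun _ => ℝ) s w)‖ := fun w => by
    have := PiLp.norm_apply_le (WithLp.toLp 2 (i.insertNth (α := fun _ => ℝ) s w)) i
    simpa [hs] using this
  refine (dist_inv_norm_smul_le (hone w) (hone w')).trans ?_
  rw [NNReal.coe_mul, NNReal.coe_ofNat, mul_assoc]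
  refine mul_le_mul_of_nonneg_left ?_ zero_le_two
  refine (hL.dist_le_mul _ _).trans ?_
  refine mul_le_mul_of_nonneg_left ?_ (NNReal.coe_nonneg _)
  rw [dist_pi_le_iff dist_nonneg]
  intro j
  rcases Fin.eq_self_or_eq_succAbove i j with rfl | ⟨j, rfl⟩
  · simp
  · simpa using dist_le_pi_dist w w' j

lemma hausdorffMeasure_sphere_lt_top (m : ℕ) :
    μH[(m : ℝ)] (sphere (0 : EuclideanSpace ℝ (Fin (m + 1))) 1) < ⊤ := by
  have hcube : μH[(m : ℝ)] (Icc (-1 : Fin m → ℝ) 1) < ⊤ := by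
    have h := hausdorffMeasure_pi_real (ι := Fin m)
    rw [Fintype.card_fin] at h
    rw [h]
    exact isCompact_Icc.measure_lt_top
  have hface : ∀ (i : Fin (m + 1)) (s : ℝ), |s| = 1 →
      μH[(m : ℝ)] (radialFace i s '' Icc (-1) 1) < ⊤ := by
    intro i s hs
    obtain ⟨K, hK⟩ := exists_lipschitzWith_radialFace i hs
    refine (hK.hausdorffMeasure_image_le (Nat.cast_nonneg m) _).trans_lt ?_
    exact ENNReal.mul_lt_top (ENNReal.rpow_lt_top_of_nonneg (Nat.cast_nonneg m)
      ENNReal.coe_ne_top) hcube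
  have hcover : sphere (0 : EuclideanSpace ℝ (Fin (m + 1))) 1 ⊆
      ⋃ i ∈ (univ : Set (Fin (m + 1))),
        (radialFace i 1 '' Icc (-1) 1 ∪ radialFace i (-1) '' Icc (-1) 1) := by
    intro x hx
    have hx1 : ‖x‖ = 1 := mem_sphere_zero_iff_norm.1 hx
    obtain ⟨i, hi⟩ := Finite.exists_max (fun i => |x i|)
    have hpos : 0 < |x i| := by
      rw [abs_pos]
      intro h0
      have : x = 0 := by
        ext j
        have := hi j
        rw [h0, abs_zero] at this
        exact abs_nonpos_iff.1 this
      simp [this] at hx1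
    set w : Fin m → ℝ := fun j => x (i.succAbove j) / |x i| with hw
    have hwmem : w ∈ Icc (-1 : Fin m → ℝ) 1 := by
      have h : ∀ j, |w j| ≤ 1 := fun j => by
        rw [hw, abs_div, abs_abs]
        exact div_le_one_of_le₀ (hi _) hpos.le
      exact ⟨fun j => (abs_le.1 (h j)).1, fun j => (abs_le.1 (h j)).2⟩
    have hrad : radialFace i (x i / |x i|) w = x := by
      have e : WithLp.toLp 2 (i.insertNth (α := fun _ => ℝ) (x i / |x i|) w) = |x i|⁻¹ • x := by
        ext j
        rcases Fin.eq_self_or_eq_succAbove i j with rfl | ⟨j, rfl⟩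
        · simp [div_eq_inv_mul]
        · simp [hw, div_eq_inv_mul]
      rw [radialFace, e, norm_smul, hx1, norm_inv, Real.norm_eq_abs, abs_abs, mul_one, inv_inv,
        smul_smul, mul_inv_cancel₀ hpos.ne', one_smul]
    refine mem_biUnion (mem_univ i) ?_
    rcases abs_cases (x i) with ⟨h, -⟩ | ⟨h, -⟩
    · left
      refine ⟨w, hwmem, ?_⟩
      rwa [← h, abs_abs, div_self hpos.ne'] at hrad
    · right
      refine ⟨w, hwmem, ?_⟩
      have : x i / |x i| = -1 := by
        rw [div_eq_iff hpos.ne']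
        linarith
      rwa [this] at hrad
  refine (measure_mono hcover).trans_lt (measure_biUnion_lt_top finite_univ fun i _ => ?_)
  exact measure_union_lt_top (hface i 1 (by simp)) (hface i (-1) (by simp))

/-- A smooth profile that is `1` on `(-∞, s]` and `0` on `[t, ∞)`. -/
def cutoffProfile (s t r : ℝ) : ℝ := Real.smoothTransition ((t - r) / (t - s))

lemma contDiff_cutoffProfile (s t : ℝ) : ContDiff ℝ (⊤ : ℕ∞) (cutoffProfile s t) :=
  Real.smoothTransition.contDiff.comp (by fun_prop)

lemma cutoffProfile_of_le {s t r : ℝ} (hst : s < t) (h : r ≤ s) : cutoffProfile s t r = 1 := by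
  refine Real.smoothTransition.one_of_one_le ?_
  rw [le_div_iff₀ (by linarith)]
  linarith

lemma cutoffProfile_of_ge {s t r : ℝ} (hst : s < t) (h : t ≤ r) : cutoffProfile s t r = 0 :=
  Real.smoothTransition.zero_of_nonpos (div_nonpos_of_nonpos_of_nonneg (by linarith) (by linarith))

lemma antitone_cutoffProfile {s t : ℝ} (hst : s < t) : Antitone (cutoffProfile s t) := by
  intro a b hab
  refine Real.smoothTransition.monotone ?_
  have : 0 < t - s := by linarith
  gcongr

lemma deriv_cutoffProfile_of_gt {s t r : ℝ} (hst : s < t) (h : t < r) :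
    deriv (cutoffProfile s t) r = 0 := by
  have h : cutoffProfile s t =ᶠ[𝓝 r] fun _ => 0 := by
    filter_upwards [Ioi_mem_nhds h] with u hu using cutoffProfile_of_ge hst (le_of_lt hu)
  rw [h.deriv_eq, deriv_const]

lemma norm_fderiv_comp_norm_sq_le {E : Type*} [NormedAddCommGroup E] [InnerProductSpace ℝ E]
    {φ : ℝ → ℝ} (hφ : Differentiable ℝ φ) (x y : E) :
    ‖fderiv ℝ (fun y => φ (‖y - x‖ ^ 2)) y‖ ≤ |deriv φ (‖y - x‖ ^ 2)| * (2 * ‖y - x‖) := by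
  have h1 : HasFDerivAt (fun y : E => ‖y - x‖ ^ 2) _ y :=
    ((hasFDerivAt_id y).sub_const x).norm_sq
  have h2 := (hφ (‖y - x‖ ^ 2)).hasDerivAt.comp_hasFDerivAt y h1
  have h3 : HasFDerivAt (fun y => φ (‖y - x‖ ^ 2)) _ y := h2
  rw [h3.fderiv, norm_smul, Real.norm_eq_abs]
  gcongr
  rw [← Nat.cast_smul_eq_nsmul ℝ, norm_smul, ContinuousLinearMap.comp_id,
    innerSL_apply_norm]
  simp

lemma integral_pow_mul_deriv_cutoffProfile_le (m : ℕ) {s ρ : ℝ} (hs : s < ρ ^ 2) (hs0 : 0 ≤ s)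
    (hρ : 0 < ρ) :
    ∫ r in Ioi (0 : ℝ), r ^ m * (|deriv (cutoffProfile s (ρ ^ 2)) (r ^ 2)| * (2 * r)) ≤ ρ ^ m := by
  set φ := cutoffProfile s (ρ ^ 2) with hφ
  have hsm := contDiff_cutoffProfile s (ρ ^ 2)
  have hdc : Continuous (deriv φ) := hsm.continuous_deriv (by simp)
  have hdiff : Differentiable ℝ φ := hsm.differentiable (by simp)
  have hzero : ∀ r ∈ Ioi ρ, deriv φ (r ^ 2) = 0 := fun r hr =>
    deriv_cutoffProfile_of_gt hs (pow_lt_pow_left₀ hr hρ.le two_ne_zero)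
  have hψ : ∀ r ∈ uIcc 0 ρ, HasDerivAt (fun r => -φ (r ^ 2)) (-(deriv φ (r ^ 2) * (2 * r))) r := by
    intro r _
    have h := ((hdiff (r ^ 2)).hasDerivAt.comp r (hasDerivAt_pow 2 r)).neg
    simp only [Nat.cast_ofNat, Nat.add_one_sub_one, pow_one] at h
    exact h
  have hftc := intervalIntegral.integral_eq_sub_of_hasDerivAt hψ
    (Continuous.intervalIntegrable (by fun_prop) _ _)
  have hval : ∫ r in (0 : ℝ)..ρ, -(deriv φ (r ^ 2) * (2 * r)) = 1 := by
    rw [hftc, hφ, cutoffProfile_of_ge hs le_rfl, cutoffProfile_of_le hs (by simpa using hs0)]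
    simp
  have hsplit : ∫ r in Ioi (0 : ℝ), r ^ m * (|deriv φ (r ^ 2)| * (2 * r)) =
      ∫ r in Ioc (0 : ℝ) ρ, r ^ m * (|deriv φ (r ^ 2)| * (2 * r)) := by
    refine (setIntegral_eq_of_subset_of_forall_sdiff_eq_zero measurableSet_Ioi
      Ioc_subset_Ioi_self ?_)
    rintro r ⟨hr, hr'⟩
    rw [hzero r (by simpa [mem_Ioi.1 hr] using hr')]
    simp
  rw [hsplit, ← intervalIntegral.integral_of_le hρ.le]
  calc _ ≤ ∫ r in (0 : ℝ)..ρ, ρ ^ m * -(deriv φ (r ^ 2) * (2 * r)) := by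
        refine intervalIntegral.integral_mono_on hρ.le
          (Continuous.intervalIntegrable (by fun_prop) _ _)
          (Continuous.intervalIntegrable (by fun_prop) _ _) fun r hr => ?_
        have hneg : deriv φ (r ^ 2) ≤ 0 := (antitone_cutoffProfile hs).deriv_nonpos
        have hr0 := hr.1
        rw [abs_of_nonpos hneg, neg_mul]
        refine mul_le_mul_of_nonneg_right (pow_le_pow_left₀ hr0 hr.2 m) ?_
        have := mul_nonneg (neg_nonneg.2 hneg) hr0
        linarith
    _ = ρ ^ m := by rw [intervalIntegral.integral_const_mul, hval, mul_one]

lemma lintegral_norm_fderiv_cutoff_le {m : ℕ} {s ρ : ℝ} (hs : s < ρ ^ 2) (hs0 : 0 ≤ s)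
    (hρ : 0 < ρ) (x : EuclideanSpace ℝ (Fin (m + 1))) :
    ∫⁻ y, ENNReal.ofReal ‖fderiv ℝ (fun y => cutoffProfile s (ρ ^ 2) (‖y - x‖ ^ 2)) y‖ ≤
      ((m + 1 : ℕ) : ℝ≥0∞) * volume (ball (0 : EuclideanSpace ℝ (Fin (m + 1))) 1) *
        ENNReal.ofReal (ρ ^ m) := by
  set φ := cutoffProfile s (ρ ^ 2) with hφ
  have hsm := contDiff_cutoffProfile s (ρ ^ 2)
  have hdc : Continuous (deriv φ) := hsm.continuous_deriv (by simp)
  set G : ℝ → ℝ := fun r => |deriv φ (r ^ 2)| * (2 * r) with hG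
  have hGc : Continuous G := by fun_prop
  have hint : Integrable (fun y : EuclideanSpace ℝ (Fin (m + 1)) => G ‖y‖) := by
    refine Continuous.integrable_of_hasCompactSupport (by fun_prop) ?_
    refine HasCompactSupport.of_support_subset_isCompact
      (isCompact_closedBall (0 : EuclideanSpace ℝ (Fin (m + 1))) ρ) ?_
    intro y hy
    by_contra hmem
    refine hy ?_
    have hlt : ρ < ‖y‖ := by simpa using hmem
    have h : deriv φ (‖y‖ ^ 2) = 0 :=
      deriv_cutoffProfile_of_gt hs (pow_lt_pow_left₀ hlt hρ.le two_ne_zero)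
    simp [hG, h]
  calc _ ≤ ∫⁻ y, ENNReal.ofReal (G ‖y - x‖) := by
        refine lintegral_mono fun y => ENNReal.ofReal_le_ofReal ?_
        exact norm_fderiv_comp_norm_sq_le (hsm.differentiable (by simp)) x y
    _ = ∫⁻ y : EuclideanSpace ℝ (Fin (m + 1)), ENNReal.ofReal (G ‖y‖) :=
        lintegral_sub_right_eq_self (fun y => ENNReal.ofReal (G ‖y‖)) x
    _ = ENNReal.ofReal (∫ y : EuclideanSpace ℝ (Fin (m + 1)), G ‖y‖) := by
        rw [ofReal_integral_eq_lintegral_ofReal hint]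
        exact Eventually.of_forall fun y => by simp only [hG]; positivity
    _ ≤ ENNReal.ofReal (((m + 1 : ℕ) : ℝ) *
          volume.real (ball (0 : EuclideanSpace ℝ (Fin (m + 1))) 1) * ρ ^ m) := by
        refine ENNReal.ofReal_le_ofReal ?_
        rw [integral_fun_norm_addHaar, finrank_euclideanSpace_fin, nsmul_eq_mul, smul_eq_mul,
          mul_assoc]
        gcongr
        exact integral_pow_mul_deriv_cutoffProfile_le m hs hs0 hρ
    _ = _ := by
        rw [ENNReal.ofReal_mul (by positivity), ENNReal.ofReal_mul (by positivity),
          ENNReal.ofReal_natCast, ofReal_measureReal]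

lemma measure_cross_le_lintegral {X : Type*} [MeasurableSpace X] (μ : Measure (X × X))
    {B₁ B₂ : Set X} (h₁ : MeasurableSet B₁) (h₂ : MeasurableSet B₂) {q : ℝ} {u : X → ℝ}
    (hu₁ : ∀ y ∈ B₁, u y = 1) (hu₂ : ∀ y ∈ B₂, u y = 0) :
    μ (B₁ ×ˢ B₂ ∪ B₂ ×ˢ B₁) ≤ ∫⁻ z, ENNReal.ofReal (|u z.1 - u z.2| ^ q) ∂μ := by
  rw [← lintegral_indicator_one ((h₁.prod h₂).union (h₂.prod h₁))]
  refine lintegral_mono (indicator_le' (fun z hz => ?_) (fun _ _ => zero_le))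
  rcases hz with hz | hz
  · simp [hu₁ _ hz.1, hu₂ _ hz.2]
  · simp [hu₂ _ hz.1, hu₁ _ hz.2]

lemma measure_cross_ball_le {X : Type*} [PseudoMetricSpace X] [MeasurableSpace X]
    [OpensMeasurableSpace X] (μ : Measure (X × X)) (x : X) {ρ : ℝ} (hρ : 0 < ρ) {M : ℝ≥0∞}
    (h : ∀ s, 0 < s → s < ρ →
      μ (closedBall x s ×ˢ (ball x ρ)ᶜ ∪ (ball x ρ)ᶜ ×ˢ closedBall x s) ≤ M) :
    μ (ball x ρ ×ˢ (ball x ρ)ᶜ) + μ ((ball x ρ)ᶜ ×ˢ ball x ρ) ≤ M := by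
  rw [← measure_union]
  rotate_left
  · rw [Set.disjoint_left]
    exact fun z hz hz' => hz'.1 hz.1
  · exact measurableSet_ball.compl.prod measurableSet_ball
  obtain ⟨s, hmono, hs, hlim⟩ := exists_seq_strictMono_tendsto' hρ
  have hsub : ball x ρ ×ˢ (ball x ρ)ᶜ ∪ (ball x ρ)ᶜ ×ˢ ball x ρ ⊆
      ⋃ k, (closedBall x (s k) ×ˢ (ball x ρ)ᶜ ∪ (ball x ρ)ᶜ ×ˢ closedBall x (s k)) := by
    rintro z (⟨hz, hz'⟩ | ⟨hz, hz'⟩)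
    · obtain ⟨k, hk⟩ := (hlim.eventually_const_lt hz).exists
      exact mem_iUnion.2 ⟨k, Or.inl ⟨hk.le, hz'⟩⟩
    · obtain ⟨k, hk⟩ := (hlim.eventually_const_lt hz').exists
      exact mem_iUnion.2 ⟨k, Or.inr ⟨hz, hk.le⟩⟩
  refine (measure_mono hsub).trans ?_
  rw [Monotone.measure_iUnion]
  · exact iSup_le fun k => h _ (hs k).1 (hs k).2
  · intro k l hkl
    have := closedBall_subset_closedBall (x := x) (hmono.monotone hkl)
    exact union_subset_union (prod_mono this le_rfl) (prod_mono le_rfl this)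

/-- if `(∬ |u(x)−u(y)|^q dμ)^{1/q} ≤ C·∫_{ℝⁿ}|∇u| dx` for all
`u ∈ C^∞(ℝⁿ)`, then for every ball `B(x,ρ)`,
`μ(B×Bᶜ) + μ(Bᶜ×B) ≤ (σ_{n−1}·C·ρ^{n−1})^q`. -/
theorem stmt_10 (n : ℕ) (q : ℝ) (hq : 1 ≤ q) (C : ℝ) (hC : 0 ≤ C)
    (μ : Measure (EuclideanSpace ℝ (Fin n) × EuclideanSpace ℝ (Fin n)))
    -- `μ` is locally finite outside the diagonal
    (hloc : ∀ K : Set (EuclideanSpace ℝ (Fin n) × EuclideanSpace ℝ (Fin n)),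
      IsCompact K → (∀ z ∈ K, z.1 ≠ z.2) → μ K < ⊤)
    (hineq : ∀ u : EuclideanSpace ℝ (Fin n) → ℝ, ContDiff ℝ (⊤ : ℕ∞) u →
      (∫⁻ z, ENNReal.ofReal (|u z.1 - u z.2| ^ q) ∂μ) ^ (1 / q) ≤
        ENNReal.ofReal C * ∫⁻ x, ENNReal.ofReal ‖fderiv ℝ u x‖) :
    ∀ (x : EuclideanSpace ℝ (Fin n)) (ρ : ℝ), 0 < ρ →
      μ (ball x ρ ×ˢ (ball x ρ)ᶜ) + μ ((ball x ρ)ᶜ ×ˢ ball x ρ) ≤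
        ENNReal.ofReal
          ((μH[(n : ℝ) - 1] (sphere (0 : EuclideanSpace ℝ (Fin n)) 1)).toReal *
            C * ρ ^ (n - 1)) ^ q := by
  intro x ρ hρ
  have hq0 : 0 < q := by linarith
  rcases n with _ | m
  · have hball : ball x ρ = univ := eq_univ_of_forall fun y => by
      rw [Subsingleton.elim y x]
      exact mem_ball_self hρ
    simp [hball]
  set σ := (μH[((m + 1 : ℕ) : ℝ) - 1] (sphere (0 : EuclideanSpace ℝ (Fin (m + 1))) 1)).toReal
    with hσ
  have hvol : ((m + 1 : ℕ) : ℝ≥0∞) * volume (ball (0 : EuclideanSpace ℝ (Fin (m + 1))) 1) ≤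
      ENNReal.ofReal σ := by
    have hdim : ((m + 1 : ℕ) : ℝ) - 1 = m := by simp
    rw [hσ, hdim,
      ENNReal.ofReal_toReal (hausdorffMeasure_sphere_lt_top m).ne]
    exact natCast_mul_volume_ball_le_hausdorffMeasure_sphere m
  refine measure_cross_ball_le μ x hρ fun s hs hsρ => ?_
  have hsq : s ^ 2 < ρ ^ 2 := pow_lt_pow_left₀ hsρ hs.le two_ne_zero
  set u : EuclideanSpace ℝ (Fin (m + 1)) → ℝ :=
    fun y => cutoffProfile (s ^ 2) (ρ ^ 2) (‖y - x‖ ^ 2) with hu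
  have husm : ContDiff ℝ (⊤ : ℕ∞) u :=
    (contDiff_cutoffProfile _ _).comp ((contDiff_id.sub contDiff_const).norm_sq ℝ)
  refine (measure_cross_le_lintegral μ (q := q) (u := u) measurableSet_closedBall
    measurableSet_ball.compl (fun y hy => ?_) (fun y hy => ?_)).trans ?_
  · rw [mem_closedBall, dist_eq_norm] at hy
    exact cutoffProfile_of_le hsq (pow_le_pow_left₀ (norm_nonneg _) hy 2)
  · rw [mem_compl_iff, mem_ball, dist_eq_norm, not_lt] at hy
    exact cutoffProfile_of_ge hsq (pow_le_pow_left₀ hρ.le hy 2)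
  have hmain := hineq u husm
  rw [one_div, ENNReal.rpow_inv_le_iff hq0] at hmain
  refine hmain.trans (ENNReal.rpow_le_rpow ?_ hq0.le)
  calc _ ≤ ENNReal.ofReal C * (ENNReal.ofReal σ * ENNReal.ofReal (ρ ^ m)) := by
        gcongr
        refine (lintegral_norm_fderiv_cutoff_le hsq (by positivity) hρ x).trans ?_
        gcongr
    _ = _ := by
        rw [← mul_assoc, mul_comm (ENNReal.ofReal C), ← ENNReal.ofReal_mul ENNReal.toReal_nonneg,
          ← ENNReal.ofReal_mul (by positivity)]
        rfl
end
end

section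
/- Let D be the open unit disk in ℝ² and let s denote the 1-dimensional Hausdorff measure (arclength) on its boundary circle ∂D. Then for every function u continuous on the closed unit disk and C^∞ in D, ∫_{∂D} ∫_{∂D} |u(x) − u(y)| s(dx) s(dy) ≤ 4π · ∫_D |∇u(x)| dx. -/
open MeasureTheory Metric Set Filter Real
open scoped ENNReal Topology MeasureTheory

noncomputable section

lemma integral_Ioc_sq_sub_indicator {M a b : ℝ} (ha : |a| ≤ M) (hb : |b| ≤ M) :
    ∫ t in Ioc (-M) M, ((Iio a).indicator (1 : ℝ → ℝ) t - (Iio b).indicator 1 t) ^ 2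
      = |a - b| := by
  wlog h : b ≤ a generalizing a b
  · rw [abs_sub_comm, ← this hb ha (le_of_not_ge h)]
    exact integral_congr_ae (ae_of_all _ fun t => by ring)
  have key : (fun t => ((Iio a).indicator (1 : ℝ → ℝ) t - (Iio b).indicator 1 t) ^ 2)
      = (Ico b a).indicator (fun _ => (1 : ℝ)) := by
    ext t
    simp only [indicator, Pi.one_apply, mem_Iio, mem_Ico]
    grind
  have hsub : Ico b a ⊆ Icc (-M) M := fun t ht =>
    ⟨(abs_le.1 hb).1.trans ht.1, ht.2.le.trans (abs_le.1 ha).2⟩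
  rw [key, ← integral_Icc_eq_integral_Ioc, setIntegral_indicator measurableSet_Ico,
    inter_eq_right.2 hsub]
  simp [h, abs_of_nonneg (sub_nonneg.2 h)]

/-- The kernel `|f x - f y|` is of negative type. -/
lemma integral_abs_sub_mul_mul_nonpos {X : Type*} [MeasurableSpace X] (μ : Measure X)
    [IsFiniteMeasure μ] {f c : X → ℝ} (hf : Measurable f) (hc : Measurable c) {M C : ℝ}
    (hM : ∀ x, |f x| ≤ M) (hC : ∀ x, |c x| ≤ C) (h0 : ∫ x, c x ∂μ = 0) :
    ∫ p, |f p.1 - f p.2| * (c p.1 * c p.2) ∂(μ.prod μ) ≤ 0 := by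
  set ν : Measure ℝ := volume.restrict (Ioc (-M) M)
  set s : X → ℝ → ℝ := fun x t => (Iio (f x)).indicator 1 t
  have hs : Measurable (fun q : X × ℝ => s q.1 q.2) := by
    have : (fun q : X × ℝ => s q.1 q.2) = {q : X × ℝ | q.2 < f q.1}.indicator 1 := by
      ext q; simp [s, indicator]
    rw [this]
    exact measurable_one.indicator (measurableSet_lt measurable_snd (hf.comp measurable_fst))
  have hs01 : ∀ x t, s x t = 0 ∨ s x t = 1 := fun x t => by
    by_cases h : t < f x <;> simp [s, h]
  have hsb : ∀ x t, |s x t| ≤ 1 := fun x t => by rcases hs01 x t with h | h <;> simp [h]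
  have hci : Integrable c μ := Integrable.of_bound hc.aestronglyMeasurable C (ae_of_all _ hC)
  have hsm : ∀ t, Measurable (fun x => s x t) := fun t =>
    hs.comp (measurable_id.prodMk measurable_const)
  have hsci : ∀ t, Integrable (fun x => s x t * c x) μ := fun t =>
    hci.bdd_mul (hsm t).aestronglyMeasurable (ae_of_all _ (fun x => hsb x t))
  have e1 : ∀ p : X × X, |f p.1 - f p.2| * (c p.1 * c p.2)
      = ∫ t, (s p.1 t - s p.2 t) ^ 2 * (c p.1 * c p.2) ∂ν := fun p => by
    rw [integral_mul_const, ← integral_Ioc_sq_sub_indicator (hM p.1) (hM p.2)]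
  simp_rw [e1]
  have hmeas : Measurable (fun q : (X × X) × ℝ =>
      (s q.1.1 q.2 - s q.1.2 q.2) ^ 2 * (c q.1.1 * c q.1.2)) := by
    have h1 : Measurable (fun q : (X × X) × ℝ => s q.1.1 q.2) :=
      hs.comp (by fun_prop : Measurable fun q : (X × X) × ℝ => (q.1.1, q.2))
    have h2 : Measurable (fun q : (X × X) × ℝ => s q.1.2 q.2) :=
      hs.comp (by fun_prop : Measurable fun q : (X × X) × ℝ => (q.1.2, q.2))
    fun_prop
  rw [integral_integral_swap]
  · refine integral_nonpos fun t => ?_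
    have e2 : ∀ p : X × X, (s p.1 t - s p.2 t) ^ 2 * (c p.1 * c p.2)
        = (s p.1 t * c p.1) * c p.2 + c p.1 * (s p.2 t * c p.2)
          - 2 * ((s p.1 t * c p.1) * (s p.2 t * c p.2)) := fun p => by
      rcases hs01 p.1 t with h | h <;> rcases hs01 p.2 t with h' | h' <;> rw [h, h'] <;> ring
    simp only [Pi.zero_apply]
    simp_rw [e2]
    have i1 := (hsci t).mul_prod hci
    have i2 := hci.mul_prod (hsci t)
    have i3 := (hsci t).mul_prod (hsci t)
    have i12 : Integrable (fun p : X × X => s p.1 t * c p.1 * c p.2 + c p.1 * (s p.2 t * c p.2))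
        (μ.prod μ) := i1.add i2
    rw [integral_sub i12 (i3.const_mul 2), integral_add i1 i2, integral_const_mul,
      integral_prod_mul (fun x => s x t * c x) c, integral_prod_mul c (fun x => s x t * c x),
      integral_prod_mul (fun x => s x t * c x) (fun x => s x t * c x), h0]
    nlinarith [mul_self_nonneg (∫ x, s x t * c x ∂μ)]
  · refine Integrable.of_bound hmeas.aestronglyMeasurable (1 * (C * C)) (ae_of_all _ fun q => ?_)
    simp only [Function.uncurry, norm_mul, Real.norm_eq_abs]
    have hC0 : 0 ≤ C := (abs_nonneg _).trans (hC q.1.1)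
    gcongr
    · rcases hs01 q.1.1 q.2 with h | h <;> rcases hs01 q.1.2 q.2 with h' | h' <;> simp [h, h']
    · exact hC _
    · exact hC _

lemma one_sub_four_mul_int_sq_ne_zero (n : ℤ) : (1 - 4 * (n : ℝ) ^ 2) ≠ 0 := by
  intro h
  have h' : (1 - 4 * n ^ 2 : ℤ) = 0 := by exact_mod_cast h
  omega

lemma summable_abs_sin_half_coeff :
    Summable (fun n : ℤ => 2 / π / (1 - 4 * (n : ℝ) ^ 2)) := by
  simp_rw [div_eq_mul_one_div (2 / π)]
  refine Summable.mul_left _ ?_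
  refine (Real.summable_one_div_int_pow.2 one_lt_two).of_norm_bounded_eventually ?_
  filter_upwards [(finite_singleton (0 : ℤ)).compl_mem_cofinite] with n hn
  have hn1 : (1 : ℝ) ≤ (n : ℝ) ^ 2 := by
    have : n ≠ 0 := hn
    have : (1 : ℤ) ≤ n ^ 2 := by have := sq_pos_of_ne_zero (a := n) this; omega
    exact_mod_cast this
  rw [norm_div, norm_one, Real.norm_eq_abs, abs_of_neg (by linarith)]
  exact one_div_le_one_div_of_le (by linarith) (by linarith)

lemma integral_exp_mul_sin_pi (n : ℤ) :
    ∫ x : ℝ in (0 : ℝ)..1, Complex.exp (2 * π * Complex.I * (-n : ℤ) * x) * (Real.sin (π * x) : ℂ)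
      = ((2 / π / (1 - 4 * (n : ℝ) ^ 2) : ℝ) : ℂ) := by
  have hn : (1 - 4 * (n : ℂ) ^ 2) ≠ 0 := by exact_mod_cast one_sub_four_mul_int_sq_ne_zero n
  have hπ : (π : ℂ) ≠ 0 := by exact_mod_cast Real.pi_ne_zero
  set b : ℂ := -1 / (π * (1 - 4 * (n : ℂ) ^ 2)) with hb
  have hd : ∀ x ∈ uIcc (0 : ℝ) 1, HasDerivAt (fun x : ℝ =>
      Complex.exp (2 * π * Complex.I * (-n : ℤ) * x) *
        (2 * Complex.I * n * b * Complex.sin (π * x) + b * Complex.cos (π * x)))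
      (Complex.exp (2 * π * Complex.I * (-n : ℤ) * x) * (Real.sin (π * x) : ℂ)) x := by
    intro x _
    have h1 : HasDerivAt (fun x : ℂ => Complex.exp (2 * π * Complex.I * (-n : ℤ) * x) *
        (2 * Complex.I * n * b * Complex.sin (π * x) + b * Complex.cos (π * x)))
        (Complex.exp (2 * π * Complex.I * (-n : ℤ) * x) * (Real.sin (π * x) : ℂ)) (x : ℂ) := by
      have e1 : ∀ k : ℂ, HasDerivAt (fun x : ℂ => k * x) k (x : ℂ) := fun k => by
        simpa using (hasDerivAt_id (x : ℂ)).const_mul k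
      refine ((e1 (2 * π * Complex.I * (-n : ℤ))).cexp.mul
        (((e1 π).csin.const_mul (2 * Complex.I * n * b)).add
          ((e1 π).ccos.const_mul b))).congr_deriv ?_
      have hbb : b * π * (4 * (n : ℂ) ^ 2 - 1) = 1 := by
        rw [hb]; field_simp; ring
      push_cast
      simp only [Pi.add_apply]
      linear_combination (Complex.exp (2 * π * Complex.I * (-n) * x) * Complex.sin (π * x)) * hbb
        - (Complex.exp (2 * π * Complex.I * (-n) * x) * Complex.sin (π * x)) *
          (4 * π * n ^ 2 * b) * Complex.I_sq
    exact h1.comp_ofReal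
  rw [intervalIntegral.integral_eq_sub_of_hasDerivAt hd
    (Continuous.intervalIntegrable (by fun_prop) _ _)]
  have : Complex.exp (2 * π * Complex.I * (-n : ℤ) * (1 : ℝ)) = 1 := by
    rw [Complex.exp_eq_one_iff]; exact ⟨-n, by push_cast; ring⟩
  rw [this]
  simp [hb]
  field_simp
  ring

/-- The Fourier series of `|sin (x / 2)|`. -/
lemma hasSum_abs_sin_half (x : ℝ) :
    HasSum (fun n : ℤ => 2 / π / (1 - 4 * (n : ℝ) ^ 2) * Real.cos (n * x)) |Real.sin (x / 2)| := by
  have hper : Function.Periodic (fun x : ℝ => ((|Real.sin (π * x)| : ℝ) : ℂ)) 1 := fun x => by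
    simp [mul_add, Real.sin_add_pi]
  have hcont : Continuous (hper.lift : AddCircle (1 : ℝ) → ℂ) :=
    continuous_coinduced_dom.mpr (by
      change Continuous (fun x : ℝ => ((|Real.sin (π * x)| : ℝ) : ℂ))
      fun_prop)
  set f : C(AddCircle (1 : ℝ), ℂ) := ⟨hper.lift, hcont⟩
  have hcoeff : ∀ n : ℤ, fourierCoeff f n = ((2 / π / (1 - 4 * (n : ℝ) ^ 2) : ℝ) : ℂ) := by
    intro n
    rw [fourierCoeff_eq_intervalIntegral _ n 0, ← integral_exp_mul_sin_pi n, zero_add, div_one,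
      one_smul]
    refine intervalIntegral.integral_congr fun t ht => ?_
    rw [uIcc_of_le zero_le_one] at ht
    have h0 : 0 ≤ Real.sin (π * t) := Real.sin_nonneg_of_nonneg_of_le_pi
      (mul_nonneg Real.pi_pos.le ht.1) (by nlinarith [Real.pi_pos, ht.2])
    change fourier (-n) (t : AddCircle (1 : ℝ)) • ((|Real.sin (π * t)| : ℝ) : ℂ) = _
    rw [fourier_coe_apply, abs_of_nonneg h0, smul_eq_mul, Complex.ofReal_one, div_one]
  have hs : Summable (fourierCoeff f) := by
    rw [funext hcoeff]
    exact Complex.summable_ofReal.2 summable_abs_sin_half_coeff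
  have := has_pointwise_sum_fourier_series_of_summable hs ((x / (2 * π) : ℝ) : AddCircle (1 : ℝ))
  have h2 := Complex.hasSum_re this
  convert h2 using 1
  · ext n
    rw [hcoeff, fourier_coe_apply, smul_eq_mul, Complex.re_ofReal_mul]
    congr 1
    have : 2 * π * Complex.I * n * (x / (2 * π) : ℝ) / (1 : ℝ) = ((n * x : ℝ) : ℂ) * Complex.I := by
      have hπ : (π : ℂ) ≠ 0 := by exact_mod_cast Real.pi_ne_zero
      push_cast
      field_simp
    rw [this, Complex.exp_ofReal_mul_I_re]
  · change _ = ((|Real.sin (π * (x / (2 * π)))| : ℝ) : ℂ).re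
    rw [Complex.ofReal_re]
    congr 2
    field_simp

lemma integral_cos_int_mul {n : ℤ} (hn : n ≠ 0) :
    ∫ x in Ioc 0 (2 * π), Real.cos (n * x) = 0 := by
  rw [← intervalIntegral.integral_of_le Real.two_pi_pos.le,
    intervalIntegral.integral_comp_mul_left (fun x => Real.cos x) (by exact_mod_cast hn)]
  have h : Real.sin (n * (2 * π)) = 0 := by
    simpa [mul_assoc] using Real.sin_int_mul_pi (n * 2)
  simp [h]

lemma integral_sin_int_mul {n : ℤ} (hn : n ≠ 0) :
    ∫ x in Ioc 0 (2 * π), Real.sin (n * x) = 0 := by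
  rw [← intervalIntegral.integral_of_le Real.two_pi_pos.le,
    intervalIntegral.integral_comp_mul_left (fun x => Real.sin x) (by exact_mod_cast hn)]
  simp [Real.cos_int_mul_two_pi]

lemma integrable_circle_prod {F : ℝ × ℝ → ℝ} (hF : Continuous F) :
    Integrable F ((volume.restrict (Ioc 0 (2 * π))).prod (volume.restrict (Ioc 0 (2 * π)))) := by
  rw [Measure.prod_restrict, ← Measure.volume_eq_prod]
  exact (hF.continuousOn.integrableOn_compact (isCompact_Icc.prod isCompact_Icc)).mono_set
    (prod_mono Ioc_subset_Icc_self Ioc_subset_Icc_self)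

lemma integral_abs_sub_mul_cos_nonpos {G : ℝ → ℝ} (hG : Continuous G) {M : ℝ}
    (hM : ∀ x, |G x| ≤ M) {n : ℤ} (hn : n ≠ 0) :
    ∫ p, |G p.1 - G p.2| * Real.cos (n * (p.1 - p.2))
      ∂((volume.restrict (Ioc 0 (2 * π))).prod (volume.restrict (Ioc 0 (2 * π)))) ≤ 0 := by
  have h1 := integral_abs_sub_mul_mul_nonpos (volume.restrict (Ioc 0 (2 * π))) hG.measurable
    (c := fun x => Real.cos (n * x)) (by fun_prop) hM (fun x => Real.abs_cos_le_one _)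
    (integral_cos_int_mul hn)
  have h2 := integral_abs_sub_mul_mul_nonpos (volume.restrict (Ioc 0 (2 * π))) hG.measurable
    (c := fun x => Real.sin (n * x)) (by fun_prop) hM (fun x => Real.abs_sin_le_one _)
    (integral_sin_int_mul hn)
  have e : ∀ p : ℝ × ℝ, |G p.1 - G p.2| * Real.cos (n * (p.1 - p.2))
      = |G p.1 - G p.2| * (Real.cos (n * p.1) * Real.cos (n * p.2))
        + |G p.1 - G p.2| * (Real.sin (n * p.1) * Real.sin (n * p.2)) := fun p => by
    rw [mul_sub, Real.cos_sub]; ring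
  simp_rw [e]
  rw [integral_add (integrable_circle_prod (by fun_prop)) (integrable_circle_prod (by fun_prop))]
  linarith

/-- Weighting `|G α - G β|` by the half chord length `|sin ((α - β) / 2)|` costs at most the mean
value `2 / π` of the weight. -/
lemma integral_abs_sub_le_integral_abs_sub_mul_sin {G : ℝ → ℝ} (hG : Continuous G) {M : ℝ}
    (hM : ∀ x, |G x| ≤ M) :
    2 / π * ∫ p, |G p.1 - G p.2|
        ∂((volume.restrict (Ioc 0 (2 * π))).prod (volume.restrict (Ioc 0 (2 * π)))) ≤
      ∫ p, |G p.1 - G p.2| * |Real.sin ((p.1 - p.2) / 2)|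
        ∂((volume.restrict (Ioc 0 (2 * π))).prod (volume.restrict (Ioc 0 (2 * π)))) := by
  set μ := (volume.restrict (Ioc 0 (2 * π))).prod (volume.restrict (Ioc 0 (2 * π)))
  have hM2 : ∀ p : ℝ × ℝ, |(|G p.1 - G p.2|)| ≤ 2 * M := fun p => by
    rw [abs_abs]
    linarith [abs_sub (G p.1) (G p.2), hM p.1, hM p.2]
  have hsum : HasSum (fun n : ℤ => ∫ p, 2 / π / (1 - 4 * (n : ℝ) ^ 2) *
      (|G p.1 - G p.2| * Real.cos (n * (p.1 - p.2))) ∂μ)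
      (∫ p, |G p.1 - G p.2| * |Real.sin ((p.1 - p.2) / 2)| ∂μ) := by
    refine hasSum_integral_of_dominated_convergence
      (fun n _ => |2 / π / (1 - 4 * (n : ℝ) ^ 2)| * (2 * M))
      (fun n => Continuous.aestronglyMeasurable (by fun_prop)) ?_ ?_ ?_ ?_
    · refine fun n => ae_of_all _ fun p => ?_
      rw [norm_mul, norm_mul, Real.norm_eq_abs, Real.norm_eq_abs, Real.norm_eq_abs]
      exact mul_le_mul_of_nonneg_left ((mul_le_of_le_one_right (abs_nonneg _)
        (Real.abs_cos_le_one _)).trans (hM2 p)) (abs_nonneg _)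
    · exact ae_of_all _ fun p => summable_abs_sin_half_coeff.abs.mul_right _
    · exact integrable_const _
    · refine ae_of_all _ fun p => ?_
      simpa only [mul_left_comm] using (hasSum_abs_sin_half (p.1 - p.2)).mul_left |G p.1 - G p.2|
  have := le_hasSum hsum 0 fun n hn => ?_
  · simpa [integral_const_mul] using this
  · rw [integral_const_mul]
    refine mul_nonneg_of_nonpos_of_nonpos (div_nonpos_of_nonneg_of_nonpos (by positivity) ?_)
      (integral_abs_sub_mul_cos_nonpos hG hM hn)
    have : (1 : ℤ) ≤ n ^ 2 := by have := sq_pos_of_ne_zero (a := n) hn; omega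
    have : (1 : ℝ) ≤ (n : ℝ) ^ 2 := by exact_mod_cast this
    linarith

lemma integral_circle_prod_eq {H : ℝ → ℝ → ℝ} (hH : Continuous fun p : ℝ × ℝ => H p.1 p.2)
    (h1 : ∀ y, Function.Periodic (fun x => H x y) (2 * π))
    (h2 : ∀ x, Function.Periodic (H x) (2 * π)) :
    ∫ p, H p.1 p.2 ∂((volume.restrict (Ioc 0 (2 * π))).prod (volume.restrict (Ioc 0 (2 * π))))
      = 2 * ∫ p, H (p.1 + p.2) (p.1 - p.2)
        ∂((volume.restrict (Ioc 0 (2 * π))).prod (volume.restrict (Ioc 0 π))) := by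
  have hH' : ∀ {X : Type} [TopologicalSpace X] {a b : X → ℝ}, Continuous a → Continuous b →
      Continuous fun x => H (a x) (b x) := fun ha hb => hH.comp (ha.prodMk hb)
  have hint : Integrable (fun p : ℝ × ℝ => H (p.1 + p.2) (p.1 - p.2))
      ((volume.restrict (Ioc 0 (2 * π))).prod (volume.restrict (Ioc 0 π))) := by
    rw [Measure.prod_restrict, ← Measure.volume_eq_prod]
    refine IntegrableOn.mono_set (ContinuousOn.integrableOn_compact
      (isCompact_Icc.prod isCompact_Icc) ?_)
      (prod_mono Ioc_subset_Icc_self Ioc_subset_Icc_self)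
    exact (hH' (by fun_prop) (by fun_prop)).continuousOn
  rw [integral_prod_symm _ (integrable_circle_prod hH), integral_prod_symm _ hint]
  have inner : ∀ y, ∫ x in Ioc 0 (2 * π), H x y = 2 * ∫ θ in Ioc 0 π, H (y + 2 * θ) y := by
    intro y
    rw [← intervalIntegral.integral_of_le Real.two_pi_pos.le,
      ← intervalIntegral.integral_of_le Real.pi_pos.le,
      intervalIntegral.integral_comp_add_mul (fun x => H x y) two_ne_zero y, smul_eq_mul,
      mul_inv_cancel_left₀ two_ne_zero, mul_zero, add_zero,
      (h1 y).intervalIntegral_add_eq y 0, zero_add]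
  simp_rw [inner]
  rw [integral_const_mul]
  congr 1
  rw [integral_integral_swap]
  · congr 1 with θ
    rw [← intervalIntegral.integral_of_le Real.two_pi_pos.le,
      ← intervalIntegral.integral_of_le Real.two_pi_pos.le]
    have hp : Function.Periodic (fun y => H (y + 2 * θ) y) (2 * π) := fun y => by
      have h3 : H (y + 2 * θ + 2 * π) (y + 2 * π) = H (y + 2 * θ) (y + 2 * π) := h1 _ _
      change H (y + 2 * π + 2 * θ) (y + 2 * π) = H (y + 2 * θ) y
      rw [add_right_comm, h3, h2 (y + 2 * θ) y]
    have h3 := intervalIntegral.integral_comp_sub_right (a := 0) (b := 2 * π)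
      (fun y => H (y + 2 * θ) y) θ
    rw [show (2 * π - θ) = 0 - θ + 2 * π by ring, hp.intervalIntegral_add_eq (0 - θ) 0,
      zero_add] at h3
    rw [← h3]
    refine intervalIntegral.integral_congr fun y _ => ?_
    rw [show y - θ + 2 * θ = y + θ by ring]
  · simp only [Function.uncurry_def]
    rw [Measure.prod_restrict, ← Measure.volume_eq_prod]
    refine IntegrableOn.mono_set (ContinuousOn.integrableOn_compact
      (isCompact_Icc.prod isCompact_Icc) ?_)
      (prod_mono Ioc_subset_Icc_self Ioc_subset_Icc_self)
    exact (hH' (by fun_prop) (by fun_prop)).continuousOn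

lemma lintegral_abs_sub_le_lintegral_chord {G : ℝ → ℝ} (hG : Continuous G)
    (hper : Function.Periodic G (2 * π)) :
    ∫⁻ x in Ioc 0 (2 * π), ∫⁻ y in Ioc 0 (2 * π), ENNReal.ofReal |G x - G y| ≤
      ENNReal.ofReal π * ∫⁻ φ in Ioc 0 (2 * π), ∫⁻ θ in Ioo 0 π,
        ENNReal.ofReal (Real.sin θ) * ENNReal.ofReal |G (φ + θ) - G (φ - θ)| := by
  obtain ⟨M, hM⟩ : ∃ M, ∀ x, |G x| ≤ M := by
    obtain ⟨M, hM⟩ := (isCompact_Icc (a := 0) (b := 2 * π)).exists_bound_of_continuousOn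
      hG.continuousOn
    refine ⟨M, fun x => ?_⟩
    obtain ⟨y, hy, hxy⟩ := hper.exists_mem_Ico₀ Real.two_pi_pos x
    rw [hxy]
    exact hM y (Ico_subset_Icc_self hy)
  have hsin : ∀ x : ℝ, |Real.sin ((x + 2 * π) / 2)| = |Real.sin (x / 2)| := fun x => by
    rw [add_div, mul_div_cancel_left₀ _ two_ne_zero, Real.sin_add_pi, abs_neg]
  have key : ∫ p, |G p.1 - G p.2|
        ∂((volume.restrict (Ioc 0 (2 * π))).prod (volume.restrict (Ioc 0 (2 * π)))) ≤
      π * ∫ p, |Real.sin p.2| * |G (p.1 + p.2) - G (p.1 - p.2)|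
        ∂((volume.restrict (Ioc 0 (2 * π))).prod (volume.restrict (Ioc 0 π))) := by
    have h := integral_abs_sub_le_integral_abs_sub_mul_sin hG hM
    rw [integral_circle_prod_eq (H := fun x y => |G x - G y| * |Real.sin ((x - y) / 2)|)
      (by fun_prop)
      (fun y x => by simp only [hper x]; rw [add_sub_right_comm, hsin])
      (fun x y => by
        simp only [hper y]
        rw [← hsin (x - (y + 2 * π))]
        congr 4; ring)] at h
    have e : ∀ p : ℝ × ℝ, |G (p.1 + p.2) - G (p.1 - p.2)| *
        |Real.sin ((p.1 + p.2 - (p.1 - p.2)) / 2)|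
        = |Real.sin p.2| * |G (p.1 + p.2) - G (p.1 - p.2)| := fun p => by
      rw [mul_comm]; congr 3; ring
    simp_rw [e] at h
    rw [div_mul_eq_mul_div, div_le_iff₀ Real.pi_pos] at h
    linarith
  have hint : Integrable (fun p : ℝ × ℝ => |Real.sin p.2| * |G (p.1 + p.2) - G (p.1 - p.2)|)
      ((volume.restrict (Ioc 0 (2 * π))).prod (volume.restrict (Ioc 0 π))) := by
    rw [Measure.prod_restrict, ← Measure.volume_eq_prod]
    refine IntegrableOn.mono_set (ContinuousOn.integrableOn_compact
      (isCompact_Icc.prod isCompact_Icc) ?_)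
      (prod_mono Ioc_subset_Icc_self Ioc_subset_Icc_self)
    fun_prop
  have h := ENNReal.ofReal_le_ofReal key
  rw [ENNReal.ofReal_mul Real.pi_pos.le,
    ofReal_integral_eq_lintegral_ofReal (integrable_circle_prod (by fun_prop))
      (ae_of_all _ fun p => abs_nonneg _),
    ofReal_integral_eq_lintegral_ofReal hint (ae_of_all _ fun p => by positivity),
    lintegral_prod _ (Continuous.measurable (by fun_prop)).ennreal_ofReal.aemeasurable,
    lintegral_prod _ (Continuous.measurable (by fun_prop)).ennreal_ofReal.aemeasurable] at h
  refine h.trans_eq ?_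
  congr 1
  refine lintegral_congr fun φ => ?_
  rw [restrict_Ioo_eq_restrict_Ioc]
  refine setLIntegral_congr_fun measurableSet_Ioc fun θ hθ => ?_
  simp only
  rw [abs_of_nonneg (Real.sin_nonneg_of_nonneg_of_le_pi hθ.1.le hθ.2),
    ENNReal.ofReal_mul (Real.sin_nonneg_of_nonneg_of_le_pi hθ.1.le hθ.2)]

lemma periodic_exp_ofReal_mul_I :
    Function.Periodic (fun x : ℝ => Complex.exp (x * Complex.I)) (2 * π) := fun x => by
  simp only
  push_cast
  rw [add_mul, Complex.exp_add, Complex.exp_two_pi_mul_I, mul_one]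

lemma ofReal_abs_sub_le_lintegral {f f' : ℝ → ℝ} {a b : ℝ} (hab : a ≤ b)
    (hf : ContinuousOn f (Icc a b)) (hd : ∀ x ∈ Ioo a b, HasDerivAt f (f' x) x)
    (hm : Measurable f') :
    ENNReal.ofReal |f b - f a| ≤ ∫⁻ x in Ioo a b, ENNReal.ofReal |f' x| := by
  by_cases h : ∫⁻ x in Ioo a b, ENNReal.ofReal |f' x| = ∞
  · rw [h]; exact le_top
  have hi : IntegrableOn f' (Ioo a b) := by
    refine ⟨hm.aestronglyMeasurable, ?_⟩
    rw [HasFiniteIntegral]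
    simp_rw [← ofReal_norm]
    exact lt_top_iff_ne_top.2 h
  rw [← intervalIntegral.integral_eq_sub_of_hasDerivAt_of_le hab hf hd
    ((intervalIntegrable_iff_integrableOn_Ioo_of_le hab).2 hi),
    intervalIntegral.integral_of_le hab, integral_Ioc_eq_integral_Ioo]
  refine (ENNReal.ofReal_le_ofReal (abs_integral_le_integral_abs)).trans_eq ?_
  exact ofReal_integral_eq_lintegral_ofReal hi.abs (ae_of_all _ fun x => abs_nonneg _)

/-- Integrating the increments of `U` over all vertical chords of the unit disk. -/
lemma lintegral_vertical_chord_le {U : ℂ → ℝ} (hc : ContinuousOn U (closedBall 0 1))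
    (hd : DifferentiableOn ℝ U (ball 0 1)) :
    ∫⁻ θ in Ioo 0 π, ENNReal.ofReal (Real.sin θ) *
        ENNReal.ofReal |U (Complex.exp (θ * Complex.I)) - U (Complex.exp (-θ * Complex.I))| ≤
      ∫⁻ z in ball (0 : ℂ) 1, ENNReal.ofReal |fderiv ℝ U z Complex.I| := by
  set W : ℂ → ℝ := fun z => fderiv ℝ U z Complex.I
  have hW : Measurable W := measurable_fderiv_apply_const ℝ U Complex.I
  have hmem : ∀ x y : ℝ, (⟨x, y⟩ : ℂ) ∈ ball (0 : ℂ) 1 ↔ x ^ 2 + y ^ 2 < 1 := fun x y => by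
    rw [mem_ball_zero_iff, ← sq_lt_one_iff₀ (norm_nonneg _), Complex.sq_norm, Complex.normSq_mk,
      sq, sq]
  have hmem' : ∀ x y : ℝ, (⟨x, y⟩ : ℂ) ∈ closedBall (0 : ℂ) 1 ↔ x ^ 2 + y ^ 2 ≤ 1 := fun x y => by
    rw [mem_closedBall_zero_iff, ← sq_le_one_iff₀ (norm_nonneg _), Complex.sq_norm,
      Complex.normSq_mk, sq, sq]
  set K : ℂ → ℝ≥0∞ := (ball (0 : ℂ) 1).indicator fun z => ENNReal.ofReal |W z|
  have hK : Measurable K := (hW.abs.ennreal_ofReal).indicator measurableSet_ball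
  have hpt : ∀ θ ∈ Ioo 0 π, ENNReal.ofReal (Real.sin θ) *
      ENNReal.ofReal |U (Complex.exp (θ * Complex.I)) - U (Complex.exp (-θ * Complex.I))| ≤
      ENNReal.ofReal |(-Real.sin θ)| * ∫⁻ y, K ⟨Real.cos θ, y⟩ := by
    intro θ hθ
    have hs := Real.sin_pos_of_pos_of_lt_pi hθ.1 hθ.2
    rw [abs_neg, abs_of_pos hs]
    gcongr
    have e1 : Complex.exp (θ * Complex.I) = ⟨Real.cos θ, Real.sin θ⟩ := by
      apply Complex.ext <;> simp [Complex.exp_ofReal_mul_I_re, Complex.exp_ofReal_mul_I_im]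
    have e2 : Complex.exp (-θ * Complex.I) = ⟨Real.cos θ, -Real.sin θ⟩ := by
      rw [← Complex.ofReal_neg]
      apply Complex.ext <;> simp only [Complex.exp_ofReal_mul_I_re, Complex.exp_ofReal_mul_I_im,
        Real.cos_neg, Real.sin_neg]
    rw [e1, e2]
    have hcs := Real.sin_sq_add_cos_sq θ
    have hder : ∀ y : ℝ, HasDerivAt (fun y : ℝ => (⟨Real.cos θ, y⟩ : ℂ)) Complex.I y := fun y => by
      have h : HasDerivAt (fun y : ℝ => (Real.cos θ : ℂ) + y * Complex.I) (1 * Complex.I) y :=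
        ((Complex.ofRealCLM.hasDerivAt (x := y)).mul_const Complex.I).const_add _
      rw [one_mul] at h
      refine h.congr_of_eventuallyEq (Eventually.of_forall fun y => ?_)
      exact Complex.mk_eq_add_mul_I _ _
    have hcont : Continuous (fun y : ℝ => (⟨Real.cos θ, y⟩ : ℂ)) :=
      continuous_iff_continuousAt.2 fun y => (hder y).continuousAt
    have hin : ∀ y ∈ Ioo (-Real.sin θ) (Real.sin θ), (⟨Real.cos θ, y⟩ : ℂ) ∈ ball (0 : ℂ) 1 := by
      intro y hy
      rw [hmem]
      nlinarith [hy.1, hy.2]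
    have := ofReal_abs_sub_le_lintegral (f := fun y => U ⟨Real.cos θ, y⟩)
      (f' := fun y => W ⟨Real.cos θ, y⟩) (a := -Real.sin θ) (b := Real.sin θ) (by linarith)
      (hc.comp hcont.continuousOn fun y hy => by
        rw [hmem']
        nlinarith [hy.1, hy.2])
      (fun y hy => (hd.differentiableAt
        (isOpen_ball.mem_nhds (hin y hy))).hasFDerivAt.comp_hasDerivAt y (hder y))
      (hW.comp hcont.measurable)
    refine this.trans ?_
    rw [← lintegral_indicator measurableSet_Ioo]
    refine lintegral_mono fun y => ?_
    by_cases hy : y ∈ Ioo (-Real.sin θ) (Real.sin θ)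
    · rw [indicator_of_mem hy]
      simp only [K]
      rw [indicator_of_mem (hin y hy)]
    · rw [indicator_of_notMem hy]; exact zero_le
  calc _ ≤ ∫⁻ θ in Ioo 0 π, ENNReal.ofReal |(-Real.sin θ)| * ∫⁻ y, K ⟨Real.cos θ, y⟩ :=
        setLIntegral_mono' measurableSet_Ioo hpt
    _ = ∫⁻ x in Real.cos '' Ioo 0 π, ∫⁻ y, K ⟨x, y⟩ :=
        (lintegral_image_eq_lintegral_abs_deriv_mul measurableSet_Ioo
          (fun x _ => (Real.hasDerivAt_cos x).hasDerivWithinAt)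
          (Real.injOn_cos.mono Ioo_subset_Icc_self) fun x => ∫⁻ y, K ⟨x, y⟩).symm
    _ ≤ ∫⁻ x, ∫⁻ y, K ⟨x, y⟩ := setLIntegral_le_lintegral _ _
    _ = ∫⁻ p : ℝ × ℝ, K (Complex.measurableEquivRealProd.symm p) :=
        (lintegral_prod _
          (hK.comp Complex.measurableEquivRealProd.symm.measurable).aemeasurable).symm
    _ = ∫⁻ z, K z := Complex.volume_preserving_equiv_real_prod.symm.lintegral_comp hK
    _ = _ := lintegral_indicator measurableSet_ball _

lemma lintegral_chord_le {U : ℂ → ℝ} (hc : ContinuousOn U (closedBall 0 1))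
    (hd : DifferentiableOn ℝ U (ball 0 1)) (φ : ℝ) :
    ∫⁻ θ in Ioo 0 π, ENNReal.ofReal (Real.sin θ) *
        ENNReal.ofReal |U (Complex.exp ((φ + θ : ℝ) * Complex.I))
          - U (Complex.exp ((φ - θ : ℝ) * Complex.I))| ≤
      ∫⁻ z in ball (0 : ℂ) 1,
        ENNReal.ofReal |fderiv ℝ U z (Complex.exp (φ * Complex.I) * Complex.I)| := by
  set R : ℂ ≃ₗᵢ[ℝ] ℂ := rotation (Circle.exp φ)
  have hR : ∀ z, R z = Complex.exp (φ * Complex.I) * z := fun z => by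
    simp [R, rotation_apply, Circle.coe_exp]
  have hRb : R ⁻¹' ball 0 1 = ball 0 1 := by ext z; simp
  have h := lintegral_vertical_chord_le (U := U ∘ R)
    (hc.comp R.continuous.continuousOn fun z hz => by simpa using hz)
    (hd.comp R.differentiable.differentiableOn fun z hz => by simpa using hz)
  have e : ∀ θ : ℝ, R (Complex.exp (θ * Complex.I)) = Complex.exp ((φ + θ : ℝ) * Complex.I) :=
    fun θ => by rw [hR, ← Complex.exp_add]; congr 1; push_cast; ring
  have e' : ∀ θ : ℝ, R (Complex.exp (-θ * Complex.I)) = Complex.exp ((φ - θ : ℝ) * Complex.I) :=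
    fun θ => by rw [hR, ← Complex.exp_add]; congr 1; push_cast; ring
  simp_rw [Function.comp_apply, e, e'] at h
  refine h.trans_eq ?_
  have hm : Measurable fun z =>
      ENNReal.ofReal |fderiv ℝ U z (Complex.exp (φ * Complex.I) * Complex.I)| :=
    (measurable_fderiv_apply_const ℝ U _).abs.ennreal_ofReal
  rw [← R.measurePreserving.setLIntegral_comp_preimage measurableSet_ball hm, hRb]
  refine setLIntegral_congr_fun measurableSet_ball fun z hz => ?_
  have hz' : R z ∈ ball (0 : ℂ) 1 := by simpa using hz
  have := ((hd.differentiableAt (isOpen_ball.mem_nhds hz')).hasFDerivAt.comp z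
    R.toContinuousLinearEquiv.hasFDerivAt).fderiv
  change ENNReal.ofReal |fderiv ℝ (U ∘ R) z Complex.I|
    = ENNReal.ofReal |fderiv ℝ U (R z) (Complex.exp (φ * Complex.I) * Complex.I)|
  rw [show fderiv ℝ (U ∘ R) z = _ from this, ← hR]
  rfl

/-- Bound for the integral of `|ℓ|` over the unit circle. -/
lemma lintegral_abs_apply_direction_le (ℓ : ℂ →L[ℝ] ℝ) :
    ∫⁻ φ in Ioc 0 (2 * π), ENNReal.ofReal |ℓ (Complex.exp ((φ : ℝ) * Complex.I) * Complex.I)| ≤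
      ENNReal.ofReal (4 * ‖ℓ‖) := by
  set a := ℓ Complex.I
  set b := -ℓ 1
  set z : ℂ := ⟨b, a⟩
  have h1 : ∀ φ : ℝ, ℓ (Complex.exp (φ * Complex.I) * Complex.I)
      = ‖z‖ * Real.sin (φ + z.arg) := fun φ => by
    have e : Complex.exp (φ * Complex.I) * Complex.I
        = Real.cos φ • Complex.I + (-Real.sin φ) • (1 : ℂ) := by
      rw [Complex.exp_mul_I]
      apply Complex.ext <;> simp
    have e1 : ‖z‖ * Real.cos z.arg = b := Complex.norm_mul_cos_arg z
    have e2 : ‖z‖ * Real.sin z.arg = a := Complex.norm_mul_sin_arg z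
    rw [e, map_add, map_smul, map_smul, Real.sin_add]
    simp only [smul_eq_mul]
    linear_combination (-Real.sin φ) * e1 - Real.cos φ * e2
  have h2 : ‖z‖ ≤ ‖ℓ‖ := by
    by_cases hz : ‖z‖ = 0
    · rw [hz]; exact norm_nonneg _
    have hpos : 0 < ‖z‖ := lt_of_le_of_ne (norm_nonneg _) (Ne.symm hz)
    have e1 : ℓ ⟨-b, a⟩ = ‖z‖ ^ 2 := by
      rw [show (⟨-b, a⟩ : ℂ) = a • Complex.I + (-b) • (1 : ℂ) by apply Complex.ext <;> simp,
        map_add, map_smul, map_smul, Complex.sq_norm, Complex.normSq_mk]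
      simp only [smul_eq_mul, a, b]
      ring
    have e2 : ‖(⟨-b, a⟩ : ℂ)‖ = ‖z‖ := by
      rw [← sq_eq_sq₀ (norm_nonneg _) (norm_nonneg _), Complex.sq_norm, Complex.sq_norm,
        Complex.normSq_mk, Complex.normSq_mk]
      ring
    have e3 := (le_abs_self _).trans (ℓ.le_opNorm ⟨-b, a⟩)
    rw [e1, e2, sq] at e3
    exact le_of_mul_le_mul_right e3 hpos
  have hper : Function.Periodic (fun x => |Real.sin x|) (2 * π) := fun x => by simp
  have h3 : ∫ φ in Ioc 0 (2 * π), |ℓ (Complex.exp ((φ : ℝ) * Complex.I) * Complex.I)|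
      = ‖z‖ * 4 := by
    simp_rw [h1, abs_mul, abs_norm]
    rw [integral_const_mul, ← intervalIntegral.integral_of_le Real.two_pi_pos.le,
      intervalIntegral.integral_comp_add_right (fun x => |Real.sin x|), zero_add,
      add_comm (2 * π), hper.intervalIntegral_add_eq _ 0, zero_add]
    congr 1
    rw [← intervalIntegral.integral_add_adjacent_intervals (b := π)
      (Continuous.intervalIntegrable (by fun_prop) _ _)
      (Continuous.intervalIntegrable (by fun_prop) _ _)]
    have i1 : ∫ x in 0..π, |Real.sin x| = ∫ x in 0..π, Real.sin x :=
      intervalIntegral.integral_congr fun x hx => by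
        rw [uIcc_of_le Real.pi_pos.le] at hx
        exact abs_of_nonneg (Real.sin_nonneg_of_nonneg_of_le_pi hx.1 hx.2)
    have i2 : ∫ x in π..(2 * π), |Real.sin x| = ∫ x in 0..π, |Real.sin x| := by
      have := intervalIntegral.integral_comp_add_right (a := 0) (b := π) (fun x => |Real.sin x|) π
      simp only [Real.sin_add_pi, abs_neg, zero_add, ← two_mul] at this
      exact this.symm
    rw [i2, i1, integral_sin]
    norm_num
  rw [← ofReal_integral_eq_lintegral_ofReal _ (ae_of_all _ fun _ => abs_nonneg _), h3]
  · exact ENNReal.ofReal_le_ofReal (by linarith)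
  · exact (Continuous.integrableOn_Icc (by fun_prop)).mono_set Ioc_subset_Icc_self

lemma lintegral_circle_abs_sub_le {U : ℂ → ℝ} (hc : ContinuousOn U (closedBall 0 1))
    (hd : DifferentiableOn ℝ U (ball 0 1)) :
    ∫⁻ x in Ioc 0 (2 * π), ∫⁻ y in Ioc 0 (2 * π),
        ENNReal.ofReal |U (Complex.exp ((x : ℝ) * Complex.I))
          - U (Complex.exp ((y : ℝ) * Complex.I))| ≤
      ENNReal.ofReal (4 * π) * ∫⁻ z in ball (0 : ℂ) 1, ENNReal.ofReal ‖fderiv ℝ U z‖ := by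
  have hG : Continuous fun x : ℝ => U (Complex.exp (x * Complex.I)) :=
    hc.comp_continuous (by fun_prop) fun x => by simp [Complex.norm_exp_ofReal_mul_I]
  have hper : Function.Periodic (fun x : ℝ => U (Complex.exp (x * Complex.I))) (2 * π) :=
    periodic_exp_ofReal_mul_I.comp U
  have hm : Measurable fun p : ℝ × ℂ =>
      fderiv ℝ U p.2 (Complex.exp (p.1 * Complex.I) * Complex.I) := by
    have e : ∀ p : ℝ × ℂ, fderiv ℝ U p.2 (Complex.exp (p.1 * Complex.I) * Complex.I)
        = Real.cos p.1 * fderiv ℝ U p.2 Complex.I - Real.sin p.1 * fderiv ℝ U p.2 1 := fun p => by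
      have e : Complex.exp (p.1 * Complex.I) * Complex.I
          = Real.cos p.1 • Complex.I - Real.sin p.1 • (1 : ℂ) := by
        rw [Complex.exp_mul_I]
        apply Complex.ext <;> simp
      rw [e, map_sub, map_smul, map_smul, smul_eq_mul, smul_eq_mul]
    simp_rw [e]
    have h_snd : Measurable (Prod.snd : ℝ × ℂ → ℂ) := measurable_snd
    have m1 := (measurable_fderiv_apply_const ℝ U Complex.I).comp h_snd
    have m2 := (measurable_fderiv_apply_const ℝ U 1).comp h_snd
    exact ((by fun_prop : Measurable fun p : ℝ × ℂ => Real.cos p.1).mul m1).sub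
      ((by fun_prop : Measurable fun p : ℝ × ℂ => Real.sin p.1).mul m2)
  calc _ ≤ ENNReal.ofReal π * ∫⁻ φ in Ioc 0 (2 * π), ∫⁻ z in ball (0 : ℂ) 1,
        ENNReal.ofReal |fderiv ℝ U z (Complex.exp ((φ : ℝ) * Complex.I) * Complex.I)| := by
        refine (lintegral_abs_sub_le_lintegral_chord hG hper).trans ?_
        gcongr with φ
        exact lintegral_chord_le hc hd φ
    _ = ENNReal.ofReal π * ∫⁻ z in ball (0 : ℂ) 1, ∫⁻ φ in Ioc 0 (2 * π),
        ENNReal.ofReal |fderiv ℝ U z (Complex.exp ((φ : ℝ) * Complex.I) * Complex.I)| := by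
        rw [lintegral_lintegral_swap]
        exact hm.abs.ennreal_ofReal.aemeasurable
    _ ≤ ENNReal.ofReal π * ∫⁻ z in ball (0 : ℂ) 1, ENNReal.ofReal (4 * ‖fderiv ℝ U z‖) := by
        gcongr with z
        exact lintegral_abs_apply_direction_le _
    _ = _ := by
        simp_rw [ENNReal.ofReal_mul (zero_le_four (α := ℝ))]
        rw [lintegral_const_mul' _ _ ENNReal.ofReal_ne_top]
        ring

lemma hausdorffMeasure_restrict_sphere_le {E : Type*} [NormedAddCommGroup E]
    [InnerProductSpace ℝ E] [MeasurableSpace E] [BorelSpace E] (L : ℂ ≃ₗᵢ[ℝ] E) :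
    (μH[(1 : ℝ)] : Measure E).restrict (sphere 0 1) ≤
      (volume.restrict (Ioc 0 (2 * π))).map fun x : ℝ => L (Complex.exp (x * Complex.I)) := by
  set e : ℝ → E := fun x => L (Complex.exp (x * Complex.I))
  have he : LipschitzWith 1 e := by
    refine LipschitzWith.of_dist_le_mul fun x y => ?_
    have h : Complex.exp (x * Complex.I) - Complex.exp (y * Complex.I)
        = Complex.exp (y * Complex.I) * (Complex.exp (Complex.I * (x - y : ℝ)) - 1) := by
      rw [mul_sub, ← Complex.exp_add, mul_one]
      congr 2
      push_cast
      ring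
    rw [L.dist_map, dist_eq_norm, dist_eq_norm, h, norm_mul, Complex.norm_exp_ofReal_mul_I,
      one_mul, NNReal.coe_one, one_mul]
    exact Real.norm_exp_I_mul_ofReal_sub_one_le
  have hem : Measurable e := he.continuous.measurable
  refine Measure.le_iff.2 fun A hA => ?_
  rw [Measure.restrict_apply hA, Measure.map_apply hem hA, Measure.restrict_apply (hem hA)]
  have hsub : A ∩ sphere 0 1 ⊆ e '' (e ⁻¹' A ∩ Ioc 0 (2 * π)) := by
    rintro p ⟨hpA, hp⟩
    have hn : ‖L.symm p‖ = 1 := by simpa using hp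
    obtain ⟨x, hx, hxe⟩ := periodic_exp_ofReal_mul_I.exists_mem_Ioc Real.two_pi_pos (L.symm p).arg 0
    rw [zero_add] at hx
    have : e x = p := by
      have h := Complex.norm_mul_exp_arg_mul_I (L.symm p)
      rw [hn, Complex.ofReal_one, one_mul] at h
      simp only [e]
      rw [← hxe, h, L.apply_symm_apply]
    exact ⟨x, ⟨by rwa [mem_preimage, this], hx⟩, this⟩
  refine (measure_mono hsub).trans ((he.hausdorffMeasure_image_le zero_le_one _).trans_eq ?_)
  rw [hausdorffMeasure_real]
  simp

/-- for every `u` continuous on the closed unit disk of `ℝ²` and smooth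
inside, `∬_{∂D×∂D} |u(x)−u(y)| ds ds ≤ 4π ∫_D |∇u| dx`. -/
theorem stmt_12 (u : EuclideanSpace ℝ (Fin 2) → ℝ)
    (hc : ContinuousOn u (closedBall (0 : EuclideanSpace ℝ (Fin 2)) 1))
    (hsm : ContDiffOn ℝ (⊤ : ℕ∞) u (ball (0 : EuclideanSpace ℝ (Fin 2)) 1)) :
    ∫⁻ x in sphere (0 : EuclideanSpace ℝ (Fin 2)) 1,
      ∫⁻ y in sphere (0 : EuclideanSpace ℝ (Fin 2)) 1,
        ENNReal.ofReal |u x - u y| ∂(μH[(1 : ℝ)]) ∂(μH[(1 : ℝ)]) ≤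
      ENNReal.ofReal (4 * π) *
        ∫⁻ x in ball (0 : EuclideanSpace ℝ (Fin 2)) 1,
          ENNReal.ofReal ‖fderiv ℝ u x‖ := by
  set L : ℂ ≃ₗᵢ[ℝ] EuclideanSpace ℝ (Fin 2) := Complex.orthonormalBasisOneI.repr
  have hle := hausdorffMeasure_restrict_sphere_le L
  have hd : DifferentiableOn ℝ u (ball 0 1) := hsm.differentiableOn (by simp)
  have hLb : L ⁻¹' ball 0 1 = ball 0 1 := by ext z; simp
  have hmain := lintegral_circle_abs_sub_le (U := u ∘ L)
    (hc.comp L.continuous.continuousOn fun z hz => by simpa using hz)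
    (hd.comp L.differentiable.differentiableOn fun z hz => by simpa using hz)
  have hm : Measurable fun x => ENNReal.ofReal ‖fderiv ℝ u x‖ :=
    (measurable_fderiv ℝ u).norm.ennreal_ofReal
  rw [← L.measurePreserving.setLIntegral_comp_preimage measurableSet_ball hm, hLb]
  have hgrad : ∫⁻ z in ball (0 : ℂ) 1, ENNReal.ofReal ‖fderiv ℝ (u ∘ L) z‖
      = ∫⁻ z in ball (0 : ℂ) 1, ENNReal.ofReal ‖fderiv ℝ u (L z)‖ := by
    refine setLIntegral_congr_fun measurableSet_ball fun z hz => ?_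
    have hz' : L z ∈ ball (0 : EuclideanSpace ℝ (Fin 2)) 1 := by simpa using hz
    have := ((hd.differentiableAt (isOpen_ball.mem_nhds hz')).hasFDerivAt.comp z
      L.toContinuousLinearEquiv.hasFDerivAt).fderiv
    change ENNReal.ofReal ‖fderiv ℝ (u ∘ L) z‖ = ENNReal.ofReal ‖fderiv ℝ u (L z)‖
    rw [show fderiv ℝ (u ∘ L) z = _ from this]
    congr 1
    exact ContinuousLinearMap.opNorm_comp_linearIsometryEquiv _ L
  rw [← hgrad]
  refine le_trans ?_ hmain
  refine (lintegral_mono' hle fun x => lintegral_mono' hle le_rfl).trans ?_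
  refine (lintegral_map_le _ _).trans (lintegral_mono fun x => ?_)
  exact lintegral_map_le _ _
end
end

section
/- (Sufficiency part of the criterion for q > p > 1.) Let Ω ⊆ ℝⁿ be open and let q > p > 1. There exists a constant c depending only on p and q with the following property: if μ is a nonnegative measure on Ω×Ω, locally finite outside the diagonal, and B ≥ 0 is such that μ(F₁ × F₂)^{p/q} ≤ B · cap_p(F₁,F₂;Ω) for every pair (F₁,F₂) of disjoint subsets of Ω that are closed in Ω, then for every u ∈ C^∞(Ω), ( ∫_Ω ∫_Ω |u(x) − u(y)|^q μ(dx,dy) )^{1/q} ≤ c · B^{1/p} · ( ∫_Ω |∇u|^p dx )^{1/p}. -/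
open MeasureTheory Metric Set Filter
open scoped ENNReal Topology MeasureTheory

noncomputable section

/-- The condenser `p`-capacity
`cap_p(F₁,F₂;Ω) = inf { ∫_Ω |∇u|^p : u ∈ C^∞(Ω), u ≥ 1 on F₁, u ≤ 0 on F₂ }`. -/
def condCap {n : ℕ} (p : ℝ) (F₁ F₂ Ω : Set (EuclideanSpace ℝ (Fin n))) : ℝ≥0∞ :=
  sInf {r : ℝ≥0∞ | ∃ u : EuclideanSpace ℝ (Fin n) → ℝ, ContDiffOn ℝ (⊤ : ℕ∞) u Ω ∧
    (∀ x ∈ F₁, 1 ≤ u x) ∧ (∀ x ∈ F₂, u x ≤ 0) ∧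
    r = ∫⁻ x in Ω, ENNReal.ofReal (‖fderiv ℝ u x‖ ^ p)}

lemma ENNReal.rpow_add_rpow_add_min_rpow_le {r : ℝ} (hr : 1 < r) (x y : ℝ≥0∞) :
    x ^ r + y ^ r + ENNReal.ofReal (2 ^ (r - 1) - 1) * min x y ^ r ≤ (x + y) ^ r := by
  wlog hxy : y ≤ x generalizing x y
  · have := this y x (le_of_not_ge hxy)
    rwa [min_comm, add_comm (y ^ r), add_comm y] at this
  have h2 : (1 : ℝ) ≤ 2 ^ (r - 1) := Real.one_le_rpow (by norm_num) (by linarith)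
  have hsplit : ∀ z : ℝ≥0∞, z ^ r = z * z ^ (r - 1) := fun z => by
    conv_lhs => rw [show r = 1 + (r - 1) by ring]
    rw [ENNReal.rpow_add_of_nonneg _ _ zero_le_one (by linarith), ENNReal.rpow_one]
  have hc : (1 : ℝ≥0∞) + ENNReal.ofReal (2 ^ (r - 1) - 1) = 2 ^ (r - 1) := by
    rw [← ENNReal.ofReal_one, ← ENNReal.ofReal_add zero_le_one (by linarith),
      add_sub_cancel, ← ENNReal.ofReal_rpow_of_pos two_pos]
    norm_num
  rw [min_eq_right hxy, add_assoc]
  calc x ^ r + (y ^ r + ENNReal.ofReal (2 ^ (r - 1) - 1) * y ^ r)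
      = x ^ r + 2 ^ (r - 1) * y ^ r := by rw [← hc]; ring
    _ = x * x ^ (r - 1) + y * (2 * y) ^ (r - 1) := by
        rw [ENNReal.mul_rpow_of_nonneg _ _ (by linarith), hsplit x, hsplit y]; ring
    _ ≤ x * (x + y) ^ (r - 1) + y * (x + y) ^ (r - 1) := by
        have hr' : 0 ≤ r - 1 := by linarith
        gcongr
        · exact le_self_add
        · rw [two_mul]; gcongr
    _ = (x + y) ^ r := by rw [hsplit (x + y)]; ring

lemma ENNReal.tsum_int_le_tsum_even_add_odd (f : ℤ → ℝ≥0∞) :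
    ∑' i, f i ≤ ∑' j, (f (2 * j) + f (2 * j + 1)) := by
  rw [← (Int.divModEquiv 2).symm.tsum_eq,
    ENNReal.tsum_prod (f := fun a b => f ((Int.divModEquiv 2).symm (a, b)))]
  refine ENNReal.tsum_le_tsum fun j => ?_
  rw [tsum_fintype, Fin.sum_univ_two]
  simp [Int.divModEquiv, mul_comm]

/-- For a refining family of partitions into dyadic pieces of masses `A k j`, and an exponent
`r > 1`, the `r`-th powers of the smaller halves are summable over all scales. -/
lemma tsum_min_rpow_le {r : ℝ} (hr : 1 < r) (A : ℤ → ℤ → ℝ≥0∞) (E : ℝ≥0∞)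
    (hA : ∀ k j, A k (2 * j) + A k (2 * j + 1) = A (k + 1) j) (hE : ∀ k, ∑' j, A k j ≤ E) :
    ENNReal.ofReal (2 ^ (r - 1) - 1) * ∑' k, ∑' j, min (A k (2 * j)) (A k (2 * j + 1)) ^ r
      ≤ E ^ r := by
  set c := ENNReal.ofReal (2 ^ (r - 1) - 1)
  set D : ℤ → ℝ≥0∞ := fun k => ∑' j, min (A k (2 * j)) (A k (2 * j + 1)) ^ r
  have hstep : ∀ k, ∑' j, A k j ^ r + c * D k ≤ ∑' j, A (k + 1) j ^ r := fun k => by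
    calc ∑' j, A k j ^ r + c * D k
        ≤ ∑' j, (A k (2 * j) ^ r + A k (2 * j + 1) ^ r) + c * D k := by
          exact add_le_add (ENNReal.tsum_int_le_tsum_even_add_odd fun j => A k j ^ r) le_rfl
      _ = ∑' j, (A k (2 * j) ^ r + A k (2 * j + 1) ^ r
            + c * min (A k (2 * j)) (A k (2 * j + 1)) ^ r) := by
          rw [← ENNReal.tsum_mul_left, ← ENNReal.tsum_add]
      _ ≤ _ := ENNReal.tsum_le_tsum fun j => by
          rw [← hA]; exact ENNReal.rpow_add_rpow_add_min_rpow_le hr _ _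
  have hiter : ∀ (k : ℤ) (m : ℕ), ∑' j, A k j ^ r + c * ∑ i ∈ Finset.range m, D (k + i)
      ≤ ∑' j, A (k + m) j ^ r := fun k m => by
    induction m with
    | zero => simp
    | succ m ih =>
      rw [Finset.sum_range_succ, mul_add, ← add_assoc]
      push_cast
      rw [← add_assoc k]
      exact (add_le_add_left ih _).trans (hstep _)
  have hpow : ∀ k, ∑' j, A k j ^ r ≤ E ^ r := fun k => by
    have hsplit : ∀ z : ℝ≥0∞, z ^ r = z * z ^ (r - 1) := fun z => by
      conv_lhs => rw [show r = 1 + (r - 1) by ring]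
      rw [ENNReal.rpow_add_of_nonneg _ _ zero_le_one (by linarith), ENNReal.rpow_one]
    have hr' : 0 ≤ r - 1 := by linarith
    calc ∑' j, A k j ^ r ≤ ∑' j, A k j * E ^ (r - 1) := ENNReal.tsum_le_tsum fun j => by
          rw [hsplit]
          gcongr
          exact (ENNReal.le_tsum j).trans (hE k)
      _ ≤ E ^ r := by
          rw [ENNReal.tsum_mul_right, hsplit E]
          gcongr
          exact hE k
  rw [ENNReal.tsum_eq_iSup_sum, ENNReal.mul_iSup]
  refine iSup_le fun s => ?_
  obtain ⟨k, hk⟩ := s.bddBelow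
  obtain ⟨K, hK⟩ := s.bddAbove
  have hs : s ⊆ (Finset.range (K - k + 1).toNat).image fun i : ℕ => k + (i : ℤ) := fun i hi => by
    have h1 := hk (Finset.mem_coe.2 hi)
    have h2 := hK (Finset.mem_coe.2 hi)
    simp only [Finset.mem_image, Finset.mem_range]
    exact ⟨(i - k).toNat, by omega, by omega⟩
  calc c * ∑ i ∈ s, D i
      ≤ c * ∑ i ∈ Finset.range (K - k + 1).toNat, D (k + i) := by
        gcongr
        refine (Finset.sum_le_sum_of_subset hs).trans_eq ?_
        exact Finset.sum_image fun a _ b _ h => by simpa using h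
    _ ≤ _ := le_add_self.trans ((hiter k _).trans (hpow _))

lemma Real.smoothTransition.exists_norm_deriv_le :
    ∃ L : ℝ, 0 < L ∧ ∀ t, ‖deriv Real.smoothTransition t‖ ≤ L := by
  have hc : Continuous (deriv Real.smoothTransition) :=
    (Real.smoothTransition.contDiff (n := 1)).continuous_deriv le_rfl
  have hs : HasCompactSupport (deriv Real.smoothTransition) := by
    refine HasCompactSupport.intro (isCompact_Icc (a := (0 : ℝ)) (b := 1)) fun t ht => ?_
    rw [Set.mem_Icc, not_and_or, not_le, not_le] at ht
    rcases ht with ht | ht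
    · have : Real.smoothTransition =ᶠ[𝓝 t] fun _ => 0 := by
        filter_upwards [Iio_mem_nhds ht] with s hs using Real.smoothTransition.zero_of_nonpos hs.le
      rw [this.deriv_eq, deriv_const]
    · have : Real.smoothTransition =ᶠ[𝓝 t] fun _ => 1 := by
        filter_upwards [Ioi_mem_nhds ht] with s hs using Real.smoothTransition.one_of_one_le hs.le
      rw [this.deriv_eq, deriv_const]
  obtain ⟨C, hC⟩ := hc.bounded_above_of_compact_support hs
  exact ⟨max C 1, by positivity, fun t => (hC t).trans (le_max_left _ _)⟩

lemma Real.smoothTransition.deriv_eq_zero {t : ℝ} (ht : t ∉ Set.Ico (0 : ℝ) 1) :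
    deriv Real.smoothTransition t = 0 := by
  rw [Set.mem_Ico, not_and_or, not_le, not_lt] at ht
  rcases ht with ht | ht
  · refine IsLocalMin.deriv_eq_zero (Eventually.of_forall fun s => ?_)
    rw [Real.smoothTransition.zero_of_nonpos ht.le]
    exact Real.smoothTransition.nonneg s
  · refine IsLocalMax.deriv_eq_zero (Eventually.of_forall fun s => ?_)
    rw [Real.smoothTransition.one_of_one_le ht]
    exact Real.smoothTransition.le_one s

section Energy

variable {n : ℕ} {Ω : Set (EuclideanSpace ℝ (Fin n))} {u : EuclideanSpace ℝ (Fin n) → ℝ}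

/-- The distribution under `u` of the energy density `|∇u|^p` on `Ω`. -/
def levelEnergy (p : ℝ) (Ω : Set (EuclideanSpace ℝ (Fin n))) (u : EuclideanSpace ℝ (Fin n) → ℝ) :
    Measure ℝ :=
  ((volume.restrict Ω).withDensity fun x => ENNReal.ofReal (‖fderiv ℝ u x‖ ^ p)).map u

lemma levelEnergy_apply {p : ℝ} (hΩ : IsOpen Ω) (hu : ContinuousOn u Ω) {S : Set ℝ}
    (hS : MeasurableSet S) :
    levelEnergy p Ω u S
      = ∫⁻ x in u ⁻¹' S, ENNReal.ofReal (‖fderiv ℝ u x‖ ^ p) ∂volume.restrict Ω := by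
  rw [levelEnergy, Measure.map_apply_of_aemeasurable _ hS, withDensity_apply']
  exact (hu.aemeasurable hΩ.measurableSet).mono_ac (withDensity_absolutelyContinuous _ _)

lemma condCap_le_levelEnergy {p L a b : ℝ} (hp : 0 < p) (hL : 0 ≤ L)
    (hLd : ∀ t, ‖deriv Real.smoothTransition t‖ ≤ L) (hab : a < b) (hΩ : IsOpen Ω)
    (hu : ContDiffOn ℝ (⊤ : ℕ∞) u Ω) {F₁ F₂ : Set (EuclideanSpace ℝ (Fin n))}
    (h₁ : ∀ x ∈ F₁, b ≤ u x) (h₂ : ∀ x ∈ F₂, u x ≤ a) :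
    condCap p F₁ F₂ Ω ≤ ENNReal.ofReal ((L / (b - a)) ^ p) * levelEnergy p Ω u (Ico a b) := by
  have hba : 0 < b - a := sub_pos.2 hab
  have hcap : condCap p F₁ F₂ Ω ≤ ∫⁻ x in Ω, ENNReal.ofReal
      (‖fderiv ℝ (fun x => Real.smoothTransition ((u x - a) / (b - a))) x‖ ^ p) := by
    refine sInf_le ⟨fun x => Real.smoothTransition ((u x - a) / (b - a)), ?_, ?_, ?_, rfl⟩
    · exact (Real.smoothTransition.contDiff (n := ⊤)).comp_contDiffOn
        ((hu.sub contDiffOn_const).div_const _)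
    · intro x hx
      refine (Real.smoothTransition.one_of_one_le ?_).ge
      rw [one_le_div hba]
      linarith [h₁ x hx]
    · intro x hx
      refine (Real.smoothTransition.zero_of_nonpos ?_).le
      exact div_nonpos_of_nonpos_of_nonneg (by linarith [h₂ x hx]) hba.le
  refine hcap.trans ?_
  rw [levelEnergy_apply hΩ hu.continuousOn measurableSet_Ico,
    ← lintegral_const_mul' _ _ ENNReal.ofReal_ne_top]
  refine le_trans ?_ (lintegral_indicator_le _ _)
  refine lintegral_mono_ae ((ae_restrict_iff' hΩ.measurableSet).2 (Eventually.of_forall ?_))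
  intro x hx
  have hux : HasFDerivAt u (fderiv ℝ u x) x :=
    ((hu.contDiffAt (hΩ.mem_nhds hx)).differentiableAt (by simp)).hasFDerivAt
  have hst : HasDerivAt Real.smoothTransition
      (deriv Real.smoothTransition ((u x - a) / (b - a))) ((u x - a) / (b - a)) :=
    ((Real.smoothTransition.contDiff (n := 1)).differentiable (by simp) _).hasDerivAt
  have hv : HasFDerivAt (fun x => (u x - a) / (b - a)) ((b - a)⁻¹ • fderiv ℝ u x) x := by
    exact ((hux.sub_const a).const_smul (b - a)⁻¹).congr_of_eventuallyEq
      (Eventually.of_forall fun y => div_eq_inv_mul _ _)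
  have hd : fderiv ℝ (fun x => Real.smoothTransition ((u x - a) / (b - a))) x
      = deriv Real.smoothTransition ((u x - a) / (b - a)) • (b - a)⁻¹ • fderiv ℝ u x :=
    (HasDerivAt.comp_hasFDerivAt (f := fun x => (u x - a) / (b - a)) x hst hv).fderiv
  rw [hd]
  by_cases hx' : u x ∈ Ico a b
  · rw [indicator_of_mem (by exact hx'), ← ENNReal.ofReal_mul (by positivity),
      ← Real.mul_rpow (by positivity) (by positivity)]
    gcongr
    rw [norm_smul, norm_smul, norm_inv, Real.norm_of_nonneg hba.le, ← mul_assoc, div_eq_mul_inv L]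
    gcongr
    exact hLd _
  · rw [indicator_of_notMem (by exact hx'), Real.smoothTransition.deriv_eq_zero]
    · simp [Real.zero_rpow hp.ne']
    · contrapose! hx'
      rw [mem_Ico, le_div_iff₀ hba, div_lt_iff₀ hba] at hx'
      exact ⟨by linarith [hx'.1], by linarith [hx'.2]⟩

end Energy

section Majorant

variable {n : ℕ} {Ω : Set (EuclideanSpace ℝ (Fin n))} {u : EuclideanSpace ℝ (Fin n) → ℝ}

/-- The pairs `(x, y)` whose values `u y ≤ u x` enclose the dyadic interval
`[j 2^k, (j + 1) 2^k]`. -/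
def dyadicPairs (Ω : Set (EuclideanSpace ℝ (Fin n))) (u : EuclideanSpace ℝ (Fin n) → ℝ)
    (k j : ℤ) : Set (EuclideanSpace ℝ (Fin n) × EuclideanSpace ℝ (Fin n)) :=
  (Ω ∩ u ⁻¹' Ici ((j + 1) * 2 ^ k)) ×ˢ (Ω ∩ u ⁻¹' Iic (j * 2 ^ k))

/-- A countable sum of weighted indicators dominating the `q`-th power of `(u x - u y)⁺`. -/
def dyadicMajorant (q : ℝ) (Ω : Set (EuclideanSpace ℝ (Fin n)))
    (u : EuclideanSpace ℝ (Fin n) → ℝ)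
    (z : EuclideanSpace ℝ (Fin n) × EuclideanSpace ℝ (Fin n)) : ℝ≥0∞ :=
  ∑' k : ℤ, ∑' j : ℤ,
    (dyadicPairs Ω u k j).indicator (fun _ => ENNReal.ofReal ((4 * 2 ^ k) ^ q)) z

lemma inter_closure_inter_preimage_subset (hu : ContinuousOn u Ω) {S : Set ℝ} (hS : IsClosed S) :
    Ω ∩ closure (Ω ∩ u ⁻¹' S) ⊆ Ω ∩ u ⁻¹' S := by
  rintro x ⟨hx, hxc⟩
  refine ⟨hx, ?_⟩
  have := ((hu x hx).mono inter_subset_left).mem_closure hxc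
    (show MapsTo u (Ω ∩ u ⁻¹' S) S from fun y hy => hy.2)
  rwa [hS.closure_eq] at this

lemma measurableSet_dyadicPairs (hΩ : IsOpen Ω) (hu : ContinuousOn u Ω) (k j : ℤ) :
    MeasurableSet (dyadicPairs Ω u k j) := by
  have key : ∀ S : Set ℝ, IsClosed S → MeasurableSet (Ω ∩ u ⁻¹' S) := fun S hS => by
    rw [← (inter_closure_inter_preimage_subset hu hS).antisymm
      fun x hx => ⟨hx.1, subset_closure hx⟩]
    exact hΩ.measurableSet.inter isClosed_closure.measurableSet
  exact (key _ isClosed_Ici).prod (key _ isClosed_Iic)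

lemma measurable_dyadicMajorant (q : ℝ) (hΩ : IsOpen Ω) (hu : ContinuousOn u Ω) :
    Measurable (dyadicMajorant q Ω u) :=
  .tsum fun k => .tsum fun j =>
    measurable_const.indicator (measurableSet_dyadicPairs hΩ hu k j)

lemma rpow_le_dyadicMajorant {q : ℝ} (hq : 0 < q)
    {z : EuclideanSpace ℝ (Fin n) × EuclideanSpace ℝ (Fin n)} (hz : z ∈ Ω ×ˢ Ω)
    (hlt : u z.2 < u z.1) :
    ENNReal.ofReal (|u z.1 - u z.2| ^ q) ≤ dyadicMajorant q Ω u z := by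
  have hd : 0 < u z.1 - u z.2 := sub_pos.2 hlt
  obtain ⟨k, hk₁, hk₂⟩ := exists_mem_Ico_zpow (half_pos hd) (one_lt_two (α := ℝ))
  have hk : (0 : ℝ) < 2 ^ k := by positivity
  rw [zpow_add_one₀ two_ne_zero] at hk₂
  set j := ⌈u z.2 / 2 ^ k⌉
  have hj₁ : u z.2 ≤ j * 2 ^ k := (div_le_iff₀ hk).1 (Int.le_ceil _)
  have hj₂ : ((j : ℝ) - 1) * 2 ^ k < u z.2 :=
    (lt_div_iff₀ hk).1 (by linarith [Int.ceil_lt_add_one (u z.2 / 2 ^ k)])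
  have hmem : z ∈ dyadicPairs Ω u k j := by
    refine ⟨⟨hz.1, ?_⟩, hz.2, hj₁⟩
    change ((j : ℝ) + 1) * 2 ^ k ≤ u z.1
    linarith
  refine le_trans ?_ ((ENNReal.le_tsum j).trans (ENNReal.le_tsum k))
  rw [indicator_of_mem hmem, abs_of_pos hd]
  gcongr
  linarith

lemma rpow_le_dyadicMajorant_add_neg {q : ℝ} (hq : 0 < q)
    {z : EuclideanSpace ℝ (Fin n) × EuclideanSpace ℝ (Fin n)} (hz : z ∈ Ω ×ˢ Ω) :
    ENNReal.ofReal (|u z.1 - u z.2| ^ q)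
      ≤ dyadicMajorant q Ω u z + dyadicMajorant q Ω (-u) z := by
  rcases lt_trichotomy (u z.1) (u z.2) with h | h | h
  · have hneg := rpow_le_dyadicMajorant (u := -u) hq hz (by simpa using h)
    rw [Pi.neg_apply, Pi.neg_apply, neg_sub_neg, abs_sub_comm] at hneg
    exact hneg.trans le_add_self
  · simp [h, Real.zero_rpow hq.ne']
  · exact (rpow_le_dyadicMajorant hq hz h).trans le_self_add

lemma measure_dyadicPairs_le {p q L B : ℝ} (hp : 1 < p) (hpq : p < q) (hL : 0 < L)
    (hLd : ∀ t, ‖deriv Real.smoothTransition t‖ ≤ L) (hΩ : IsOpen Ω)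
    {μ : Measure (EuclideanSpace ℝ (Fin n) × EuclideanSpace ℝ (Fin n))}
    (hμ : ∀ F₁ F₂ : Set (EuclideanSpace ℝ (Fin n)),
      F₁ ⊆ Ω → Ω ∩ closure F₁ ⊆ F₁ → F₂ ⊆ Ω → Ω ∩ closure F₂ ⊆ F₂ → Disjoint F₁ F₂ →
      μ (F₁ ×ˢ F₂) ^ (p / q) ≤ ENNReal.ofReal B * condCap p F₁ F₂ Ω)
    (hu : ContDiffOn ℝ (⊤ : ℕ∞) u Ω) (k j : ℤ) {a : ℝ} (ha : j * 2 ^ (k + 1) ≤ a)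
    (hb : a + 2 ^ k ≤ (j + 1) * 2 ^ (k + 1)) :
    ENNReal.ofReal ((4 * 2 ^ (k + 1)) ^ q) * μ (dyadicPairs Ω u (k + 1) j)
      ≤ ENNReal.ofReal ((8 * L) ^ q) * ENNReal.ofReal B ^ (q / p)
        * levelEnergy p Ω u (Ico a (a + 2 ^ k)) ^ (q / p) := by
  have hk : (0 : ℝ) < 2 ^ k := by positivity
  have hp0 : 0 < p := by linarith
  have hq0 : 0 < q := by linarith
  have h1 := hμ (Ω ∩ u ⁻¹' Ici (((j : ℝ) + 1) * 2 ^ (k + 1)))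
    (Ω ∩ u ⁻¹' Iic ((j : ℝ) * 2 ^ (k + 1)))
    inter_subset_left (inter_closure_inter_preimage_subset hu.continuousOn isClosed_Ici)
    inter_subset_left (inter_closure_inter_preimage_subset hu.continuousOn isClosed_Iic)
    (disjoint_left.2 fun x hx hx' => by
      have h1 : ((j : ℝ) + 1) * 2 ^ (k + 1) ≤ u x := hx.2
      have h2 : u x ≤ (j : ℝ) * 2 ^ (k + 1) := hx'.2
      linarith)
  have h2 := condCap_le_levelEnergy hp0 hL.le hLd (lt_add_of_pos_right a hk) hΩ hu
    (F₁ := Ω ∩ u ⁻¹' Ici (((j : ℝ) + 1) * 2 ^ (k + 1)))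
    (F₂ := Ω ∩ u ⁻¹' Iic ((j : ℝ) * 2 ^ (k + 1)))
    (fun x hx => hb.trans hx.2) (fun x hx => le_trans hx.2 ha)
  have h3 : μ (dyadicPairs Ω u (k + 1) j) ≤ (ENNReal.ofReal B *
      (ENNReal.ofReal ((L / 2 ^ k) ^ p) * levelEnergy p Ω u (Ico a (a + 2 ^ k)))) ^ (q / p) := by
    rw [← inv_div p q, ENNReal.le_rpow_inv_iff (by positivity)]
    refine h1.trans ?_
    rw [add_sub_cancel_left] at h2
    gcongr
  have hr : 0 ≤ q / p := by positivity
  have h4 : ENNReal.ofReal ((L / 2 ^ k) ^ p) ^ (q / p) = ENNReal.ofReal ((L / 2 ^ k) ^ q) := by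
    rw [ENNReal.ofReal_rpow_of_nonneg (by positivity) hr, ← Real.rpow_mul (by positivity),
      mul_div_cancel₀ _ hp0.ne']
  have h5 : ENNReal.ofReal ((4 * 2 ^ (k + 1)) ^ q) * ENNReal.ofReal ((L / 2 ^ k) ^ q)
      = ENNReal.ofReal ((8 * L) ^ q) := by
    rw [← ENNReal.ofReal_mul (by positivity), ← Real.mul_rpow (by positivity) (by positivity),
      zpow_add_one₀ two_ne_zero]
    congr 2
    field_simp
    norm_num
  rw [ENNReal.mul_rpow_of_nonneg _ _ hr, ENNReal.mul_rpow_of_nonneg _ _ hr, h4] at h3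
  calc _ ≤ _ := mul_le_mul_right h3 _
    _ = _ := by rw [← h5]; ring

lemma lintegral_dyadicMajorant_le {p q L B : ℝ} (hp : 1 < p) (hpq : p < q) (hL : 0 < L)
    (hLd : ∀ t, ‖deriv Real.smoothTransition t‖ ≤ L) (hΩ : IsOpen Ω)
    {μ : Measure (EuclideanSpace ℝ (Fin n) × EuclideanSpace ℝ (Fin n))}
    (hμ : ∀ F₁ F₂ : Set (EuclideanSpace ℝ (Fin n)),
      F₁ ⊆ Ω → Ω ∩ closure F₁ ⊆ F₁ → F₂ ⊆ Ω → Ω ∩ closure F₂ ⊆ F₂ → Disjoint F₁ F₂ →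
      μ (F₁ ×ˢ F₂) ^ (p / q) ≤ ENNReal.ofReal B * condCap p F₁ F₂ Ω)
    (hu : ContDiffOn ℝ (⊤ : ℕ∞) u Ω) :
    ∫⁻ z, dyadicMajorant q Ω u z ∂μ ≤ ENNReal.ofReal ((8 * L) ^ q / (2 ^ (q / p - 1) - 1))
      * ENNReal.ofReal B ^ (q / p)
      * (∫⁻ x in Ω, ENNReal.ofReal (‖fderiv ℝ u x‖ ^ p)) ^ (q / p) := by
  set E := ∫⁻ x in Ω, ENNReal.ofReal (‖fderiv ℝ u x‖ ^ p)
  have hp0 : 0 < p := by linarith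
  have hr : 1 < q / p := (one_lt_div hp0).2 hpq
  have hc : (0 : ℝ) < 2 ^ (q / p - 1) - 1 :=
    sub_pos.2 (Real.one_lt_rpow one_lt_two (by linarith))
  set ν := levelEnergy p Ω u
  set A : ℤ → ℤ → ℝ≥0∞ := fun k j => ν (Ico (j * 2 ^ k) (j * 2 ^ k + 2 ^ k))
  have hν : ν univ = E := by
    simp only [ν, levelEnergy_apply hΩ hu.continuousOn MeasurableSet.univ, preimage_univ,
      Measure.restrict_univ, E]
  have hmin := tsum_min_rpow_le hr A E
    (fun k j => by
      have hk : (0 : ℝ) < 2 ^ k := by positivity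
      simp only [A]
      rw [← measure_union _ measurableSet_Ico, zpow_add_one₀ two_ne_zero]
      · push_cast
        rw [show ((2 : ℝ) * j + 1) * 2 ^ k = 2 * j * 2 ^ k + 2 ^ k by ring,
          Ico_union_Ico_eq_Ico (by linarith) (by linarith)]
        congr 2 <;> ring
      · push_cast
        rw [show ((2 : ℝ) * j + 1) * 2 ^ k = 2 * j * 2 ^ k + 2 ^ k by ring]
        exact Ico_disjoint_Ico_same)
    (fun k => by
      rw [← hν]
      refine tsum_measure_le_measure_univ (fun _ => measurableSet_Ico.nullMeasurableSet)
        fun i j hij => (disjoint_left.2 fun t ht ht' => hij ?_).aedisjoint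
      have hk : (0 : ℝ) < 2 ^ k := by positivity
      have hfl : ∀ m : ℤ, t ∈ Ico (m * (2 : ℝ) ^ k) (m * 2 ^ k + 2 ^ k) → ⌊t / 2 ^ k⌋ = m :=
        fun m hm => by
          rw [Int.floor_eq_iff, le_div_iff₀ hk, div_lt_iff₀ hk]
          exact ⟨hm.1, by linarith [hm.2]⟩
      rw [← hfl i ht, hfl j ht'])
  have hbound : ∀ k j : ℤ,
      ENNReal.ofReal ((4 * 2 ^ (k + 1)) ^ q) * μ (dyadicPairs Ω u (k + 1) j)
        ≤ ENNReal.ofReal ((8 * L) ^ q) * ENNReal.ofReal B ^ (q / p)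
          * min (A k (2 * j)) (A k (2 * j + 1)) ^ (q / p) := fun k j => by
    have hk : (0 : ℝ) < 2 ^ k := by positivity
    rcases min_choice (A k (2 * j)) (A k (2 * j + 1)) with h | h <;> rw [h] <;>
    · refine measure_dyadicPairs_le hp hpq hL hLd hΩ hμ hu k j ?_ ?_ <;>
      · rw [zpow_add_one₀ two_ne_zero]
        push_cast
        linarith
  have hle : ∑' k, ∑' j, min (A k (2 * j)) (A k (2 * j + 1)) ^ (q / p)
      ≤ (ENNReal.ofReal (2 ^ (q / p - 1) - 1))⁻¹ * E ^ (q / p) := by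
    rw [← ENNReal.mul_le_iff_le_inv (ENNReal.ofReal_pos.2 hc).ne' ENNReal.ofReal_ne_top]
    exact hmin
  have hm := measurableSet_dyadicPairs (u := u) hΩ hu.continuousOn
  calc ∫⁻ z, dyadicMajorant q Ω u z ∂μ
      = ∑' k : ℤ, ∑' j : ℤ, ENNReal.ofReal ((4 * 2 ^ k) ^ q) * μ (dyadicPairs Ω u k j) := by
        simp only [dyadicMajorant]
        rw [lintegral_tsum fun k => (Measurable.tsum fun j =>
          measurable_const.indicator (hm k j)).aemeasurable]
        refine tsum_congr fun k => ?_
        rw [lintegral_tsum fun j => (measurable_const.indicator (hm k j)).aemeasurable]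
        exact tsum_congr fun j => lintegral_indicator_const (hm k j) _
    _ = ∑' k : ℤ, ∑' j : ℤ,
          ENNReal.ofReal ((4 * 2 ^ (k + 1)) ^ q) * μ (dyadicPairs Ω u (k + 1) j) :=
        ((Equiv.addRight (1 : ℤ)).tsum_eq fun k : ℤ => ∑' j : ℤ,
          ENNReal.ofReal ((4 * 2 ^ k) ^ q) * μ (dyadicPairs Ω u k j)).symm
    _ ≤ ∑' k : ℤ, ∑' j : ℤ, ENNReal.ofReal ((8 * L) ^ q) * ENNReal.ofReal B ^ (q / p)
          * min (A k (2 * j)) (A k (2 * j + 1)) ^ (q / p) :=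
        ENNReal.tsum_le_tsum fun k => ENNReal.tsum_le_tsum fun j => hbound k j
    _ ≤ ENNReal.ofReal ((8 * L) ^ q) * ENNReal.ofReal B ^ (q / p)
          * ((ENNReal.ofReal (2 ^ (q / p - 1) - 1))⁻¹ * E ^ (q / p)) := by
        simp only [ENNReal.tsum_mul_left]
        gcongr
    _ = _ := by
        rw [div_eq_mul_inv ((8 * L) ^ q), ENNReal.ofReal_mul (by positivity), ENNReal.ofReal_inv_of_pos hc]
        ring

end Majorant

/-- sufficiency, `q > p > 1`: there is `c = c(p,q)` such that the
isocapacitary condition `μ(F₁×F₂)^{p/q} ≤ B·cap_p(F₁,F₂;Ω)` implies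
`(∬_{Ω×Ω} |u(x)−u(y)|^q dμ)^{1/q} ≤ c·B^{1/p}·‖∇u‖_{L^p(Ω)}`. -/
theorem stmt_13 (p q : ℝ) (hp : 1 < p) (hpq : p < q) :
    ∃ c : ℝ, 0 < c ∧
      ∀ (n : ℕ) (Ω : Set (EuclideanSpace ℝ (Fin n))), IsOpen Ω →
      ∀ μ : Measure (EuclideanSpace ℝ (Fin n) × EuclideanSpace ℝ (Fin n)),
        -- `μ` is locally finite outside the diagonal
        (∀ K : Set (EuclideanSpace ℝ (Fin n) × EuclideanSpace ℝ (Fin n)),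
          IsCompact K → (∀ z ∈ K, z.1 ≠ z.2) → μ K < ⊤) →
      ∀ B : ℝ, 0 ≤ B →
        (∀ F₁ F₂ : Set (EuclideanSpace ℝ (Fin n)),
          F₁ ⊆ Ω → Ω ∩ closure F₁ ⊆ F₁ → F₂ ⊆ Ω → Ω ∩ closure F₂ ⊆ F₂ →
          Disjoint F₁ F₂ →
          μ (F₁ ×ˢ F₂) ^ (p / q) ≤ ENNReal.ofReal B * condCap p F₁ F₂ Ω) →
      ∀ u : EuclideanSpace ℝ (Fin n) → ℝ, ContDiffOn ℝ (⊤ : ℕ∞) u Ω →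
        (∫⁻ z in Ω ×ˢ Ω, ENNReal.ofReal (|u z.1 - u z.2| ^ q) ∂μ) ^ (1 / q) ≤
          ENNReal.ofReal (c * B ^ (1 / p)) *
            (∫⁻ x in Ω, ENNReal.ofReal (‖fderiv ℝ u x‖ ^ p)) ^ (1 / p) := by
  obtain ⟨L, hL, hLd⟩ := Real.smoothTransition.exists_norm_deriv_le
  have hp0 : 0 < p := by linarith
  have hq0 : 0 < q := by linarith
  have hc : (0 : ℝ) < 2 ^ (q / p - 1) - 1 :=
    sub_pos.2 (Real.one_lt_rpow one_lt_two (by linarith [(one_lt_div hp0).2 hpq]))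
  set C := (8 * L) ^ q / (2 ^ (q / p - 1) - 1)
  have hC : 0 < C := by positivity
  refine ⟨(2 * C) ^ (1 / q), by positivity, ?_⟩
  intro n Ω hΩ μ _ B hB hμ u hu
  set E := ∫⁻ x in Ω, ENNReal.ofReal (‖fderiv ℝ u x‖ ^ p)
  have hpos := lintegral_dyadicMajorant_le hp hpq hL hLd hΩ hμ hu
  have hneg := lintegral_dyadicMajorant_le (u := -u) hp hpq hL hLd hΩ hμ hu.neg
  have hE : ∫⁻ x in Ω, ENNReal.ofReal (‖fderiv ℝ (-u) x‖ ^ p) = E := by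
    simp only [fderiv_neg, norm_neg, E]
  rw [hE] at hneg
  have hmain : ∫⁻ z in Ω ×ˢ Ω, ENNReal.ofReal (|u z.1 - u z.2| ^ q) ∂μ
      ≤ ENNReal.ofReal (2 * C) * ENNReal.ofReal B ^ (q / p) * E ^ (q / p) := by
    calc ∫⁻ z in Ω ×ˢ Ω, ENNReal.ofReal (|u z.1 - u z.2| ^ q) ∂μ
        ≤ ∫⁻ z in Ω ×ˢ Ω, (dyadicMajorant q Ω u z + dyadicMajorant q Ω (-u) z) ∂μ :=
          setLIntegral_mono' (hΩ.prod hΩ).measurableSet fun z hz =>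
            rpow_le_dyadicMajorant_add_neg hq0 hz
      _ ≤ ∫⁻ z, (dyadicMajorant q Ω u z + dyadicMajorant q Ω (-u) z) ∂μ :=
          setLIntegral_le_lintegral _ _
      _ = ∫⁻ z, dyadicMajorant q Ω u z ∂μ + ∫⁻ z, dyadicMajorant q Ω (-u) z ∂μ :=
          lintegral_add_left (measurable_dyadicMajorant q hΩ hu.continuousOn) _
      _ ≤ _ := add_le_add hpos hneg
      _ = _ := by
          rw [ENNReal.ofReal_mul zero_le_two, ENNReal.ofReal_ofNat]
          ring
  have hq1 : 0 ≤ 1 / q := by positivity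
  have hpq1 : q / p * (1 / q) = 1 / p := by field_simp
  calc _ ≤ (ENNReal.ofReal (2 * C) * ENNReal.ofReal B ^ (q / p) * E ^ (q / p)) ^ (1 / q) := by
        gcongr
    _ = _ := by
        rw [ENNReal.mul_rpow_of_nonneg _ _ hq1, ENNReal.mul_rpow_of_nonneg _ _ hq1,
          ← ENNReal.rpow_mul, ← ENNReal.rpow_mul, hpq1,
          ENNReal.ofReal_mul (p := (2 * C) ^ (1 / q)) (by positivity),
          ENNReal.ofReal_rpow_of_nonneg (by positivity) hq1,
          ENNReal.ofReal_rpow_of_nonneg hB (by positivity)]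
end
end

section
/- (One-dimensional criterion, case q > p > 1.) Let Ω = (α,β) with −∞ ≤ α < β ≤ ∞, let q > p > 1, and let μ be a nonnegative measure on Ω×Ω, locally finite outside the diagonal. Then there exists a finite constant C such that ( ∫_Ω ∫_Ω |u(x) − u(y)|^q μ(dx,dy) )^{1/q} ≤ C · ( ∫_Ω |u′(x)|^p dx )^{1/p} for every u ∈ C^∞(Ω), if and only if there exists a finite constant B such that r^{(p−1)/p} · μ(I × (Ω∖J))^{1/q} ≤ B for all pairs of intervals (I,J) with J ⊆ Ω of the following three types: I = [x−d, x+d] and J = (x−d−r, x+d+r); I = (α, x] and J = (α, x+r); I = [x, β) and J = (x−r, β); where d > 0 and r > 0. -/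
open MeasureTheory Metric Set Filter
open scoped ENNReal Topology MeasureTheory

noncomputable section

theorem ofReal_intervalIntegral_rpow_le {g : ℝ → ℝ} (hg : Measurable g) (hg0 : 0 ≤ g)
    {a b s : ℝ} (hab : a ≤ b) (hs : 1 < s) (hint : IntervalIntegrable g volume a b) :
    ENNReal.ofReal (∫ x in a..b, g x) ^ s ≤
      (∫⁻ x in Ioc a b, ENNReal.ofReal (g x) ^ s) * ENNReal.ofReal (b - a) ^ (s - 1) := by
  have hs0 : 0 < s := by linarith
  rw [intervalIntegral.integral_of_le hab,
    ofReal_integral_eq_lintegral_ofReal ((intervalIntegrable_iff_integrableOn_Ioc_of_le hab).1 hint)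
      (Eventually.of_forall hg0)]
  have hc := Real.HolderConjugate.conjExponent hs
  have h := ENNReal.lintegral_mul_le_Lp_mul_Lq (volume.restrict (Ioc a b)) hc
    (f := fun x => ENNReal.ofReal (g x)) (g := fun _ => 1)
    hg.ennreal_ofReal.aemeasurable aemeasurable_const
  simp only [Pi.mul_apply, mul_one, ENNReal.one_rpow, lintegral_const, one_mul,
    Measure.restrict_apply_univ, Real.volume_Ioc] at h
  calc _ ≤ _ := ENNReal.rpow_le_rpow h hs0.le
    _ = _ := by
      rw [ENNReal.mul_rpow_of_nonneg _ _ hs0.le, ← ENNReal.rpow_mul, ← ENNReal.rpow_mul,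
        one_div_mul_cancel hs0.ne', ENNReal.rpow_one, Real.conjExponent]
      congr 2
      field_simp

/-- If `μ` has the decay `μ({x ≤ a, b ≤ y}) ≤ K (b - a)^{-(s-1)}`, then `g ↦ ∫_x^y g` maps `L^s` to
weak `L^s(μ)`. -/
theorem meas_lt_intervalIntegral_le {Ω : Set ℝ} (hΩ : Ω.OrdConnected) {μ : Measure (ℝ × ℝ)}
    {K : ℝ≥0∞} {s : ℝ} (hs : 1 < s)
    (hμ : ∀ a ∈ Ω, ∀ b ∈ Ω, a < b →
      μ ((Ω ∩ Iic a) ×ˢ (Ω ∩ Ici b)) * ENNReal.ofReal (b - a) ^ (s - 1) ≤ K)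
    {g : ℝ → ℝ} (hg : Measurable g) (hg0 : 0 ≤ g)
    (hint : ∀ x ∈ Ω, ∀ y ∈ Ω, IntervalIntegrable g volume x y) {h : ℝ} (hh : 0 < h) :
    ENNReal.ofReal h ^ s * μ {z | z ∈ Ω ×ˢ Ω ∧ 2 * h < ∫ x in z.1..z.2, g x} ≤
      K * ∫⁻ x in Ω, ENNReal.ofReal (g x) ^ s := by
  rcases Ω.eq_empty_or_nonempty with rfl | ⟨x₀, hx₀⟩
  · simp
  set G : ℝ → ℝ := fun x => ∫ t in x₀..x, g t with hG
  have hGsub : ∀ x ∈ Ω, ∀ y ∈ Ω, ∫ t in x..y, g t = G y - G x := fun x hx y hy =>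
    (intervalIntegral.integral_interval_sub_left (hint _ hx₀ _ hy) (hint _ hx₀ _ hx)).symm
  have hGlt : ∀ x ∈ Ω, ∀ y ∈ Ω, G x < G y → x < y := by
    intro x hx y hy hxy
    by_contra! hyx
    have := intervalIntegral.integral_nonneg (f := g) (μ := volume) hyx (fun t _ => hg0 t)
    rw [hGsub y hy x hx] at this
    linarith
  have hGcont : ∀ x ∈ Ω, ∀ y ∈ Ω, x ≤ y → ContinuousOn G (Icc x y) := by
    intro x hx y hy hxy
    have h1 := intervalIntegral.continuousOn_primitive_interval' (hint x hx y hy) left_mem_uIcc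
    rw [uIcc_of_le hxy] at h1
    refine (h1.add (continuousOn_const (c := G x))).congr fun t ht => ?_
    simp only [hGsub x hx t (hΩ.out hx hy ht), sub_add_cancel, Pi.add_apply]
  let P : ℤ → Prop := fun j => ∃ x ∈ Ω, G x = j * h
  have hchoice : ∀ j : ℤ, ∃ x : ℝ, P j → x ∈ Ω ∧ G x = j * h := by
    intro j
    by_cases hj : P j
    · obtain ⟨x, hx⟩ := hj
      exact ⟨x, fun _ => hx⟩
    · exact ⟨0, fun h => absurd h hj⟩
  choose a ha using hchoice
  let S : Set ℤ := {j | P j ∧ P (j + 1)}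
  have hSc : S.Countable := S.to_countable
  have hlt : ∀ j ∈ S, a j < a (j + 1) := by
    rintro j ⟨h1, h2⟩
    refine hGlt _ (ha _ h1).1 _ (ha _ h2).1 ?_
    rw [(ha _ h1).2, (ha _ h2).2]
    push_cast
    linarith
  have hle : ∀ i ∈ S, ∀ j ∈ S, i < j → a (i + 1) ≤ a j := by
    intro i hi j hj hij
    rcases (show i + 1 ≤ j by omega).eq_or_lt with h1 | h1
    · rw [h1]
    · refine (hGlt _ (ha _ hi.2).1 _ (ha _ hj.1).1 ?_).le
      rw [(ha _ hi.2).2, (ha _ hj.1).2]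
      have : ((i + 1 : ℤ) : ℝ) < j := by exact_mod_cast h1
      gcongr
  have hdisj : S.PairwiseDisjoint fun j => Ioc (a j) (a (j + 1)) := by
    intro i hi j hj hij
    rw [Function.onFun, Set.disjoint_left]
    intro t ht1 ht2
    rcases lt_or_gt_of_ne hij with h1 | h1
    · exact absurd (hle i hi j hj h1) (not_le.2 (ht2.1.trans_le ht1.2))
    · exact absurd (hle j hj i hi h1) (not_le.2 (ht1.1.trans_le ht2.2))
  have hsub : {z : ℝ × ℝ | z ∈ Ω ×ˢ Ω ∧ 2 * h < ∫ x in z.1..z.2, g x} ⊆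
      ⋃ j ∈ S, (Ω ∩ Iic (a j)) ×ˢ (Ω ∩ Ici (a (j + 1))) := by
    rintro ⟨x, y⟩ ⟨⟨hx, hy⟩, hxy⟩
    simp only at hx hy hxy
    rw [hGsub x hx y hy] at hxy
    have hxylt : x < y := hGlt x hx y hy (by linarith)
    set j : ℤ := ⌊G x / h⌋ + 1 with hj
    have h1 : G x < j * h := by
      rw [hj, ← div_lt_iff₀ hh]; push_cast; exact Int.lt_floor_add_one _
    have h2 : (j : ℝ) * h ≤ G x + h := by
      have : (⌊G x / h⌋ : ℝ) * h ≤ G x := by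
        rw [← le_div_iff₀ hh]; exact Int.floor_le _
      rw [hj]; push_cast; linarith
    have hivt : ∀ c, G x < c → c < G y → ∃ t ∈ Ω, G t = c := by
      intro c hc1 hc2
      obtain ⟨t, ht, htc⟩ := intermediate_value_Icc hxylt.le (hGcont x hx y hy hxylt.le)
        ⟨hc1.le, hc2.le⟩
      exact ⟨t, hΩ.out hx hy ht, htc⟩
    have hP1 : P j := hivt _ h1 (by linarith)
    have hP2 : P (j + 1) := hivt _ (by push_cast; linarith) (by push_cast; linarith)
    simp only [mem_iUnion]
    refine ⟨j, ⟨hP1, hP2⟩, ⟨hx, ?_⟩, ⟨hy, ?_⟩⟩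
    · exact (hGlt _ hx _ (ha _ hP1).1 (by rw [(ha _ hP1).2]; exact h1)).le
    · refine (hGlt _ (ha _ hP2).1 _ hy ?_).le
      rw [(ha _ hP2).2]; push_cast; linarith
  calc ENNReal.ofReal h ^ s * μ {z | z ∈ Ω ×ˢ Ω ∧ 2 * h < ∫ x in z.1..z.2, g x}
      ≤ ENNReal.ofReal h ^ s * ∑' j : S, μ ((Ω ∩ Iic (a j)) ×ˢ (Ω ∩ Ici (a (j + 1)))) := by
        gcongr
        exact (measure_mono hsub).trans (measure_biUnion_le μ hSc _)
    _ = ∑' j : S, ENNReal.ofReal h ^ s * μ ((Ω ∩ Iic (a j)) ×ˢ (Ω ∩ Ici (a (j + 1)))) :=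
        ENNReal.tsum_mul_left.symm
    _ ≤ ∑' j : S, K * ∫⁻ x in Ioc (a j) (a (j + 1)), ENNReal.ofReal (g x) ^ s := by
        refine ENNReal.tsum_le_tsum fun ⟨j, hj⟩ => ?_
        have h1 := ha _ hj.1
        have h2 := ha _ hj.2
        have h3 := ofReal_intervalIntegral_rpow_le hg hg0 (hlt j hj).le hs (hint _ h1.1 _ h2.1)
        rw [hGsub _ h1.1 _ h2.1, h1.2, h2.2] at h3
        have h4 : ((j + 1 : ℤ) : ℝ) * h - j * h = h := by push_cast; ring
        rw [h4] at h3
        calc _ ≤ _ := mul_le_mul_left h3 _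
          _ = (μ ((Ω ∩ Iic (a j)) ×ˢ (Ω ∩ Ici (a (j + 1)))) *
                ENNReal.ofReal (a (j + 1) - a j) ^ (s - 1)) *
              ∫⁻ x in Ioc (a j) (a (j + 1)), ENNReal.ofReal (g x) ^ s := by ring
          _ ≤ _ := mul_le_mul_left (hμ _ h1.1 _ h2.1 (hlt j hj)) _
    _ = K * ∫⁻ x in ⋃ j ∈ S, Ioc (a j) (a (j + 1)), ENNReal.ofReal (g x) ^ s := by
        rw [ENNReal.tsum_mul_left, lintegral_biUnion hSc (fun _ _ => measurableSet_Ioc) hdisj]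
    _ ≤ K * ∫⁻ x in Ω, ENNReal.ofReal (g x) ^ s := by
        gcongr
        refine iUnion₂_subset fun j hj => ?_
        exact Ioc_subset_Icc_self.trans (hΩ.out (ha _ hj.1).1 (ha _ hj.2).1)

/-- The function `f`, cut off to zero where `t * f ^ (p - 1)` exceeds `c`. -/
def cutoff (f : ℝ → ℝ) (p c t x : ℝ) : ℝ := if t * f x ^ (p - 1) ≤ c then f x else 0

theorem measurable_cutoff {f : ℝ → ℝ} (hf : Measurable f) (p c : ℝ) :
    Measurable fun z : ℝ × ℝ => cutoff f p c z.1 z.2 := by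
  unfold cutoff
  refine Measurable.ite (measurableSet_le ?_ measurable_const) (hf.comp measurable_snd)
    measurable_const
  exact measurable_fst.mul ((hf.comp measurable_snd).pow_const _)

theorem cutoff_nonneg {f : ℝ → ℝ} (hf0 : 0 ≤ f) (p c t : ℝ) : 0 ≤ cutoff f p c t := by
  intro x
  unfold cutoff
  split_ifs
  exacts [hf0 x, le_rfl]

theorem cutoff_le {f : ℝ → ℝ} (hf0 : 0 ≤ f) (p c t x : ℝ) : cutoff f p c t x ≤ f x := by
  unfold cutoff
  split_ifs
  exacts [le_rfl, hf0 x]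

theorem sub_cutoff_le {f : ℝ → ℝ} (hf0 : 0 ≤ f) {p c t : ℝ} (hc : 0 < c) (hp : 1 < p)
    (ht : 0 ≤ t) (x : ℝ) : f x - cutoff f p c t x ≤ t / c * f x ^ p := by
  have hx : 0 ≤ f x := hf0 x
  unfold cutoff
  split_ifs with h
  · rw [sub_self]; positivity
  · push Not at h
    have h1 : f x ^ p = f x ^ (p - 1) * f x := by
      rcases hx.eq_or_lt with h0 | h0
      · rw [← h0, Real.zero_rpow (by linarith), mul_zero]
      · rw [← Real.rpow_add_one h0.ne']; congr 1; ring
    rw [sub_zero, h1, div_mul_eq_mul_div, le_div_iff₀ hc, ← mul_assoc, mul_comm (f x) c]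
    exact mul_le_mul_of_nonneg_right h.le hx

theorem meas_lt_intervalIntegral_le_cutoff {Ω : Set ℝ} (hΩ : Ω.OrdConnected)
    {μ : Measure (ℝ × ℝ)} {K : ℝ≥0∞} {s p A t : ℝ} (hs : 1 < s) (hp : 1 < p) (hA : 0 < A)
    (ht : 0 < t)
    (hμ : ∀ a ∈ Ω, ∀ b ∈ Ω, a < b →
      μ ((Ω ∩ Iic a) ×ˢ (Ω ∩ Ici b)) * ENNReal.ofReal (b - a) ^ (s - 1) ≤ K)
    {f : ℝ → ℝ} (hf : Measurable f) (hf0 : 0 ≤ f)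
    (hint : ∀ x ∈ Ω, ∀ y ∈ Ω, IntervalIntegrable f volume x y)
    (hfA : ∫⁻ x in Ω, ENNReal.ofReal (f x ^ p) ≤ ENNReal.ofReal A) :
    ENNReal.ofReal (t / 4) ^ s * μ {z | z ∈ Ω ×ˢ Ω ∧ t < ∫ x in z.1..z.2, f x} ≤
      K * ∫⁻ x in Ω, ENNReal.ofReal (cutoff f p (2 * A) t x) ^ s := by
  set g := cutoff f p (2 * A) t with hg
  have hgm : Measurable g :=
    (measurable_cutoff hf p (2 * A)).comp (measurable_const.prodMk measurable_id)
  have hg0 : 0 ≤ g := cutoff_nonneg hf0 _ _ _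
  have hgf : ∀ x, g x ≤ f x := cutoff_le hf0 _ _ _
  have hgint : ∀ x ∈ Ω, ∀ y ∈ Ω, IntervalIntegrable g volume x y := fun x hx y hy =>
    (hint x hx y hy).mono_fun hgm.aestronglyMeasurable <| Eventually.of_forall fun z => by
      simpa only [Real.norm_of_nonneg (hg0 z), Real.norm_of_nonneg (hf0 z)] using hgf z
  refine le_trans ?_ (meas_lt_intervalIntegral_le hΩ hs hμ hgm hg0 hgint
    (show 0 < t / 4 by linarith))
  gcongr 1
  refine measure_mono ?_
  rintro ⟨x, y⟩ ⟨hxy, hlt⟩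
  refine ⟨hxy, ?_⟩
  obtain ⟨hx, hy⟩ := hxy
  simp only at hx hy hlt ⊢
  have hle : x ≤ y := by
    by_contra! hyx
    have := intervalIntegral.integral_nonneg (f := f) (μ := volume) hyx.le (fun t _ => hf0 t)
    rw [intervalIntegral.integral_symm] at this
    linarith
  have hdiff : ∫ z in x..y, (f z - g z) ≤ t / 2 := by
    have hi : IntegrableOn (fun z => f z - g z) (Ioc x y) :=
      (intervalIntegrable_iff_integrableOn_Ioc_of_le hle).1 ((hint x hx y hy).sub (hgint x hx y hy))
    rw [intervalIntegral.integral_of_le hle, ← ENNReal.ofReal_le_ofReal_iff (by positivity),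
      ofReal_integral_eq_lintegral_ofReal hi (Eventually.of_forall fun z => sub_nonneg.2 (hgf z))]
    calc ∫⁻ z in Ioc x y, ENNReal.ofReal (f z - g z)
        ≤ ∫⁻ z in Ioc x y, ENNReal.ofReal (t / (2 * A)) * ENNReal.ofReal (f z ^ p) := by
          refine lintegral_mono fun z => ?_
          rw [← ENNReal.ofReal_mul (by positivity)]
          exact ENNReal.ofReal_le_ofReal (sub_cutoff_le hf0 (by linarith) hp ht.le z)
      _ ≤ ∫⁻ z in Ω, ENNReal.ofReal (t / (2 * A)) * ENNReal.ofReal (f z ^ p) :=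
          lintegral_mono_set (Ioc_subset_Icc_self.trans (hΩ.out hx hy))
      _ ≤ ENNReal.ofReal (t / (2 * A)) * ENNReal.ofReal A := by
          rw [lintegral_const_mul _ (hf.pow_const p).ennreal_ofReal]
          gcongr
      _ = ENNReal.ofReal (t / 2) := by
          rw [← ENNReal.ofReal_mul (by positivity)]; congr 1; field_simp
  rw [intervalIntegral.integral_sub (hint x hx y hy) (hgint x hx y hy)] at hdiff
  linarith

theorem lintegral_rpow_mul_cutoff_le {f : ℝ → ℝ} (hf0 : 0 ≤ f) {p q s c : ℝ} (hc : 0 < c)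
    (hs : 0 < s) (hsq : s < q) (hpqs : s + (1 - p) * (q - s) = p) (x : ℝ) :
    ∫⁻ t in Ioi (0 : ℝ), ENNReal.ofReal (t ^ (q - s - 1)) * ENNReal.ofReal (cutoff f p c t x) ^ s ≤
      ENNReal.ofReal (c ^ (q - s) / (q - s)) * ENNReal.ofReal (f x ^ p) := by
  have hqs : 0 < q - s := by linarith
  rcases (show 0 ≤ f x from hf0 x).eq_or_lt with h0 | h0
  · have : ∀ t, cutoff f p c t x = 0 := fun t => by unfold cutoff; rw [← h0]; simp
    simp [this, ENNReal.zero_rpow_of_pos hs]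
  set M := c / f x ^ (p - 1) with hM
  have hypos : 0 < f x ^ (p - 1) := Real.rpow_pos_of_pos h0 _
  have hM0 : 0 < M := by positivity
  have hI : IntegrableOn (fun t : ℝ => t ^ (q - s - 1) * f x ^ s) (Ioc 0 M) :=
    (intervalIntegrable_iff_integrableOn_Ioc_of_le hM0.le).1
      ((intervalIntegral.intervalIntegrable_rpow' (by linarith)).mul_const _)
  calc _ ≤ ∫⁻ t in Ioi (0 : ℝ), (Ioc 0 M).indicator
          (fun t => ENNReal.ofReal (t ^ (q - s - 1) * f x ^ s)) t := by
        refine setLIntegral_mono' measurableSet_Ioi fun t ht => ?_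
        by_cases h : t * f x ^ (p - 1) ≤ c
        · have hmem : t ∈ Ioc 0 M := ⟨ht, (le_div_iff₀ hypos).2 h⟩
          rw [indicator_of_mem hmem, cutoff, if_pos h,
            ENNReal.ofReal_rpow_of_pos h0, ← ENNReal.ofReal_mul (Real.rpow_nonneg (le_of_lt ht) _)]
        · rw [cutoff, if_neg h, ENNReal.ofReal_zero, ENNReal.zero_rpow_of_pos hs, mul_zero]
          exact zero_le
    _ ≤ ∫⁻ t in Ioc 0 M, ENNReal.ofReal (t ^ (q - s - 1) * f x ^ s) := by
        rw [← lintegral_indicator measurableSet_Ioc]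
        exact setLIntegral_le_lintegral _ _
    _ = ENNReal.ofReal (M ^ (q - s) / (q - s) * f x ^ s) := by
        rw [← ofReal_integral_eq_lintegral_ofReal hI, ← intervalIntegral.integral_of_le hM0.le,
          intervalIntegral.integral_mul_const, integral_rpow (Or.inl (by linarith)),
          sub_add_cancel, Real.zero_rpow hqs.ne', sub_zero]
        filter_upwards [ae_restrict_mem measurableSet_Ioc] with t ht
        exact mul_nonneg (Real.rpow_nonneg ht.1.le _) (Real.rpow_nonneg h0.le _)
    _ = _ := by
        rw [← ENNReal.ofReal_mul (by positivity), hM, Real.div_rpow hc.le hypos.le,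
          ← Real.rpow_mul h0.le]
        congr 1
        have : f x ^ p = f x ^ s / f x ^ ((p - 1) * (q - s)) := by
          rw [← Real.rpow_sub h0]; congr 1; linarith
        rw [this]; ring

theorem lintegral_rpow_le_of_meas_lt_le_cutoff {α : Type*} [MeasurableSpace α] {ν : Measure α}
    {F : α → ℝ} (hF : AEMeasurable F ν) (hF0 : 0 ≤ F) {Ω : Set ℝ} {f : ℝ → ℝ} (hf : Measurable f)
    (hf0 : 0 ≤ f) {K : ℝ≥0∞} {p q s c : ℝ} (hc : 0 < c)
    (hs : 0 < s) (hsq : s < q) (hpqs : s + (1 - p) * (q - s) = p)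
    (hν : ∀ t : ℝ, 0 < t → ENNReal.ofReal (t / 4) ^ s * ν {z | t < F z} ≤
      K * ∫⁻ x in Ω, ENNReal.ofReal (cutoff f p c t x) ^ s) :
    ∫⁻ z, ENNReal.ofReal (F z ^ q) ∂ν ≤
      ENNReal.ofReal (q * 4 ^ s * (c ^ (q - s) / (q - s))) * K *
        ∫⁻ x in Ω, ENNReal.ofReal (f x ^ p) := by
  have hq : 0 < q := hs.trans hsq
  have hqs : 0 < q - s := by linarith
  have hcm : ∀ t : ℝ, Measurable fun x => ENNReal.ofReal (cutoff f p c t x) ^ s := fun t =>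
    ((measurable_cutoff hf p c).comp
      (measurable_const.prodMk measurable_id)).ennreal_ofReal.pow_const s
  have hjm : Measurable fun z : ℝ × ℝ =>
      ENNReal.ofReal (z.1 ^ (q - s - 1)) * ENNReal.ofReal (cutoff f p c z.1 z.2) ^ s :=
    (measurable_fst.pow_const _).ennreal_ofReal.mul
      ((measurable_cutoff hf p c).ennreal_ofReal.pow_const s)
  rw [lintegral_rpow_eq_lintegral_meas_lt_mul ν (Eventually.of_forall hF0) hF hq]
  have key : ∀ t ∈ Ioi (0 : ℝ), ν {a | t < F a} * ENNReal.ofReal (t ^ (q - 1)) ≤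
      ENNReal.ofReal (4 ^ s) * K * ∫⁻ x in Ω,
        ENNReal.ofReal (t ^ (q - s - 1)) * ENNReal.ofReal (cutoff f p c t x) ^ s := by
    intro t ht
    have ht : 0 < t := ht
    have h1 : t ^ (q - 1) = 4 ^ s * t ^ (q - s - 1) * (t / 4) ^ s := by
      rw [Real.div_rpow ht.le (by norm_num), show q - 1 = (q - s - 1) + s by ring,
        Real.rpow_add ht]
      field_simp
    rw [lintegral_const_mul _ (hcm t), h1, ENNReal.ofReal_mul (by positivity),
      ENNReal.ofReal_mul (by positivity), ← ENNReal.ofReal_rpow_of_pos (by positivity : 0 < t / 4)]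
    calc _ = ENNReal.ofReal (4 ^ s) * ENNReal.ofReal (t ^ (q - s - 1)) *
          (ENNReal.ofReal (t / 4) ^ s * ν {z | t < F z}) := by ring
      _ ≤ ENNReal.ofReal (4 ^ s) * ENNReal.ofReal (t ^ (q - s - 1)) *
          (K * ∫⁻ x in Ω, ENNReal.ofReal (cutoff f p c t x) ^ s) := by
        exact mul_le_mul_right (hν t ht) _
      _ = _ := by ring
  calc _ ≤ ENNReal.ofReal q * ∫⁻ t in Ioi (0 : ℝ), ENNReal.ofReal (4 ^ s) * K * ∫⁻ x in Ω,
        ENNReal.ofReal (t ^ (q - s - 1)) * ENNReal.ofReal (cutoff f p c t x) ^ s := by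
        gcongr 1
        exact setLIntegral_mono' measurableSet_Ioi key
    _ = ENNReal.ofReal q * (ENNReal.ofReal (4 ^ s) * K * ∫⁻ x in Ω, ∫⁻ t in Ioi (0 : ℝ),
        ENNReal.ofReal (t ^ (q - s - 1)) * ENNReal.ofReal (cutoff f p c t x) ^ s) := by
        rw [lintegral_const_mul _ hjm.lintegral_prod_right',
          lintegral_lintegral_swap hjm.aemeasurable]
    _ ≤ ENNReal.ofReal q * (ENNReal.ofReal (4 ^ s) * K *
        ∫⁻ x in Ω, ENNReal.ofReal (c ^ (q - s) / (q - s)) * ENNReal.ofReal (f x ^ p)) := by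
        gcongr with x
        exact lintegral_rpow_mul_cutoff_le hf0 hc hs hsq hpqs x
    _ = _ := by
        rw [lintegral_const_mul _ (hf.pow_const p).ennreal_ofReal,
          ENNReal.ofReal_mul (by positivity), ENNReal.ofReal_mul (by positivity)]
        ring

theorem lintegral_abs_sub_rpow_le {Ω : Set ℝ} (hΩo : IsOpen Ω) (hΩ : Ω.OrdConnected)
    {μ : Measure (ℝ × ℝ)} {K : ℝ≥0∞} (hK0 : K ≠ 0) {p q s : ℝ} (hp : 1 < p) (hs : 1 < s)
    (hsq : s < q) (hpqs : s + (1 - p) * (q - s) = p)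
    (hμ : ∀ a ∈ Ω, ∀ b ∈ Ω, a < b →
      μ ((Ω ∩ Iic a) ×ˢ (Ω ∩ Ici b)) * ENNReal.ofReal (b - a) ^ (s - 1) ≤ K)
    (hμ' : ∀ a ∈ Ω, ∀ b ∈ Ω, a < b →
      μ ((Ω ∩ Ici b) ×ˢ (Ω ∩ Iic a)) * ENNReal.ofReal (b - a) ^ (s - 1) ≤ K)
    {u : ℝ → ℝ} (hu : ContDiffOn ℝ 1 u Ω) :
    ∫⁻ z in Ω ×ˢ Ω, ENNReal.ofReal (|u z.1 - u z.2| ^ q) ∂μ ≤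
      ENNReal.ofReal (q * 4 ^ s * (2 ^ (q - s) / (q - s))) * (2 * K) *
        (∫⁻ x in Ω, ENNReal.ofReal (|deriv u x| ^ p)) ^ (q / p) := by
  have hq : 0 < q := by linarith
  have hqs : 0 < q - s := by linarith
  have hp0 : 0 < p := by linarith
  have hqp : q - s + 1 = q / p := by
    field_simp; linarith
  set f : ℝ → ℝ := fun x => |deriv u x| with hfdef
  have hf : Measurable f := (measurable_deriv u).abs
  have hf0 : 0 ≤ f := fun x => abs_nonneg _
  have hdc : ContinuousOn (deriv u) Ω := hu.continuousOn_deriv_of_isOpen hΩo le_rfl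
  have hdint : ∀ x ∈ Ω, ∀ y ∈ Ω, IntervalIntegrable (deriv u) volume x y := fun x hx y hy =>
    (hdc.mono (hΩ.uIcc_subset hx hy)).intervalIntegrable
  have hint : ∀ x ∈ Ω, ∀ y ∈ Ω, IntervalIntegrable f volume x y := fun x hx y hy =>
    (hdint x hx y hy).norm
  have hftc : ∀ x ∈ Ω, ∀ y ∈ Ω, x ≤ y → |u y - u x| ≤ ∫ t in x..y, f t := by
    intro x hx y hy hxy
    rw [← intervalIntegral.integral_eq_sub_of_hasDerivAt (f := u) (f' := deriv u) (fun t ht =>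
      ((hu.differentiableOn one_ne_zero).differentiableAt
        (hΩo.mem_nhds (hΩ.uIcc_subset hx hy ht))).hasDerivAt) (hdint x hx y hy)]
    exact intervalIntegral.norm_integral_le_integral_norm (f := deriv u) (μ := volume) hxy
  have hΩm : MeasurableSet (Ω ×ˢ Ω) := (hΩo.prod hΩo).measurableSet
  have hFm : AEMeasurable (fun z : ℝ × ℝ => |u z.1 - u z.2|) (μ.restrict (Ω ×ˢ Ω)) := by
    refine ContinuousOn.aemeasurable ?_ hΩm
    exact ((hu.continuousOn.comp continuousOn_fst fun z hz => hz.1).sub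
      (hu.continuousOn.comp continuousOn_snd fun z hz => hz.2)).abs
  have main : ∀ A : ℝ, 0 < A → ∫⁻ x in Ω, ENNReal.ofReal (f x ^ p) ≤ ENNReal.ofReal A →
      ∫⁻ z in Ω ×ˢ Ω, ENNReal.ofReal (|u z.1 - u z.2| ^ q) ∂μ ≤
        ENNReal.ofReal (q * 4 ^ s * ((2 * A) ^ (q - s) / (q - s))) * (2 * K) *
          ∫⁻ x in Ω, ENNReal.ofReal (f x ^ p) := by
    intro A hA hfA
    refine lintegral_rpow_le_of_meas_lt_le_cutoff hFm (fun z => abs_nonneg _) hf hf0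
      (by positivity) (by linarith) hsq hpqs fun t ht => ?_
    have hswap : ∀ E : Set (ℝ × ℝ), μ.map Prod.swap E = μ (Prod.swap ⁻¹' E) := fun E =>
      MeasurableEquiv.map_apply MeasurableEquiv.prodComm E
    have h1 := meas_lt_intervalIntegral_le_cutoff hΩ hs hp hA ht hμ hf hf0 hint hfA
    have h2 := meas_lt_intervalIntegral_le_cutoff hΩ (μ := μ.map Prod.swap) (K := K)
      hs hp hA ht (by
        intro a ha b hb hab
        rw [hswap, preimage_swap_prod]
        exact hμ' a ha b hb hab) hf hf0 hint hfA
    rw [hswap] at h2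
    rw [Measure.restrict_apply' hΩm]
    calc _ ≤ ENNReal.ofReal (t / 4) ^ s *
          (μ {z | z ∈ Ω ×ˢ Ω ∧ t < ∫ x in z.1..z.2, f x} +
            μ (Prod.swap ⁻¹' {z | z ∈ Ω ×ˢ Ω ∧ t < ∫ x in z.1..z.2, f x})) := by
          gcongr 1
          refine (measure_mono ?_).trans (measure_union_le _ _)
          rintro ⟨x, y⟩ ⟨hlt, hx, hy⟩
          have hlt : t < |u x - u y| := hlt
          rcases le_total x y with hxy | hxy
          · left
            rw [abs_sub_comm] at hlt
            exact ⟨⟨hx, hy⟩, hlt.trans_le (hftc x hx y hy hxy)⟩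
          · right
            exact ⟨⟨hy, hx⟩, hlt.trans_le (hftc y hy x hx hxy)⟩
      _ ≤ _ := by
          rw [mul_add, two_mul, add_mul]
          exact add_le_add h1 h2
  have hconst : 0 < q * 4 ^ s * (2 ^ (q - s) / (q - s)) := by positivity
  rcases eq_or_ne (∫⁻ x in Ω, ENNReal.ofReal (f x ^ p)) 0 with h0 | h0
  · have := main 1 one_pos (by rw [h0]; exact zero_le)
    rw [h0, mul_zero] at this
    exact this.trans zero_le
  rcases eq_or_ne (∫⁻ x in Ω, ENNReal.ofReal (f x ^ p)) ⊤ with ht | ht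
  · rw [ht, ENNReal.top_rpow_of_pos (by positivity), ENNReal.mul_top]
    · exact le_top
    · exact mul_ne_zero (ENNReal.ofReal_pos.2 hconst).ne' (mul_ne_zero two_ne_zero hK0)
  have hA := ENNReal.toReal_pos h0 ht
  have hAe := ENNReal.ofReal_toReal ht
  refine (main _ hA hAe.ge).trans_eq ?_
  rw [← hqp, ENNReal.rpow_add _ _ h0 ht, ENNReal.rpow_one]
  set D := ∫⁻ x in Ω, ENNReal.ofReal (f x ^ p)
  have : q * 4 ^ s * ((2 * D.toReal) ^ (q - s) / (q - s)) =
      q * 4 ^ s * (2 ^ (q - s) / (q - s)) * D.toReal ^ (q - s) := by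
    rw [Real.mul_rpow (by norm_num) hA.le]; ring
  rw [this, ENNReal.ofReal_mul hconst.le, ← ENNReal.ofReal_rpow_of_pos hA, hAe]
  ring

theorem deriv_smoothTransition_eq_zero {t : ℝ} (ht : t ∉ Icc (0 : ℝ) 1) :
    deriv Real.smoothTransition t = 0 := by
  rw [mem_Icc, not_and_or, not_le, not_le] at ht
  rcases ht with ht | ht
  · have : Real.smoothTransition =ᶠ[𝓝 t] fun _ => 0 := by
      filter_upwards [Iio_mem_nhds ht] with x hx
      exact Real.smoothTransition.zero_of_nonpos (le_of_lt hx)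
    rw [this.deriv_eq, deriv_const]
  · have : Real.smoothTransition =ᶠ[𝓝 t] fun _ => 1 := by
      filter_upwards [Ioi_mem_nhds ht] with x hx
      exact Real.smoothTransition.one_of_one_le (le_of_lt hx)
    rw [this.deriv_eq, deriv_const]

theorem exists_abs_deriv_smoothTransition_le :
    ∃ M : ℝ, 0 ≤ M ∧ ∀ t, |deriv Real.smoothTransition t| ≤ M := by
  have hcd : ContDiff ℝ 1 Real.smoothTransition := Real.smoothTransition.contDiff (n := 1)
  have hc : Continuous (deriv Real.smoothTransition) := hcd.continuous_deriv le_rfl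
  obtain ⟨M, hM⟩ := isCompact_Icc.exists_bound_of_continuousOn (s := Icc (0 : ℝ) 1) hc.continuousOn
  refine ⟨M, (norm_nonneg _).trans (hM 0 (by simp)), fun t => ?_⟩
  by_cases ht : t ∈ Icc (0 : ℝ) 1
  · exact hM t ht
  · rw [deriv_smoothTransition_eq_zero ht, abs_zero]
    exact (norm_nonneg _).trans (hM 0 (by simp))

/-- A smooth step from `0` on `(-∞, a]` to `1` on `[a + r, ∞)`. -/
def smoothStep (a r t : ℝ) : ℝ := Real.smoothTransition ((t - a) / r)

theorem contDiff_smoothStep (a r : ℝ) : ContDiff ℝ (⊤ : ℕ∞) (smoothStep a r) :=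
  Real.smoothTransition.contDiff.comp ((contDiff_id.sub contDiff_const).div_const r)

theorem smoothStep_eq_zero {a r t : ℝ} (hr : 0 < r) (ht : t ≤ a) : smoothStep a r t = 0 :=
  Real.smoothTransition.zero_of_nonpos (div_nonpos_of_nonpos_of_nonneg (by linarith) hr.le)

theorem smoothStep_eq_one {a r t : ℝ} (hr : 0 < r) (ht : a + r ≤ t) : smoothStep a r t = 1 :=
  Real.smoothTransition.one_of_one_le (by rw [le_div_iff₀ hr]; linarith)

theorem deriv_smoothStep (a r t : ℝ) :
    deriv (smoothStep a r) t = deriv Real.smoothTransition ((t - a) / r) / r := by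
  have hd : DifferentiableAt ℝ Real.smoothTransition ((t - a) / r) :=
    ((Real.smoothTransition.contDiff (n := 1)).differentiable one_ne_zero).differentiableAt
  have := hd.hasDerivAt.comp t (((hasDerivAt_id t).sub_const a).div_const r)
  rw [mul_one_div] at this
  exact this.deriv

theorem deriv_smoothStep_eq_zero {a r t : ℝ} (hr : 0 < r) (ht : t ∉ Icc a (a + r)) :
    deriv (smoothStep a r) t = 0 := by
  rw [deriv_smoothStep, deriv_smoothTransition_eq_zero, zero_div]
  contrapose! ht
  rw [mem_Icc, le_div_iff₀ hr, div_le_iff₀ hr] at ht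
  constructor <;> linarith [ht.1, ht.2]

theorem abs_deriv_smoothStep_le {M : ℝ} (hM : ∀ t, |deriv Real.smoothTransition t| ≤ M)
    {r : ℝ} (hr : 0 < r) (a t : ℝ) : |deriv (smoothStep a r) t| ≤ M / r := by
  rw [deriv_smoothStep, abs_div, abs_of_pos hr]
  gcongr
  exact hM _

theorem ofReal_mul_measure_rpow_le {Ω : Set ℝ} {μ : Measure (ℝ × ℝ)} {C p q : ℝ}
    (hC : 0 ≤ C) (hp : 0 < p) (hq : 0 < q) {u : ℝ → ℝ}
    (hu : (∫⁻ z in Ω ×ˢ Ω, ENNReal.ofReal (|u z.1 - u z.2| ^ q) ∂μ) ^ (1 / q) ≤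
      ENNReal.ofReal C * (∫⁻ x in Ω, ENNReal.ofReal (|deriv u x| ^ p)) ^ (1 / p))
    {E : Set (ℝ × ℝ)} (hE : MeasurableSet E) (hEΩ : E ⊆ Ω ×ˢ Ω)
    (hone : ∀ z ∈ E, |u z.1 - u z.2| = 1) {N r : ℝ} (hN : 0 ≤ N) (hr : 0 < r)
    (hbd : ∀ t, |deriv u t| ≤ N / r) {T : Set ℝ} (hT : MeasurableSet T)
    (hzero : ∀ t, t ∉ T → deriv u t = 0) (hvol : volume T ≤ ENNReal.ofReal (2 * r)) :
    ENNReal.ofReal (r ^ ((p - 1) / p)) * μ E ^ (1 / q) ≤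
      ENNReal.ofReal (C * (2 ^ (1 / p) * N)) := by
  have hleft : μ E ≤ ∫⁻ z in Ω ×ˢ Ω, ENNReal.ofReal (|u z.1 - u z.2| ^ q) ∂μ := by
    calc μ E = ∫⁻ z in E, 1 ∂μ := by simp
      _ = ∫⁻ z in E, ENNReal.ofReal (|u z.1 - u z.2| ^ q) ∂μ :=
        setLIntegral_congr_fun hE fun z hz => by simp [hone z hz]
      _ ≤ _ := lintegral_mono_set hEΩ
  have hright : ∫⁻ x in Ω, ENNReal.ofReal (|deriv u x| ^ p) ≤
      ENNReal.ofReal ((N / r) ^ p * (2 * r)) := by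
    calc _ ≤ ∫⁻ x, ENNReal.ofReal (|deriv u x| ^ p) := setLIntegral_le_lintegral _ _
      _ ≤ ∫⁻ x, T.indicator (fun _ => ENNReal.ofReal ((N / r) ^ p)) x := by
        refine lintegral_mono fun x => ?_
        by_cases hx : x ∈ T
        · simp only [indicator_of_mem hx]
          exact ENNReal.ofReal_le_ofReal (Real.rpow_le_rpow (abs_nonneg _) (hbd x) hp.le)
        · simp [hx, hzero x hx, Real.zero_rpow hp.ne']
      _ = ENNReal.ofReal ((N / r) ^ p) * volume T := lintegral_indicator_const hT _
      _ ≤ _ := by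
        rw [ENNReal.ofReal_mul (by positivity)]
        gcongr
  have hcomb : μ E ^ (1 / q) ≤ ENNReal.ofReal (C * ((N / r) ^ p * (2 * r)) ^ (1 / p)) := by
    calc _ ≤ _ := ENNReal.rpow_le_rpow hleft (by positivity)
      _ ≤ _ := hu
      _ ≤ ENNReal.ofReal C * ENNReal.ofReal ((N / r) ^ p * (2 * r)) ^ (1 / p) := by gcongr
      _ = _ := by
        rw [ENNReal.ofReal_rpow_of_nonneg (by positivity) (by positivity), ← ENNReal.ofReal_mul hC]
  calc _ ≤ ENNReal.ofReal (r ^ ((p - 1) / p)) *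
        ENNReal.ofReal (C * ((N / r) ^ p * (2 * r)) ^ (1 / p)) := by gcongr
    _ = _ := by
      rw [← ENNReal.ofReal_mul (by positivity)]
      congr 1
      rw [Real.mul_rpow (by positivity) (by positivity), ← Real.rpow_mul (by positivity),
        mul_one_div_cancel hp.ne', Real.rpow_one, Real.mul_rpow (by norm_num) hr.le]
      have : r ^ ((p - 1) / p) * r ^ (1 / p) = r := by
        rw [← Real.rpow_add hr, ← add_div, sub_add_cancel, div_self hp.ne', Real.rpow_one]
      calc _ = C * (2 ^ (1 / p) * N) * (r ^ ((p - 1) / p) * r ^ (1 / p)) / r := by ring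
        _ = _ := by rw [this]; field_simp

theorem measure_mul_rpow_le_of_mul_rpow_le {m : ℝ≥0∞} {B r p q : ℝ} (hr : 0 < r) (hq : 0 < q)
    (h : ENNReal.ofReal (r ^ ((p - 1) / p)) * m ^ (1 / q) ≤ ENNReal.ofReal B) :
    m * ENNReal.ofReal r ^ (q * (p - 1) / p) ≤ ENNReal.ofReal B ^ q + 1 := by
  refine le_trans ?_ le_self_add
  refine le_trans (le_of_eq ?_) (ENNReal.rpow_le_rpow h hq.le)
  rw [ENNReal.mul_rpow_of_nonneg _ _ hq.le, ← ENNReal.rpow_mul, one_div_mul_cancel hq.ne',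
    ENNReal.rpow_one, ← ENNReal.ofReal_rpow_of_pos hr, ← ENNReal.rpow_mul, mul_comm]
  congr 2
  ring

/-- one-dimensional criterion, `q > p > 1`: on `Ω = (α,β)` the inequality
`(∬_{Ω×Ω}|u(x)−u(y)|^q dμ)^{1/q} ≤ C(∫_Ω |u′|^p)^{1/p}` holds for some finite `C` and
all `u ∈ C^∞(Ω)` iff `r^{(p−1)/p}·μ(I×(Ω∖J))^{1/q} ≤ B` for some finite `B` and all
pairs of intervals `(I,J)` of the three indicated types. -/
theorem stmt_16 (α β : EReal) (hαβ : α < β) (p q : ℝ) (hp : 1 < p) (hpq : p < q)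
    (Ω : Set ℝ) (hΩdef : Ω = {x : ℝ | α < (x : EReal) ∧ (x : EReal) < β})
    (μ : Measure (ℝ × ℝ))
    -- `μ` is locally finite outside the diagonal
    (hloc : ∀ K : Set (ℝ × ℝ), IsCompact K → K ⊆ Ω ×ˢ Ω → (∀ z ∈ K, z.1 ≠ z.2) →
      μ K < ⊤) :
    (∃ C : ℝ, 0 ≤ C ∧ ∀ u : ℝ → ℝ, ContDiffOn ℝ (⊤ : ℕ∞) u Ω →
      (∫⁻ z in Ω ×ˢ Ω, ENNReal.ofReal (|u z.1 - u z.2| ^ q) ∂μ) ^ (1 / q) ≤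
        ENNReal.ofReal C *
          (∫⁻ x in Ω, ENNReal.ofReal (|deriv u x| ^ p)) ^ (1 / p)) ↔
    (∃ B : ℝ, 0 ≤ B ∧
      -- type 1: `I = [x−d, x+d]`, `J = (x−d−r, x+d+r) ⊆ Ω`
      (∀ x d r : ℝ, 0 < d → 0 < r → Ioo (x - d - r) (x + d + r) ⊆ Ω →
        ENNReal.ofReal (r ^ ((p - 1) / p)) *
          (μ (Icc (x - d) (x + d) ×ˢ (Ω \ Ioo (x - d - r) (x + d + r)))) ^ (1 / q) ≤
            ENNReal.ofReal B) ∧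
      -- type 2: `I = (α, x]`, `J = (α, x+r) ⊆ Ω`
      (∀ x r : ℝ, 0 < r → α < (x : EReal) → ((x + r : ℝ) : EReal) ≤ β →
        ENNReal.ofReal (r ^ ((p - 1) / p)) *
          (μ ((Ω ∩ Iic x) ×ˢ (Ω ∩ Ici (x + r)))) ^ (1 / q) ≤ ENNReal.ofReal B) ∧
      -- type 3: `I = [x, β)`, `J = (x−r, β) ⊆ Ω`
      (∀ x r : ℝ, 0 < r → (x : EReal) < β → α ≤ ((x - r : ℝ) : EReal) →
        ENNReal.ofReal (r ^ ((p - 1) / p)) *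
          (μ ((Ω ∩ Ici x) ×ˢ (Ω ∩ Iic (x - r)))) ^ (1 / q) ≤ ENNReal.ofReal B)) := by
  have hp0 : 0 < p := by linarith
  have hq0 : 0 < q := by linarith
  have hΩo : IsOpen Ω := by
    rw [hΩdef]
    exact isOpen_Ioo.preimage continuous_coe_real_ereal
  have hΩc : Ω.OrdConnected := by
    rw [hΩdef]
    exact ⟨fun x hx y hy t ht => ⟨hx.1.trans_le (EReal.coe_le_coe_iff.2 ht.1),
      (EReal.coe_le_coe_iff.2 ht.2).trans_lt hy.2⟩⟩
  have hΩm := hΩo.measurableSet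
  constructor
  · rintro ⟨C, hC, hu⟩
    obtain ⟨M, hM0, hM⟩ := exists_abs_deriv_smoothTransition_le
    have hstep : ∀ a r : ℝ, 0 < r → ∀ E : Set (ℝ × ℝ), MeasurableSet E → E ⊆ Ω ×ˢ Ω →
        (∀ z ∈ E, |smoothStep a r z.1 - smoothStep a r z.2| = 1) →
        ENNReal.ofReal (r ^ ((p - 1) / p)) * μ E ^ (1 / q) ≤
          ENNReal.ofReal (C * (2 ^ (1 / p) * (2 * M))) := by
      intro a r hr E hE hEΩ hone
      refine ofReal_mul_measure_rpow_le hC hp0 hq0 (hu _ (contDiff_smoothStep a r).contDiffOn)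
        hE hEΩ hone (by positivity) hr (fun t => ?_) measurableSet_Icc
        (fun t ht => deriv_smoothStep_eq_zero hr ht) ?_
      · refine (abs_deriv_smoothStep_le hM hr a t).trans ?_
        gcongr
        linarith
      · rw [Real.volume_Icc]
        exact ENNReal.ofReal_le_ofReal (by linarith)
    refine ⟨C * (2 ^ (1 / p) * (2 * M)), by positivity, ?_, ?_, ?_⟩
    · intro x d r hd hr hJ
      have hd1 : Differentiable ℝ (smoothStep (x - d - r) r) :=
        (contDiff_smoothStep _ r).differentiable (by simp)
      have hd2 : Differentiable ℝ (smoothStep (x + d) r) :=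
        (contDiff_smoothStep _ r).differentiable (by simp)
      have hder : ∀ t, deriv (fun t => smoothStep (x - d - r) r t - smoothStep (x + d) r t) t =
          deriv (smoothStep (x - d - r) r) t - deriv (smoothStep (x + d) r) t := fun t =>
        deriv_fun_sub (hd1 t) (hd2 t)
      refine ofReal_mul_measure_rpow_le hC hp0 hq0
        (u := fun t => smoothStep (x - d - r) r t - smoothStep (x + d) r t)
        (hu _ ((contDiff_smoothStep _ r).sub (contDiff_smoothStep _ r)).contDiffOn)
        (measurableSet_Icc.prod (hΩm.diff measurableSet_Ioo))
        (prod_mono ((Icc_subset_Ioo (by linarith) (by linarith)).trans hJ) sdiff_subset)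
        ?_ (by positivity) hr (fun t => ?_)
        (T := Icc (x - d - r) (x - d - r + r) ∪ Icc (x + d) (x + d + r))
        (measurableSet_Icc.union measurableSet_Icc) (fun t ht => ?_) ?_
      · rintro ⟨y, z⟩ ⟨hy, -, hz⟩
        simp only [mem_Icc] at hy
        simp only [mem_Ioo, not_and_or, not_lt] at hz
        simp only
        rw [smoothStep_eq_one hr (by linarith : x - d - r + r ≤ y),
          smoothStep_eq_zero hr (by linarith : y ≤ x + d)]
        rcases hz with hz | hz
        · rw [smoothStep_eq_zero hr hz, smoothStep_eq_zero hr (by linarith : z ≤ x + d)]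
          norm_num
        · rw [smoothStep_eq_one hr hz, smoothStep_eq_one hr (by linarith : x - d - r + r ≤ z)]
          norm_num
      · rw [hder]
        refine (abs_sub _ _).trans ?_
        rw [two_mul, add_div]
        exact add_le_add (abs_deriv_smoothStep_le hM hr _ t) (abs_deriv_smoothStep_le hM hr _ t)
      · rw [mem_union, not_or] at ht
        rw [hder, deriv_smoothStep_eq_zero hr ht.1, deriv_smoothStep_eq_zero hr ht.2, sub_zero]
      · refine (measure_union_le _ _).trans ?_
        rw [Real.volume_Icc, Real.volume_Icc, ← ENNReal.ofReal_add (by linarith) (by linarith)]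
        exact ENNReal.ofReal_le_ofReal (by linarith)
    · intro x r hr _ _
      refine hstep x r hr _ ((hΩm.inter measurableSet_Iic).prod (hΩm.inter measurableSet_Ici))
        (prod_mono inter_subset_left inter_subset_left) ?_
      rintro ⟨y, z⟩ ⟨⟨-, hy⟩, -, hz⟩
      simp only
      rw [smoothStep_eq_zero hr hy, smoothStep_eq_one hr hz]
      norm_num
    · intro x r hr _ _
      refine hstep (x - r) r hr _
        ((hΩm.inter measurableSet_Ici).prod (hΩm.inter measurableSet_Iic))
        (prod_mono inter_subset_left inter_subset_left) ?_
      rintro ⟨y, z⟩ ⟨⟨-, hy⟩, -, hz⟩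
      simp only
      rw [smoothStep_eq_zero hr hz, smoothStep_eq_one hr (by simpa using hy)]
      norm_num
  · rintro ⟨B, hB, -, h2, h3⟩
    set s : ℝ := q * (p - 1) / p + 1 with hs
    have hs1 : 1 < s := by
      have : 0 < q * (p - 1) / p := div_pos (mul_pos hq0 (by linarith)) hp0
      linarith
    have hqs : q - s = q / p - 1 := by rw [hs]; field_simp; ring
    have hsq : s < q := by
      have : 1 < q / p := (one_lt_div hp0).2 hpq
      linarith
    have hpqs : s + (1 - p) * (q - s) = p := by rw [hqs, hs]; field_simp; ring
    set K : ℝ≥0∞ := ENNReal.ofReal B ^ q + 1 with hK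
    have hKtop : K ≠ ⊤ := by
      rw [hK]
      exact ENNReal.add_ne_top.2
        ⟨ENNReal.rpow_ne_top_of_nonneg hq0.le ENNReal.ofReal_ne_top, ENNReal.one_ne_top⟩
    have hK0 : K ≠ 0 := by rw [hK]; simp
    set L : ℝ≥0∞ := ENNReal.ofReal (q * 4 ^ s * (2 ^ (q - s) / (q - s))) * (2 * K) with hL
    have hLtop : L ^ (1 / q) ≠ ⊤ :=
      ENNReal.rpow_ne_top_of_nonneg (by positivity) (ENNReal.mul_ne_top ENNReal.ofReal_ne_top
        (ENNReal.mul_ne_top ENNReal.ofNat_ne_top hKtop))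
    refine ⟨(L ^ (1 / q)).toReal, ENNReal.toReal_nonneg, fun u hu => ?_⟩
    have key := lintegral_abs_sub_rpow_le hΩo hΩc (μ := μ) hK0 hp hs1 hsq hpqs
      (fun a ha b hb hab => by
        rw [hΩdef] at ha hb
        have := h2 a (b - a) (by linarith) ha.1 (by rw [add_sub_cancel]; exact hb.2.le)
        rw [add_sub_cancel] at this
        rw [hs, add_sub_cancel_right]
        exact measure_mul_rpow_le_of_mul_rpow_le (by linarith) hq0 this)
      (fun a ha b hb hab => by
        rw [hΩdef] at ha hb
        have := h3 b (b - a) (by linarith) hb.2 (by rw [sub_sub_cancel]; exact ha.1.le)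
        rw [sub_sub_cancel] at this
        rw [hs, add_sub_cancel_right]
        exact measure_mul_rpow_le_of_mul_rpow_le (by linarith) hq0 this)
      (hu.of_le (by exact_mod_cast le_top))
    calc _ ≤ _ := ENNReal.rpow_le_rpow key (by positivity)
      _ = _ := by
        rw [ENNReal.ofReal_toReal hLtop, ENNReal.mul_rpow_of_nonneg _ _ (by positivity),
          ← ENNReal.rpow_mul]
        congr 2
        field_simp
end
end
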